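/- arXiv:1602.04731 — 2 statements merged into one kernel-verified Lean document; each statement's English description precedes it below -/
import Mathlib

section
/- Let ζ be an extremal number. Then λ_4(ζ) ≥ (√5 − 1)/4. -/
open Polynomial

/-- Height of an integer polynomial: the maximum absolute value of its coefficients. -/
noncomputable def polyH (P : Polynomial ℤ) : ℝ :=
  (((P.support.sup fun i => (P.coeff i).natAbs) : ℕ) : ℝ)

/-- Evaluation of an integer polynomial at a real number. -/
noncomputable def pev (ζ : ℝ) (P : Polynomial ℤ) : ℝ := Polynomial.aeval ζ P

/-- Set of exponents η such that for arbitrarily large X the system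
    H(P) ≤ X, 0 < |P(ζ)| ≤ X^(−η) has a solution of degree at most n. -/
def wSet (n : ℕ) (ζ : ℝ) : Set ℝ :=
  {η | ∀ X₀ : ℝ, ∃ X : ℝ, X₀ ≤ X ∧ ∃ P : Polynomial ℤ,
    P.natDegree ≤ n ∧ polyH P ≤ X ∧ 0 < |pev ζ P| ∧ |pev ζ P| ≤ X ^ (-η)}

/-- The exponent w_n(ζ). -/
noncomputable def wExp (n : ℕ) (ζ : ℝ) : ℝ := sSup (wSet n ζ)

/-- Set of exponents η such that for all sufficiently large X the system
    H(P) ≤ X, 0 < |P(ζ)| ≤ X^(−η) has a solution of degree at most n. -/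
def whSet (n : ℕ) (ζ : ℝ) : Set ℝ :=
  {η | ∃ X₀ : ℝ, ∀ X : ℝ, X₀ ≤ X → ∃ P : Polynomial ℤ,
    P.natDegree ≤ n ∧ polyH P ≤ X ∧ 0 < |pev ζ P| ∧ |pev ζ P| ≤ X ^ (-η)}

/-- The uniform exponent ŵ_n(ζ). -/
noncomputable def whExp (n : ℕ) (ζ : ℝ) : ℝ := sSup (whSet n ζ)

/-- Set of exponents η such that for arbitrarily large X the system
    |x| ≤ X, max_{1≤i≤n} |ζ^i x − y_i| ≤ X^(−η) has a nonzero integer solution. -/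
def lamSet (n : ℕ) (ζ : ℝ) : Set ℝ :=
  {η | ∀ X₀ : ℝ, ∃ X : ℝ, X₀ ≤ X ∧ ∃ x : ℤ, ∃ y : Fin n → ℤ,
    (x ≠ 0 ∨ y ≠ 0) ∧ ((|x| : ℤ) : ℝ) ≤ X ∧
    ∀ i : Fin n, |ζ ^ ((i : ℕ) + 1) * (x : ℝ) - (y i : ℝ)| ≤ X ^ (-η)}

/-- The exponent λ_n(ζ). -/
noncomputable def lamExp (n : ℕ) (ζ : ℝ) : ℝ := sSup (lamSet n ζ)

/-- Set of exponents η such that for all sufficiently large X the system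
    |x| ≤ X, max_{1≤i≤n} |ζ^i x − y_i| ≤ X^(−η) has a nonzero integer solution. -/
def lamhSet (n : ℕ) (ζ : ℝ) : Set ℝ :=
  {η | ∃ X₀ : ℝ, ∀ X : ℝ, X₀ ≤ X → ∃ x : ℤ, ∃ y : Fin n → ℤ,
    (x ≠ 0 ∨ y ≠ 0) ∧ ((|x| : ℤ) : ℝ) ≤ X ∧
    ∀ i : Fin n, |ζ ^ ((i : ℕ) + 1) * (x : ℝ) - (y i : ℝ)| ≤ X ^ (-η)}

/-- The uniform exponent λ̂_n(ζ). -/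
noncomputable def lamhExp (n : ℕ) (ζ : ℝ) : ℝ := sSup (lamhSet n ζ)

/-- Set of exponents η such that for arbitrarily large X the polynomial system has
    at least j linearly independent solutions of degree at most n. -/
def wSetJ (n j : ℕ) (ζ : ℝ) : Set ℝ :=
  {η | ∀ X₀ : ℝ, ∃ X : ℝ, X₀ ≤ X ∧ ∃ P : Fin j → Polynomial ℤ,
    LinearIndependent ℤ P ∧ ∀ i : Fin j,
      (P i).natDegree ≤ n ∧ polyH (P i) ≤ X ∧ 0 < |pev ζ (P i)| ∧ |pev ζ (P i)| ≤ X ^ (-η)}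

/-- The exponent w_{n,j}(ζ). -/
noncomputable def wExpJ (n j : ℕ) (ζ : ℝ) : ℝ := sSup (wSetJ n j ζ)

/-- Set of exponents η such that for all sufficiently large X the polynomial system has
    at least j linearly independent solutions of degree at most n. -/
def whSetJ (n j : ℕ) (ζ : ℝ) : Set ℝ :=
  {η | ∃ X₀ : ℝ, ∀ X : ℝ, X₀ ≤ X → ∃ P : Fin j → Polynomial ℤ,
    LinearIndependent ℤ P ∧ ∀ i : Fin j,
      (P i).natDegree ≤ n ∧ polyH (P i) ≤ X ∧ 0 < |pev ζ (P i)| ∧ |pev ζ (P i)| ≤ X ^ (-η)}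

/-- The uniform exponent ŵ_{n,j}(ζ). -/
noncomputable def whExpJ (n j : ℕ) (ζ : ℝ) : ℝ := sSup (whSetJ n j ζ)

/-- Set of exponents η such that for arbitrarily large X the simultaneous approximation
    system has at least j linearly independent integer vector solutions. -/
def lamSetJ (n j : ℕ) (ζ : ℝ) : Set ℝ :=
  {η | ∀ X₀ : ℝ, ∃ X : ℝ, X₀ ≤ X ∧ ∃ v : Fin j → (Fin (n + 1) → ℤ),
    LinearIndependent ℤ v ∧ ∀ i : Fin j,
      ((|v i 0| : ℤ) : ℝ) ≤ X ∧
      ∀ t : Fin n, |ζ ^ ((t : ℕ) + 1) * ((v i 0 : ℤ) : ℝ) - ((v i t.succ : ℤ) : ℝ)| ≤ X ^ (-η)}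

/-- The exponent λ_{n,j}(ζ). -/
noncomputable def lamExpJ (n j : ℕ) (ζ : ℝ) : ℝ := sSup (lamSetJ n j ζ)

/-- Set of exponents η such that for all sufficiently large X the simultaneous approximation
    system has at least j linearly independent integer vector solutions. -/
def lamhSetJ (n j : ℕ) (ζ : ℝ) : Set ℝ :=
  {η | ∃ X₀ : ℝ, ∀ X : ℝ, X₀ ≤ X → ∃ v : Fin j → (Fin (n + 1) → ℤ),
    LinearIndependent ℤ v ∧ ∀ i : Fin j,
      ((|v i 0| : ℤ) : ℝ) ≤ X ∧
      ∀ t : Fin n, |ζ ^ ((t : ℕ) + 1) * ((v i 0 : ℤ) : ℝ) - ((v i t.succ : ℤ) : ℝ)| ≤ X ^ (-η)}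

/-- The uniform exponent λ̂_{n,j}(ζ). -/
noncomputable def lamhExpJ (n j : ℕ) (ζ : ℝ) : ℝ := sSup (lamhSetJ n j ζ)

/-- An extremal number: a real transcendental number with ŵ₂(ζ) = (3+√5)/2. -/
def IsExtremal (ζ : ℝ) : Prop :=
  Transcendental ℚ ζ ∧ whExp 2 ζ = (3 + Real.sqrt 5) / 2

namespace QuadApprox

open Filter

/-- Height of the triple `(a, b, c)` encoding `a T² + b T + c`. -/
def ht (P : ℤ × ℤ × ℤ) : ℕ := max P.1.natAbs (max P.2.1.natAbs P.2.2.natAbs)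

/-- The value at `ζ` of the quadratic polynomial encoded by a triple. -/
noncomputable def qev (ζ : ℝ) (P : ℤ × ℤ × ℤ) : ℝ := P.1 * ζ ^ 2 + P.2.1 * ζ + P.2.2

/-- The cross product of two integer triples. -/
def cross (P Q : ℤ × ℤ × ℤ) : ℤ × ℤ × ℤ :=
  (P.2.1 * Q.2.2 - P.2.2 * Q.2.1, P.2.2 * Q.1 - P.1 * Q.2.2, P.1 * Q.2.1 - P.2.1 * Q.1)

/-- The dot product of two integer triples. -/
def dot (P Q : ℤ × ℤ × ℤ) : ℤ := P.1 * Q.1 + P.2.1 * Q.2.1 + P.2.2 * Q.2.2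

/-- The binary quadratic form of a triple has no nontrivial rational zero. -/
def NoRoot (P : ℤ × ℤ × ℤ) : Prop :=
  ∀ p q : ℤ, P.1 * p ^ 2 + P.2.1 * p * q + P.2.2 * q ^ 2 = 0 → p = 0 ∧ q = 0

/-- Uniform approximation to `0` by quadratic polynomial values with exponent `w`. -/
def UApprox (ζ w : ℝ) : Prop :=
  ∃ X₀ : ℝ, ∀ X : ℝ, X₀ ≤ X →
    ∃ P : ℤ × ℤ × ℤ, P ≠ 0 ∧ (ht P : ℝ) ≤ X ∧ |qev ζ P| ≤ X ^ (-w)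

lemma abs_fst_le_ht (P : ℤ × ℤ × ℤ) : |(P.1 : ℝ)| ≤ ht P := by
  rw [← Int.cast_abs, ← Nat.cast_natAbs P.1]
  exact_mod_cast le_max_left _ _

lemma abs_snd_le_ht (P : ℤ × ℤ × ℤ) : |(P.2.1 : ℝ)| ≤ ht P := by
  rw [← Int.cast_abs, ← Nat.cast_natAbs P.2.1]
  exact_mod_cast le_max_of_le_right (le_max_left _ _)

lemma abs_trd_le_ht (P : ℤ × ℤ × ℤ) : |(P.2.2 : ℝ)| ≤ ht P := by
  rw [← Int.cast_abs, ← Nat.cast_natAbs P.2.2]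
  exact_mod_cast le_max_of_le_right (le_max_right _ _)

lemma ht_pos {P : ℤ × ℤ × ℤ} (hP : P ≠ 0) : 0 < ht P := by
  by_contra h
  have h0 : ht P = 0 := by omega
  obtain ⟨a, b, c⟩ := P
  simp only [ht] at h0
  apply hP
  have ha : a = 0 := by omega
  have hb : b = 0 := by omega
  have hc : c = 0 := by omega
  simp [ha, hb, hc]

lemma ht_le_iff {P : ℤ × ℤ × ℤ} {n : ℕ} :
    ht P ≤ n ↔ P.1.natAbs ≤ n ∧ P.2.1.natAbs ≤ n ∧ P.2.2.natAbs ≤ n := by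
  simp [ht]

lemma finite_ht_le (n : ℕ) : {P : ℤ × ℤ × ℤ | ht P ≤ n}.Finite := by
  apply ((Set.finite_Icc (-(n : ℤ)) n).prod
    ((Set.finite_Icc (-(n : ℤ)) n).prod (Set.finite_Icc (-(n : ℤ)) n))).subset
  intro P hP
  obtain ⟨h1, h2, h3⟩ := ht_le_iff.1 hP
  simp only [Set.mem_prod, Set.mem_Icc]
  omega

lemma linear_ne_zero {ζ : ℝ} (hnz : ∀ P, qev ζ P = 0 → P = 0) {p q : ℤ}
    (hpq : ¬(p = 0 ∧ q = 0)) : (q : ℝ) * ζ - p ≠ 0 := by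
  intro h
  have := hnz (0, q, -p) (by simp only [qev]; push_cast; linarith)
  simp only [Prod.mk_eq_zero, neg_eq_zero] at this
  exact hpq ⟨this.2.2, this.2.1⟩

/-- A quadratic form with small coefficients does not vanish at a coprime pair of large height. -/
lemma eq_zero_of_form_eq_zero {a b c p q : ℤ} (hco : IsCoprime p q)
    (ha : |a| < max |p| |q|) (hb : |b| < max |p| |q|) (hc : |c| < max |p| |q|)
    (h : a * p ^ 2 + b * p * q + c * q ^ 2 = 0) : a = 0 ∧ b = 0 ∧ c = 0 := by
  have key : ∀ a b c p q : ℤ, IsCoprime p q → |a| < |q| → |b| < |q| →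
      a * p ^ 2 + b * p * q + c * q ^ 2 = 0 → a = 0 ∧ b = 0 ∧ c = 0 := by
    intro a b c p q hco ha hb h
    have hq : q ≠ 0 := by
      rintro rfl
      simp only [abs_zero] at ha
      exact absurd ha (not_lt.2 (abs_nonneg a))
    have hqa : q ∣ a := by
      have h1 : q ∣ p ^ 2 * a := ⟨-(b * p + c * q), by linear_combination h⟩
      exact (hco.symm.pow_right).dvd_of_dvd_mul_left h1
    have ha0 : a = 0 := Int.eq_zero_of_abs_lt_dvd ((abs_dvd q a).2 hqa) ha
    subst ha0
    have h2 : b * p + c * q = 0 := by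
      have : q * (b * p + c * q) = 0 := by linear_combination h
      exact (mul_eq_zero.1 this).resolve_left hq
    have hqb : q ∣ b := by
      have h1 : q ∣ p * b := ⟨-c, by linear_combination h2⟩
      exact hco.symm.dvd_of_dvd_mul_left h1
    have hb0 : b = 0 := Int.eq_zero_of_abs_lt_dvd ((abs_dvd q b).2 hqb) hb
    subst hb0
    refine ⟨rfl, rfl, ?_⟩
    have : c * q = 0 := by linear_combination h2
    exact (mul_eq_zero.1 this).resolve_right hq
  rcases le_total |p| |q| with hle | hle
  · rw [max_eq_right hle] at ha hb hc
    exact key a b c p q hco ha hb h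
  · rw [max_eq_left hle] at ha hb hc
    obtain ⟨h1, h2, h3⟩ := key c b a q p hco.symm hc hb (by linear_combination h)
    exact ⟨h3, h2, h1⟩

lemma eventually_rpow_small {w : ℝ} (hw : 2 < w) {ε : ℝ} (hε : 0 < ε) :
    ∃ N₀ : ℝ, 1 ≤ N₀ ∧ ∀ Y : ℝ, N₀ ≤ Y → Y ^ 2 * Y ^ (-w) ≤ ε := by
  have h := (tendsto_rpow_neg_atTop (show 0 < w - 2 by linarith)).eventually (ge_mem_nhds hε)
  obtain ⟨N₀, hN⟩ := eventually_atTop.1 h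
  refine ⟨max N₀ 1, le_max_right _ _, fun Y hY => ?_⟩
  have hY0 : 0 < Y := lt_of_lt_of_le one_pos ((le_max_right _ _).trans hY)
  have := hN Y ((le_max_left _ _).trans hY)
  rw [← Real.rpow_natCast, ← Real.rpow_add hY0]
  rwa [show ((2 : ℕ) : ℝ) + -w = -(w - 2) by push_cast; ring]

/-- If quadratic uniform approximation with an exponent larger than `2` is possible, then `ζ` is
not too well approximable by rational numbers. -/
lemma linear_lower {ζ w : ℝ} (hnz : ∀ P, qev ζ P = 0 → P = 0) (hw : 2 < w)
    (hU : UApprox ζ w) :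
    ∃ c : ℝ, 0 < c ∧ ∀ p q : ℤ, ¬(p = 0 ∧ q = 0) →
      c ≤ |(q : ℝ) * ζ - p| * (max |(p : ℝ)| |(q : ℝ)|) ^ 2 := by
  obtain ⟨X₀, hX₀⟩ := hU
  obtain ⟨N₁, hN₁, hsmall⟩ := eventually_rpow_small hw (show (0 : ℝ) < 1 / 8 by norm_num)
  obtain ⟨M, hM⟩ := exists_nat_gt (2 * max N₁ X₀)
  have hMN : 2 * N₁ < M := lt_of_le_of_lt (by linarith [le_max_left N₁ X₀]) hM
  have hMX : 2 * X₀ < M := lt_of_le_of_lt (by linarith [le_max_right N₁ X₀]) hM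
  let s : Set (ℤ × ℤ) := (Set.Icc (-(M : ℤ)) M ×ˢ Set.Icc (-(M : ℤ)) M) \ {0}
  have hs : s.Finite := ((Set.finite_Icc _ _).prod (Set.finite_Icc _ _)).sdiff
  obtain ⟨c₂, hc₂, hc₂'⟩ : ∃ c : ℝ, 0 < c ∧ ∀ x ∈ s, c ≤ |(x.2 : ℝ) * ζ - x.1| := by
    rcases s.eq_empty_or_nonempty with he | hne
    · exact ⟨1, one_pos, by simp [he]⟩
    · obtain ⟨x, hx, hmin⟩ := s.exists_min_image (fun x => |(x.2 : ℝ) * ζ - x.1|) hs hne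
      refine ⟨_, abs_pos.2 (linear_ne_zero hnz (p := x.1) (q := x.2) ?_), hmin⟩
      rintro ⟨h1, h2⟩
      exact hx.2 (by simp [Prod.ext_iff, h1, h2])
  have hco : ∀ p q : ℤ, IsCoprime p q → ¬(p = 0 ∧ q = 0) →
      min c₂ (1 / (|ζ| + 2)) ≤ |(q : ℝ) * ζ - p| * (max |(p : ℝ)| |(q : ℝ)|) ^ 2 := by
    intro p q hpq hne
    set N : ℝ := max |(p : ℝ)| |(q : ℝ)| with hN
    have hNZ : N = ((max |p| |q| : ℤ) : ℝ) := by push_cast; rfl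
    have hp : |(p : ℝ)| ≤ N := le_max_left _ _
    have hq : |(q : ℝ)| ≤ N := le_max_right _ _
    have hN1 : 1 ≤ N := by
      rw [hNZ]
      have : (1 : ℤ) ≤ max |p| |q| := by
        by_contra hcon
        have h1 : |p| ≤ 0 := by have := le_max_left |p| |q|; omega
        have h2 : |q| ≤ 0 := by have := le_max_right |p| |q|; omega
        exact hne ⟨abs_nonpos_iff.1 h1, abs_nonpos_iff.1 h2⟩
      exact_mod_cast this
    rcases le_or_gt N M with hle | hgt
    · have hmem : (p, q) ∈ s := by
        have h1 : |p| ≤ (M : ℤ) := by exact_mod_cast hp.trans hle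
        have h2 : |q| ≤ (M : ℤ) := by exact_mod_cast hq.trans hle
        rw [abs_le] at h1 h2
        refine ⟨⟨h1, h2⟩, fun h0 => hne ?_⟩
        simpa [Prod.ext_iff] using h0
      have h3 := hc₂' _ hmem
      simp only at h3
      calc _ ≤ c₂ := min_le_left _ _
        _ ≤ |(q : ℝ) * ζ - p| * 1 := by linarith
        _ ≤ _ := by gcongr; nlinarith
    · obtain ⟨P, hP0, hPh, hPv⟩ := hX₀ (N / 2) (by linarith)
      have hsm := hsmall (N / 2) (by linarith)
      obtain ⟨a, b, c⟩ := P
      have ha := (abs_fst_le_ht (a, b, c)).trans hPh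
      have hb := (abs_snd_le_ht (a, b, c)).trans hPh
      have hc := (abs_trd_le_ht (a, b, c)).trans hPh
      simp only at ha hb hc
      have ht0 : a * p ^ 2 + b * p * q + c * q ^ 2 ≠ 0 := by
        intro h0
        have cv : ∀ x : ℤ, |(x : ℝ)| ≤ N / 2 → |x| < max |p| |q| := by
          intro x hx
          have : |(x : ℝ)| < N := by linarith
          rw [hNZ] at this
          exact_mod_cast this
        obtain ⟨h1, h2, h3⟩ := eq_zero_of_form_eq_zero hpq (cv a ha) (cv b hb) (cv c hc) h0
        exact hP0 (by simp [h1, h2, h3])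
      have h1 : (1 : ℝ) ≤ |(a : ℝ) * p ^ 2 + b * p * q + c * q ^ 2| := by
        exact_mod_cast Int.one_le_abs ht0
      have hid : (a : ℝ) * p ^ 2 + b * p * q + c * q ^ 2 =
          q ^ 2 * qev ζ (a, b, c) - (q * ζ - p) * (a * (q * ζ + p) + b * q) := by
        simp only [qev]; ring
      have hA : |(q : ℝ) ^ 2 * qev ζ (a, b, c)| ≤ 1 / 2 := by
        rw [abs_mul, abs_of_nonneg (sq_nonneg (q : ℝ)), ← sq_abs]
        calc |(q : ℝ)| ^ 2 * |qev ζ (a, b, c)| ≤ N ^ 2 * (N / 2) ^ (-w) := by gcongr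
          _ = 4 * ((N / 2) ^ 2 * (N / 2) ^ (-w)) := by ring
          _ ≤ 1 / 2 := by linarith
      have hB : |(a : ℝ) * (q * ζ + p) + b * q| ≤ N ^ 2 / 2 * (|ζ| + 2) := by
        calc |(a : ℝ) * (q * ζ + p) + b * q| ≤ |(a : ℝ)| * (|(q : ℝ)| * |ζ| + |(p : ℝ)|)
              + |(b : ℝ)| * |(q : ℝ)| := by
              refine (abs_add_le _ _).trans ?_
              rw [abs_mul, abs_mul]
              gcongr
              refine (abs_add_le _ _).trans ?_
              rw [abs_mul]
          _ ≤ N / 2 * (N * |ζ| + N) + N / 2 * N := by gcongr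
          _ = _ := by ring
      have h2 : 1 ≤ 1 / 2 + |(q : ℝ) * ζ - p| * (N ^ 2 / 2 * (|ζ| + 2)) := by
        rw [hid] at h1
        refine h1.trans ((abs_sub _ _).trans (add_le_add hA ?_))
        rw [abs_mul]
        gcongr
      have hz : 0 < |ζ| + 2 := by positivity
      refine (min_le_right _ _).trans ?_
      rw [div_le_iff₀ hz]
      linarith
  refine ⟨min c₂ (1 / (|ζ| + 2)), lt_min hc₂ (by positivity), fun p q hne => ?_⟩
  have hg : 0 < p.gcd q := Nat.pos_of_ne_zero (fun h => hne (Int.gcd_eq_zero_iff.1 h))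
  obtain ⟨p', q', hc, hp, hq⟩ := Int.exists_gcd_one hg
  set g := p.gcd q
  have hg1 : (1 : ℝ) ≤ g := by exact_mod_cast hg
  have h := hco p' q' (Int.isCoprime_iff_gcd_eq_one.2 hc) (by
    rintro ⟨h1, h2⟩
    exact hne ⟨by rw [hp, h1, zero_mul], by rw [hq, h2, zero_mul]⟩)
  refine h.trans ?_
  have e1 : (p : ℝ) = p' * g := by exact_mod_cast hp
  have e2 : (q : ℝ) = q' * g := by exact_mod_cast hq
  have le1 : ∀ x : ℝ, |x| ≤ |x * g| := fun x => by
    rw [abs_mul, abs_of_nonneg (by linarith : (0 : ℝ) ≤ g)]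
    nlinarith [abs_nonneg x]
  have e3 : (q : ℝ) * ζ - p = (q' * ζ - p') * g := by rw [e1, e2]; ring
  rw [e3, e1, e2]
  exact mul_le_mul (le1 _) (pow_le_pow_left₀ (by positivity) (max_le_max (le1 _) (le1 _)) 2)
    (by positivity) (by positivity)

lemma linear_factor_heights {p q r s b H : ℝ} (h1 : |q * r| ≤ H) (h2 : |p * s| ≤ H)
    (h3 : b = -(r * p + s * q)) (h4 : |b| ≤ H) :
    max |p| |q| * max |s| |r| ≤ 2 * H := by
  have hH : 0 ≤ H := (abs_nonneg _).trans h1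
  have hsum : |r * p| ≤ |s * q| + H := by
    have : r * p = -(s * q) - b := by rw [h3]; ring
    rw [this]
    refine (abs_sub _ _).trans ?_
    rw [abs_neg]; linarith
  have hsum' : |s * q| ≤ |r * p| + H := by
    have : s * q = -(r * p) - b := by rw [h3]; ring
    rw [this]
    refine (abs_sub _ _).trans ?_
    rw [abs_neg]; linarith
  have hprod : |r * p| * |s * q| ≤ H * H := by
    rw [← abs_mul, show r * p * (s * q) = (q * r) * (p * s) by ring, abs_mul]
    gcongr
  have ha : |r * p| ≤ 2 * H := by
    by_contra hc
    push Not at hc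
    nlinarith [abs_nonneg (s * q)]
  have hb : |s * q| ≤ 2 * H := by
    by_contra hc
    push Not at hc
    nlinarith [abs_nonneg (r * p)]
  rw [abs_mul] at h1 h2 ha hb
  rcases le_total |p| |q| with h | h <;> rcases le_total |s| |r| with h' | h' <;>
    simp only [max_eq_left h', max_eq_right h', max_eq_left h, max_eq_right h] <;> linarith

/-- A quadratic polynomial with a rational root is not too small at `ζ`. -/
lemma root_lower {ζ w : ℝ} (hnz : ∀ P, qev ζ P = 0 → P = 0) (hw : 2 < w) (hU : UApprox ζ w) :
    ∃ c : ℝ, 0 < c ∧ ∀ P : ℤ × ℤ × ℤ, P ≠ 0 → ¬ NoRoot P →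
      c ≤ |qev ζ P| * (ht P : ℝ) ^ 2 := by
  obtain ⟨c, hc, hlow⟩ := linear_lower hnz hw hU
  refine ⟨c ^ 2 / 4, by positivity, fun P hP hroot => ?_⟩
  have hroot' : ∃ p q : ℤ, IsCoprime p q ∧ P.1 * p ^ 2 + P.2.1 * p * q + P.2.2 * q ^ 2 = 0 := by
    simp only [NoRoot, not_forall] at hroot
    obtain ⟨p, q, h0, hne⟩ := hroot
    have hg : 0 < p.gcd q := Nat.pos_of_ne_zero (fun h => hne (Int.gcd_eq_zero_iff.1 h))
    obtain ⟨p', q', hc, hp, hq⟩ := Int.exists_gcd_one hg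
    refine ⟨p', q', Int.isCoprime_iff_gcd_eq_one.2 hc, ?_⟩
    have hg' : ((p.gcd q : ℕ) : ℤ) ^ 2 ≠ 0 := by positivity
    apply (mul_eq_zero.1 (?_ : ((p.gcd q : ℕ) : ℤ) ^ 2 * _ = 0)).resolve_left hg'
    generalize ((p.gcd q : ℕ) : ℤ) = g at *
    rw [hp, hq] at h0
    linear_combination h0
  obtain ⟨p, q, hco, h0⟩ := hroot'
  obtain ⟨a, b, d⟩ := P
  simp only at h0
  obtain ⟨r, hr⟩ : q ∣ a := by
    have h1 : q ∣ p ^ 2 * a := ⟨-(b * p + d * q), by linear_combination h0⟩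
    exact (hco.symm.pow_right).dvd_of_dvd_mul_left h1
  obtain ⟨s, hs⟩ : p ∣ d := by
    have h1 : p ∣ q ^ 2 * d := ⟨-(b * q + a * p), by linear_combination h0⟩
    exact (hco.pow_right).dvd_of_dvd_mul_left h1
  have hfac : ∃ r s : ℤ, a = q * r ∧ d = p * s ∧ b = -(r * p + s * q) := by
    by_cases hp : p = 0
    · subst hp
      have hq : q * q = 1 := by
        have := Int.isCoprime_iff_gcd_eq_one.1 hco
        simp only [Int.gcd_zero_left] at this
        rcases Int.natAbs_eq_iff.1 this with h | h <;> simp [h]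
      refine ⟨r, -(b * q), hr, by simpa using hs, ?_⟩
      linear_combination (-b) * hq
    · by_cases hq : q = 0
      · subst hq
        have hp1 : p * p = 1 := by
          have := Int.isCoprime_iff_gcd_eq_one.1 hco
          simp only [Int.gcd_zero_right] at this
          rcases Int.natAbs_eq_iff.1 this with h | h <;> simp [h]
        refine ⟨-(b * p), s, by simpa using hr, hs, ?_⟩
        linear_combination (-b) * hp1
      · refine ⟨r, s, hr, hs, ?_⟩
        have : (p * q) * (r * p + s * q + b) = 0 := by
          rw [hr, hs] at h0; linear_combination h0
        have := (mul_eq_zero.1 this).resolve_left (mul_ne_zero hp hq)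
        linarith
  obtain ⟨r, s, hr, hs, hb⟩ := hfac
  have hval : qev ζ (a, b, d) = ((q : ℝ) * ζ - p) * (r * ζ - s) := by
    simp only [qev, hr, hs, hb]; push_cast; ring
  have n1 : ¬(p = 0 ∧ q = 0) := by
    rintro ⟨rfl, rfl⟩
    exact not_isCoprime_zero_zero hco
  have n2 : ¬(s = 0 ∧ r = 0) := by
    rintro ⟨rfl, rfl⟩
    exact hP (by simp [hr, hs, hb])
  have l1 := hlow p q n1
  have l2 := hlow s r n2
  have hm := linear_factor_heights (p := p) (q := q) (r := r) (s := s) (b := b)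
    (H := ht (a, b, d))
    (by have := abs_fst_le_ht (a, b, d); simp only [hr] at this ⊢; exact_mod_cast this)
    (by have := abs_trd_le_ht (a, b, d); simp only [hs] at this ⊢; exact_mod_cast this)
    (by exact_mod_cast hb) (abs_snd_le_ht (a, b, d))
  rw [hval, abs_mul]
  have hmul := mul_le_mul l1 l2 hc.le (by positivity)
  have hm2 : (max |(p : ℝ)| |(q : ℝ)| * max |(s : ℝ)| |(r : ℝ)|) ^ 2 ≤
      (2 * (ht (a, b, d) : ℝ)) ^ 2 := by gcongr
  have h3 : |(q : ℝ) * ζ - p| * |(r : ℝ) * ζ - s| *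
      (max |(p : ℝ)| |(q : ℝ)| * max |(s : ℝ)| |(r : ℝ)|) ^ 2 ≤
      |(q : ℝ) * ζ - p| * |(r : ℝ) * ζ - s| * (2 * (ht (a, b, d) : ℝ)) ^ 2 := by gcongr
  nlinarith

/-- Four linearly independent integer forms in five variables that are small at
`(1, ζ, …, ζ⁴)` produce a nonzero integer point close to the line spanned by that vector. -/
lemma exists_dual_point (ζ : ℝ) (p : Fin 4 → Fin 5 → ℤ)
    (hli : LinearIndependent ℚ (fun i j => (p i j : ℚ))) {H V : ℝ} (hH : 1 ≤ H) (hV : 0 < V)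
    (hp : ∀ i j, |(p i j : ℝ)| ≤ H) (hv : ∀ i, |∑ j : Fin 5, ζ ^ (j : ℕ) * (p i j : ℝ)| ≤ V) :
    ∃ u : Fin 5 → ℤ, u ≠ 0 ∧ |(u 0 : ℝ)| ≤ 120 * H ^ 4 ∧
      ∀ i : Fin 5, |ζ ^ (i : ℕ) * (u 0 : ℝ) - u i| ≤ 120 * H ^ 3 * V := by
  have hH0 : 0 < H := by linarith
  let u : Fin 5 → ℤ := fun j =>
    (-1) ^ (j : ℕ) * (Matrix.of fun i k : Fin 4 => p i (j.succAbove k)).det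
  have hexp : ∀ {R : Type} [CommRing R] (S : Fin 5 → R),
      (Matrix.of (Fin.cons S (fun i j => (p i j : R)) : Fin 5 → Fin 5 → R)).det
        = ∑ j, S j * (u j : R) := by
    intro R _ S
    rw [Matrix.det_succ_row_zero]
    refine Finset.sum_congr rfl fun j _ => ?_
    have : ((Matrix.of (Fin.cons S (fun i j => (p i j : R)) : Fin 5 → Fin 5 → R)).submatrix
        Fin.succ j.succAbove) =
        (Int.castRingHom R).mapMatrix (Matrix.of fun i k : Fin 4 => p i (j.succAbove k)) := by
      ext i k; simp
    rw [this, ← RingHom.map_det]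
    simp only [u, Matrix.of_apply, Fin.cons_zero, eq_intCast, Int.cast_mul, Int.cast_pow,
      Int.cast_neg, Int.cast_one]
    ring
  have hdet : ∀ A : Matrix (Fin 5) (Fin 5) ℝ, (∀ i j, |A i j| ≤ H) → |A.det| ≤ 120 * H ^ 5 := by
    intro A hA
    have := Matrix.det_le (abv := AbsoluteValue.abs) (A := A) (x := H) hA
    simpa [Nat.factorial] using this
  have hprod : ∀ x : ℝ, ∏ i, (Fin.cons x 1 : Fin 5 → ℝ) i = x := fun x => by
    simp [Fin.prod_univ_succ]
  refine ⟨u, ?_, ?_, ?_⟩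
  · obtain ⟨S, hS⟩ := exists_linearIndependent_cons_of_lt_finrank hli (by simp)
    have h1 : IsUnit (Matrix.of (Fin.cons S (fun i j => (p i j : ℚ)) : Fin 5 → Fin 5 → ℚ)) :=
      Matrix.linearIndependent_rows_iff_isUnit.1 hS
    rw [Matrix.isUnit_iff_isUnit_det, hexp S] at h1
    intro h0
    rw [h0] at h1
    simp at h1
  · have h1 := hexp (R := ℝ) (Pi.single 0 1)
    rw [Finset.sum_eq_single 0 (by intro b _ hb; simp [hb]) (by simp)] at h1
    simp only [Pi.single_eq_same, one_mul] at h1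
    have h2 := Matrix.det_mul_column (Fin.cons H 1 : Fin 5 → ℝ)
      (Matrix.of (Fin.cons (Pi.single 0 1) (fun i j => (p i j : ℝ)) : Fin 5 → Fin 5 → ℝ))
    have h3 := hdet _ (fun i j => ?_ : ∀ i j, |Matrix.of (fun i j =>
      (Fin.cons H 1 : Fin 5 → ℝ) i * Matrix.of (Fin.cons (Pi.single 0 1)
        (fun i j => (p i j : ℝ)) : Fin 5 → Fin 5 → ℝ) i j) i j| ≤ H)
    · rw [h2, h1, hprod, abs_mul, abs_of_pos hH0] at h3
      have : H * |(u 0 : ℝ)| ≤ H * (120 * H ^ 4) := by linarith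
      exact le_of_mul_le_mul_left this hH0
    · refine Fin.cases ?_ (fun i => ?_) i
      · simp only [Matrix.of_apply, Fin.cons_zero]
        rcases eq_or_ne j 0 with rfl | hj
        · simp [abs_of_pos hH0]
        · simp [hj, hH0.le]
      · simpa using hp i j
  · intro i
    let S : Fin 5 → ℝ := fun j => (if j = 0 then ζ ^ (i : ℕ) else 0) - (if j = i then 1 else 0)
    have h1 := hexp (R := ℝ) S
    have h1' : ∑ j, S j * (u j : ℝ) = ζ ^ (i : ℕ) * (u 0 : ℝ) - u i := by
      simp [S, sub_mul, Finset.sum_sub_distrib]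
    rw [h1'] at h1
    set M : Matrix (Fin 5) (Fin 5) ℝ :=
      Matrix.of (Fin.cons S (fun i j => (p i j : ℝ)) : Fin 5 → Fin 5 → ℝ) with hM
    have h4 := Matrix.det_updateCol_sum M 0 (fun j => ζ ^ (j : ℕ))
    simp only [Fin.val_zero, pow_zero, one_smul] at h4
    set M' := M.updateCol 0 fun k => ∑ i : Fin 5, ζ ^ (i : ℕ) • M k i with hM'
    have h2 := Matrix.det_mul_column (Fin.cons H 1 : Fin 5 → ℝ)
      (Matrix.of fun i j => (Fin.cons (H / V) 1 : Fin 5 → ℝ) j * M' i j)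
    rw [Matrix.det_mul_row, h4, h1, hprod, hprod] at h2
    have h3 := hdet _ (fun i j => ?_ : ∀ i j, |Matrix.of (fun i j =>
      (Fin.cons H 1 : Fin 5 → ℝ) i * Matrix.of (fun i j =>
        (Fin.cons (H / V) 1 : Fin 5 → ℝ) j * M' i j) i j) i j| ≤ H)
    · rw [h2, abs_mul, abs_mul, abs_of_pos hH0, abs_of_pos (by positivity)] at h3
      have : H ^ 2 / V * |ζ ^ (i : ℕ) * (u 0 : ℝ) - u i| ≤ H ^ 2 / V * (120 * H ^ 3 * V) := by
        calc _ = H * (H / V * |ζ ^ (i : ℕ) * (u 0 : ℝ) - u i|) := by ring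
          _ ≤ 120 * H ^ 5 := h3
          _ = _ := by field_simp
      exact le_of_mul_le_mul_left this (by positivity)
    · refine Fin.cases ?_ (fun k => ?_) i <;> refine Fin.cases ?_ (fun l => ?_) j
      · have : ∑ x : Fin 5, ζ ^ (x : ℕ) * S x = 0 := by
          simp [S, mul_sub, Finset.sum_sub_distrib]
        simp [hM', hM, this, hH0.le]
      · simp only [Matrix.of_apply, Fin.cons_zero, Fin.cons_succ, Pi.one_apply, one_mul, hM',
          Matrix.updateCol_apply, Fin.succ_ne_zero, if_false, hM, S, zero_sub]
        split_ifs
        · simp [abs_of_pos hH0]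
        · simp [hH0.le]
      · simp only [Matrix.of_apply, Fin.cons_zero, Fin.cons_succ, Pi.one_apply, one_mul, hM',
          Matrix.updateCol_self, hM, smul_eq_mul]
        rw [abs_mul, abs_of_pos (by positivity)]
        calc H / V * _ ≤ H / V * V := by gcongr; exact hv k
          _ = H := by field_simp
      · simpa [hM', hM, Matrix.updateCol_apply] using hp k l.succ

lemma abs_mul_sub_mul_le {x y z t X Y : ℝ} (hx : |x| ≤ X) (hy : |y| ≤ Y) (hz : |z| ≤ X)
    (ht : |t| ≤ Y) : |x * y - z * t| ≤ 2 * X * Y := by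
  have hX := (abs_nonneg _).trans hx
  calc |x * y - z * t| ≤ |x * y| + |z * t| := abs_sub _ _
    _ ≤ X * Y + X * Y := by rw [abs_mul, abs_mul]; gcongr
    _ = _ := by ring

lemma noRoot_cross {P P' : ℤ × ℤ × ℤ} (hroot : NoRoot P) (hne : cross P P' ≠ 0) :
    (cross P P').2.1 ^ 2 ≠ (cross P P').1 * (cross P P').2.2 := by
  intro h
  have horth : P.1 * (cross P P').1 + P.2.1 * (cross P P').2.1 + P.2.2 * (cross P P').2.2 = 0 := by
    simp only [cross]; ring
  generalize cross P P' = ω at h hne horth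
  obtain ⟨u, v, w⟩ := ω
  simp only at h horth
  by_cases hw : w = 0
  · subst hw
    have hv : v = 0 := by simpa using h
    subst hv
    have hu : u ≠ 0 := by rintro rfl; exact hne rfl
    have ha : P.1 = 0 := by simpa [hu] using horth
    exact one_ne_zero (hroot 1 0 (by simp [ha])).1
  · exact hw (hroot v w (by linear_combination w * horth + P.1 * h)).2

lemma one_le_of_plane {ζ : ℝ} {P P' S S' : ℤ × ℤ × ℤ} (hroot : NoRoot P)
    (hne : cross P P' ≠ 0) (h1 : dot (cross P P') S = 0) (h2 : dot (cross P P') S' = 0)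
    (hne' : cross S S' ≠ 0) (hS : ht S ≤ ht S') (hv : |qev ζ S'| ≤ |qev ζ S|) :
    1 ≤ (12 * |ζ| + 8) * (ht P * ht P') * (ht S' * |qev ζ S|) := by
  have hnr := noRoot_cross hroot hne
  set ω := cross P P' with hω
  set ω' := cross S S' with hω'
  have p1 : ω.1 * ω'.2.1 = ω.2.1 * ω'.1 := by
    simp only [dot] at h1 h2
    simp only [hω', cross]
    linear_combination S.2.2 * h2 - S'.2.2 * h1
  have p2 : ω.2.1 * ω'.2.2 = ω.2.2 * ω'.2.1 := by
    simp only [dot] at h1 h2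
    simp only [hω', cross]
    linear_combination S.1 * h2 - S'.1 * h1
  have p3 : ω.2.2 * ω'.1 = ω.1 * ω'.2.2 := by
    simp only [dot] at h1 h2
    simp only [hω', cross]
    linear_combination S.2.1 * h2 - S'.2.1 * h1
  have hN : ω.2.1 * ω'.2.1 - ω.2.2 * ω'.1 ≠ 0 := by
    intro h0
    have hd : ω.2.1 ^ 2 - ω.1 * ω.2.2 ≠ 0 := sub_ne_zero.2 hnr
    have q1 : ω'.1 * (ω.2.1 ^ 2 - ω.1 * ω.2.2) = 0 := by
      linear_combination ω.1 * h0 - ω.2.1 * p1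
    have q2 : ω'.2.1 * (ω.2.1 ^ 2 - ω.1 * ω.2.2) = 0 := by
      linear_combination ω.2.1 * h0 - ω.2.2 * p1
    have q3 : ω'.2.2 * (ω.2.1 ^ 2 - ω.1 * ω.2.2) = 0 := by
      linear_combination ω.2.1 * p2 + ω.2.2 * h0 + ω.2.2 * p3
    apply hne'
    ext
    · exact (mul_eq_zero.1 q1).resolve_right hd
    · exact (mul_eq_zero.1 q2).resolve_right hd
    · exact (mul_eq_zero.1 q3).resolve_right hd
  have hN1 : (1 : ℝ) ≤ |(ω.2.1 : ℝ) * ω'.2.1 - ω.2.2 * ω'.1| := by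
    exact_mod_cast Int.one_le_abs hN
  have p2' : (ω.2.1 : ℝ) * ω'.2.2 = ω.2.2 * ω'.2.1 := by exact_mod_cast p2
  have hid : (ω.2.1 : ℝ) * ω'.2.1 - ω.2.2 * ω'.1 =
      (ω.2.1 - ζ * ω.2.2) * (ω'.2.1 - ζ * ω'.2.2)
        - ω.2.2 * (ω'.1 - 2 * ζ * ω'.2.1 + ζ ^ 2 * ω'.2.2) := by
    linear_combination ζ * p2'
  have bw : |(ω.2.2 : ℝ)| ≤ 2 * ht P * ht P' := by
    simp only [hω, cross]; push_cast
    exact abs_mul_sub_mul_le (abs_fst_le_ht P) (abs_snd_le_ht P') (abs_snd_le_ht P)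
      (abs_fst_le_ht P')
  have bv : |(ω.2.1 : ℝ)| ≤ 2 * ht P * ht P' := by
    simp only [hω, cross]; push_cast
    exact abs_mul_sub_mul_le (abs_trd_le_ht P) (abs_fst_le_ht P') (abs_fst_le_ht P)
      (abs_trd_le_ht P')
  have b1 : |(ω.2.1 : ℝ) - ζ * ω.2.2| ≤ 2 * ht P * ht P' * (1 + |ζ|) := by
    calc _ ≤ |(ω.2.1 : ℝ)| + |ζ| * |(ω.2.2 : ℝ)| := by
          rw [← abs_mul]; exact abs_sub _ _
      _ ≤ 2 * ht P * ht P' + |ζ| * (2 * ht P * ht P') := by gcongr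
      _ = _ := by ring
  have hSS : (ht S : ℝ) ≤ ht S' := by exact_mod_cast hS
  have b2 : |(ω'.2.1 : ℝ) - ζ * ω'.2.2| ≤ 2 * ht S' * |qev ζ S| := by
    have e : (ω'.2.1 : ℝ) - ζ * ω'.2.2 = S'.1 * qev ζ S - S.1 * qev ζ S' := by
      simp only [hω', cross, qev]; push_cast; ring
    rw [e]
    exact abs_mul_sub_mul_le (abs_fst_le_ht S') le_rfl ((abs_fst_le_ht S).trans hSS) hv
  have hder : ∀ R : ℤ × ℤ × ℤ, |2 * (R.1 : ℝ) * ζ + R.2.1| ≤ (2 * |ζ| + 1) * ht R := by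
    intro R
    calc _ ≤ 2 * |(R.1 : ℝ)| * |ζ| + |(R.2.1 : ℝ)| := by
          refine (abs_add_le _ _).trans ?_
          rw [abs_mul, abs_mul, abs_two]
      _ ≤ 2 * ht R * |ζ| + ht R := by
          gcongr
          · exact abs_fst_le_ht R
          · exact abs_snd_le_ht R
      _ = _ := by ring
  have b3 : |(ω'.1 : ℝ) - 2 * ζ * ω'.2.1 + ζ ^ 2 * ω'.2.2| ≤
      2 * ((2 * |ζ| + 1) * ht S') * |qev ζ S| := by
    have e : (ω'.1 : ℝ) - 2 * ζ * ω'.2.1 + ζ ^ 2 * ω'.2.2 =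
        (2 * S.1 * ζ + S.2.1) * qev ζ S' - (2 * S'.1 * ζ + S'.2.1) * qev ζ S := by
      simp only [hω', cross, qev]; push_cast; ring
    rw [e]
    refine abs_mul_sub_mul_le ((hder S).trans ?_) hv (hder S') le_rfl
    gcongr
  rw [hid] at hN1
  calc (1 : ℝ) ≤ _ := hN1
    _ ≤ |(ω.2.1 : ℝ) - ζ * ω.2.2| * |(ω'.2.1 : ℝ) - ζ * ω'.2.2|
        + |(ω.2.2 : ℝ)| * |(ω'.1 : ℝ) - 2 * ζ * ω'.2.1 + ζ ^ 2 * ω'.2.2| := by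
      rw [← abs_mul, ← abs_mul]; exact abs_sub _ _
    _ ≤ (2 * ht P * ht P' * (1 + |ζ|)) * (2 * ht S' * |qev ζ S|)
        + (2 * ht P * ht P') * (2 * ((2 * |ζ| + 1) * ht S') * |qev ζ S|) := by gcongr
    _ = _ := by ring

/-- The cross products of two pairs spanning the same plane are proportional, so that a third
vector is outside both planes simultaneously. -/
lemma dot_cross_ne_zero {P P' S S' R : ℤ × ℤ × ℤ} (h1 : dot (cross P P') S = 0)
    (h2 : dot (cross P P') S' = 0) (hne' : cross S S' ≠ 0) (hR : dot (cross P P') R ≠ 0) :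
    dot (cross S S') R ≠ 0 := by
  intro h
  have hpar : ∀ x : ℤ, x ∈ [(cross S S').1, (cross S S').2.1, (cross S S').2.2] → x = 0 := by
    simp only [dot] at h h1 h2 hR
    set ω := cross P P'
    simp only [cross] at h ⊢
    simp only [List.mem_cons, List.not_mem_nil, or_false]
    rintro x (rfl | rfl | rfl)
    all_goals apply (mul_eq_zero.1
      (_ : _ * (ω.1 * R.1 + ω.2.1 * R.2.1 + ω.2.2 * R.2.2) = 0)).resolve_right hR
    · linear_combination ω.1 * h + (S'.2.2 * R.2.1 - S'.2.1 * R.2.2) * h1 +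
        (S.2.1 * R.2.2 - S.2.2 * R.2.1) * h2
    · linear_combination ω.2.1 * h + (S'.1 * R.2.2 - S'.2.2 * R.1) * h1 +
        (S.2.2 * R.1 - S.1 * R.2.2) * h2
    · linear_combination ω.2.2 * h + (S'.2.1 * R.1 - S'.1 * R.2.1) * h1 +
        (S.1 * R.2.1 - S.2.1 * R.1) * h2
  apply hne'
  ext
  · exact hpar _ (by simp)
  · exact hpar _ (by simp)
  · exact hpar _ (by simp)

lemma one_le_of_independent {ζ : ℝ} {P P' P'' : ℤ × ℤ × ℤ} (h : dot (cross P P') P'' ≠ 0)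
    (hP : ht P ≤ ht P') (hP' : ht P' ≤ ht P'') (hv : |qev ζ P'| ≤ |qev ζ P|)
    (hv' : |qev ζ P''| ≤ |qev ζ P'|) :
    1 ≤ 6 * (ht P' * ht P'') * |qev ζ P| := by
  have h1 : (1 : ℝ) ≤ |((dot (cross P P') P'' : ℤ) : ℝ)| := by exact_mod_cast Int.one_le_abs h
  have hid : ((dot (cross P P') P'' : ℤ) : ℝ) =
      (P'.1 * P''.2.1 - P'.2.1 * P''.1) * qev ζ P - (P.1 * P''.2.1 - P.2.1 * P''.1) * qev ζ P'
      + (P.1 * P'.2.1 - P.2.1 * P'.1) * qev ζ P'' := by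
    simp only [dot, cross, qev]; push_cast; ring
  have hb : ∀ Q R : ℤ × ℤ × ℤ, |(Q.1 : ℝ) * R.2.1 - Q.2.1 * R.1| ≤ 2 * ht Q * ht R := fun Q R =>
    abs_mul_sub_mul_le (abs_fst_le_ht Q) (abs_snd_le_ht R) (abs_snd_le_ht Q) (abs_fst_le_ht R)
  have c1 : (ht P : ℝ) ≤ ht P' := by exact_mod_cast hP
  have c2 : (ht P' : ℝ) ≤ ht P'' := by exact_mod_cast hP'
  rw [hid] at h1
  calc (1 : ℝ) ≤ _ := h1
    _ ≤ |(P'.1 : ℝ) * P''.2.1 - P'.2.1 * P''.1| * |qev ζ P|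
        + |(P.1 : ℝ) * P''.2.1 - P.2.1 * P''.1| * |qev ζ P'|
        + |(P.1 : ℝ) * P'.2.1 - P.2.1 * P'.1| * |qev ζ P''| := by
      rw [← abs_mul, ← abs_mul, ← abs_mul]
      exact (abs_add_le _ _).trans (by gcongr; exact abs_sub _ _)
    _ ≤ (2 * ht P' * ht P'') * |qev ζ P| + (2 * ht P * ht P'') * |qev ζ P'|
        + (2 * ht P * ht P') * |qev ζ P''| := by
      gcongr <;> exact hb _ _
    _ ≤ (2 * ht P' * ht P'') * |qev ζ P| + (2 * ht P' * ht P'') * |qev ζ P|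
        + (2 * ht P' * ht P'') * |qev ζ P| := by
      have := hv'.trans hv
      gcongr
    _ = _ := by ring

lemma exists_abs_eq_ht (P : ℤ × ℤ × ℤ) :
    P.1.natAbs = ht P ∨ P.2.1.natAbs = ht P ∨ P.2.2.natAbs = ht P := by
  simp only [ht]; omega

lemma cross_ne_zero {ζ : ℝ} {P P' : ℤ × ℤ × ℤ} (hP : ht P < ht P')
    (hv : |qev ζ P'| < |qev ζ P|) : cross P P' ≠ 0 := by
  intro h
  simp only [cross, Prod.mk_eq_zero] at h
  obtain ⟨h1, h2, h3⟩ := h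
  have r1 : (P.2.1 : ℝ) * P'.2.2 - P.2.2 * P'.2.1 = 0 := by exact_mod_cast h1
  have r2 : (P.2.2 : ℝ) * P'.1 - P.1 * P'.2.2 = 0 := by exact_mod_cast h2
  have r3 : (P.1 : ℝ) * P'.2.1 - P.2.1 * P'.1 = 0 := by exact_mod_cast h3
  have hpos : 0 < |qev ζ P| := (abs_nonneg _).trans_lt hv
  have key : ∀ x x' : ℤ, (x' : ℝ) * qev ζ P = x * qev ζ P' → x'.natAbs = ht P' →
      |(x : ℝ)| ≤ ht P → False := by
    intro x x' he hx' hx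
    have hx'' : |(x' : ℝ)| = ht P' := by
      rw [← Int.cast_abs, ← Nat.cast_natAbs x']; exact_mod_cast hx'
    have e : |(x' : ℝ)| * |qev ζ P| = |(x : ℝ)| * |qev ζ P'| := by
      rw [← abs_mul, ← abs_mul, he]
    rw [hx''] at e
    have hlt : (ht P : ℝ) < ht P' := by exact_mod_cast hP
    have : |(x : ℝ)| * |qev ζ P'| ≤ ht P * |qev ζ P| := by gcongr
    have : (ht P : ℝ) * |qev ζ P| < ht P' * |qev ζ P| := by gcongr
    linarith
  rcases exists_abs_eq_ht P' with h' | h' | h'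
  · exact key _ _ (by simp only [qev]; linear_combination r2 - ζ * r3) h' (abs_fst_le_ht P)
  · exact key _ _ (by simp only [qev]; linear_combination ζ ^ 2 * r3 - r1) h' (abs_snd_le_ht P)
  · exact key _ _ (by simp only [qev]; linear_combination ζ * r1 - ζ ^ 2 * r2) h'
      (abs_trd_le_ht P)

/-- `P'` is the minimal polynomial following `P` in the sequence of minimal polynomials. -/
def IsNext (ζ : ℝ) (P P' : ℤ × ℤ × ℤ) : Prop :=
  ht P < ht P' ∧ |qev ζ P'| < |qev ζ P| ∧ ∀ R, R ≠ 0 → ht R < ht P' → |qev ζ P| ≤ |qev ζ R|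

/-- `P` attains the minimal value at `ζ` among nonzero triples of at most the same height. -/
def IsMin (ζ : ℝ) (P : ℤ × ℤ × ℤ) : Prop :=
  P ≠ 0 ∧ ∀ R, R ≠ 0 → ht R ≤ ht P → |qev ζ P| ≤ |qev ζ R|

lemma exists_isMin_of_le (ζ : ℝ) {n : ℕ} {Q : ℤ × ℤ × ℤ} (hQ : Q ≠ 0) (hn : ht Q ≤ n) :
    ∃ P, IsMin ζ P ∧ ht P ≤ n ∧ ∀ R, R ≠ 0 → ht R ≤ n → |qev ζ P| ≤ |qev ζ R| := by
  obtain ⟨P, hP, hmin⟩ := Set.exists_min_image ({P | ht P ≤ n} \ {0}) (fun P => |qev ζ P|)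
    (finite_ht_le n).sdiff ⟨Q, hn, by simpa using hQ⟩
  have hmin' : ∀ R, R ≠ 0 → ht R ≤ n → |qev ζ P| ≤ |qev ζ R| := fun R h0 hR =>
    hmin R ⟨hR, by simpa using h0⟩
  exact ⟨P, ⟨by simpa using hP.2, fun R h0 hR => hmin' R h0 (hR.trans hP.1)⟩, hP.1, hmin'⟩

lemma exists_next {ζ w : ℝ} (hnz : ∀ P, qev ζ P = 0 → P = 0) (hw : 2 < w) (hU : UApprox ζ w)
    {P : ℤ × ℤ × ℤ} (hP : IsMin ζ P) : ∃ P', IsMin ζ P' ∧ IsNext ζ P P' := by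
  have hpos : 0 < |qev ζ P| := abs_pos.2 fun h => hP.1 (hnz P h)
  have hex : ∃ n : ℕ, ∃ R, R ≠ 0 ∧ ht R ≤ n ∧ |qev ζ R| < |qev ζ P| := by
    obtain ⟨X₀, hX₀⟩ := hU
    have h := (tendsto_rpow_neg_atTop (show 0 < w by linarith)).eventually (gt_mem_nhds hpos)
    obtain ⟨X, hX1, hX2⟩ := (h.and (eventually_ge_atTop X₀)).exists
    obtain ⟨R, h0, hR, hv⟩ := hX₀ X hX2
    obtain ⟨n, hn⟩ := exists_nat_ge X
    exact ⟨n, R, h0, by exact_mod_cast hR.trans hn, hv.trans_lt hX1⟩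
  classical
  obtain ⟨R, hR0, hRn, hRv⟩ := Nat.find_spec hex
  obtain ⟨P', hmin, hle, hall⟩ := exists_isMin_of_le ζ hR0 hRn
  have hlt : |qev ζ P'| < |qev ζ P| := (hall R hR0 hRn).trans_lt hRv
  refine ⟨P', hmin, ?_, hlt, fun S hS0 hS => ?_⟩
  · by_contra hc
    exact absurd (hP.2 P' hmin.1 (not_lt.1 hc)) (not_le.2 hlt)
  · by_contra hc
    exact Nat.find_min hex (hS.trans_le hle) ⟨S, hS0, le_rfl, not_le.1 hc⟩

lemma exists_minimal_sequence {ζ w : ℝ} (hnz : ∀ P, qev ζ P = 0 → P = 0) (hw : 2 < w)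
    (hU : UApprox ζ w) :
    ∃ s : ℕ → ℤ × ℤ × ℤ, (∀ n, s n ≠ 0) ∧ ∀ n, IsNext ζ (s n) (s (n + 1)) := by
  obtain ⟨P₀, hP₀, -⟩ := exists_isMin_of_le ζ (Q := (1, 0, 0)) (by simp) le_rfl
  choose f hf using fun P : {P // IsMin ζ P} => exists_next hnz hw hU P.2
  let g : ℕ → {P // IsMin ζ P} := fun n => Nat.rec ⟨P₀, hP₀⟩ (fun _ P => ⟨f P, (hf P).1⟩) n
  exact ⟨fun n => (g n).1, fun n => (g n).2.1, fun n => (hf (g n)).2⟩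

lemma exists_growth {ζ w : ℝ} (hnz : ∀ P, qev ζ P = 0 → P = 0) (hw : 2 < w)
    (hU : UApprox ζ w) :
    ∃ s : ℕ → ℤ × ℤ × ℤ, ∃ C : ℝ, ∃ N : ℕ,
      (∀ n, s n ≠ 0 ∧ IsNext ζ (s n) (s (n + 1))) ∧ ∀ i, N ≤ i →
        NoRoot (s i) ∧
        Real.log |qev ζ (s i)| ≤ -w * Real.log (ht (s (i + 1))) + C ∧
        (w - 1) * Real.log (ht (s (i + 1))) ≤
          Real.log (ht (s i)) + Real.log (ht (s (i + 1))) + C ∧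
        ∃ j, i < j ∧
          (w - 1) * Real.log (ht (s j)) ≤
            Real.log (ht (s i)) + Real.log (ht (s (i + 1))) + C ∧
          (w - 1) * Real.log (ht (s j)) ≤ Real.log (ht (s (j + 1))) + C := by
  obtain ⟨s, hs0, hs⟩ := exists_minimal_sequence hnz hw hU
  have hmono : StrictMono (fun n => ht (s n)) := strictMono_nat_of_lt_succ fun n => (hs n).1
  have hH : ∀ n, (0 : ℝ) < ht (s n) := fun n => by exact_mod_cast ht_pos (hs0 n)
  have hHn : ∀ n : ℕ, (n : ℝ) ≤ ht (s n) := fun n => by exact_mod_cast hmono.le_apply (x := n)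
  have hv : ∀ n, 0 < |qev ζ (s n)| := fun n => abs_pos.2 fun h => hs0 n (hnz _ h)
  have hcr : ∀ n, cross (s n) (s (n + 1)) ≠ 0 := fun n => cross_ne_zero (hs n).1 (hs n).2.1
  obtain ⟨c, hc, hroot⟩ := root_lower hnz hw hU
  obtain ⟨Y₀, hY₀, hY⟩ := eventually_rpow_small hw (show (0 : ℝ) < c / 8 by positivity)
  obtain ⟨X₀, hX₀⟩ := hU
  obtain ⟨N, hN⟩ := exists_nat_ge (2 * max X₀ Y₀)
  have hlarge : ∀ i, N ≤ i → X₀ ≤ (ht (s (i + 1)) : ℝ) / 2 ∧ Y₀ ≤ (ht (s (i + 1)) : ℝ) / 2 := by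
    intro i hi
    have h1 : (N : ℝ) ≤ ht (s (i + 1)) := by
      have := hHn (i + 1)
      have h2 : (N : ℝ) ≤ (i + 1 : ℕ) := by exact_mod_cast hi.trans (Nat.le_succ i)
      linarith
    constructor
    · linarith [le_max_left X₀ Y₀]
    · linarith [le_max_right X₀ Y₀]
  have hval : ∀ i, N ≤ i → |qev ζ (s i)| ≤ ((ht (s (i + 1)) : ℝ) / 2) ^ (-w) := by
    intro i hi
    obtain ⟨R, hR0, hRh, hRv⟩ := hX₀ _ (hlarge i hi).1
    refine ((hs i).2.2 R hR0 ?_).trans hRv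
    have : (ht R : ℝ) < ht (s (i + 1)) := by linarith [hH (i + 1)]
    exact_mod_cast this
  have hlogval : ∀ i, N ≤ i →
      Real.log |qev ζ (s i)| ≤ -w * Real.log (ht (s (i + 1))) + w * Real.log 2 := by
    intro i hi
    have h1 := Real.log_le_log (hv i) (hval i hi)
    rw [Real.log_rpow (by linarith [hH (i + 1)]),
      Real.log_div (hH (i + 1)).ne' two_ne_zero] at h1
    linarith
  have hnr : ∀ i, N ≤ i → NoRoot (s i) := by
    intro i hi
    by_contra hcon
    have h1 := hroot (s i) (hs0 i) hcon
    have h2 := hY _ (hlarge i hi).2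
    have h3 : (ht (s i) : ℝ) ≤ ht (s (i + 1)) := by exact_mod_cast (hs i).1.le
    have h4 : |qev ζ (s i)| * (ht (s i) : ℝ) ^ 2 ≤
        ((ht (s (i + 1)) : ℝ) / 2) ^ (-w) * (ht (s (i + 1)) : ℝ) ^ 2 := by
      gcongr
      exact hval i hi
    nlinarith
  set K : ℝ := 12 * |ζ| + 8 with hK
  have hK1 : 1 ≤ K := by have := abs_nonneg ζ; linarith
  have hplane : ∀ i j, N ≤ i → i ≤ j → dot (cross (s i) (s (i + 1))) (s j) = 0 →
      dot (cross (s i) (s (i + 1))) (s (j + 1)) = 0 →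
      (w - 1) * Real.log (ht (s (j + 1))) ≤
        Real.log (ht (s i)) + Real.log (ht (s (i + 1))) + (Real.log K + w * Real.log 2) := by
    intro i j hi hj h1 h2
    have h3 := one_le_of_plane (ζ := ζ) (hnr i hi) (hcr i) h1 h2 (hcr j) (hs j).1.le
      (hs j).2.1.le
    have h4 := Real.log_le_log one_pos h3
    have := hH i; have := hH (i + 1); have := hH (j + 1); have := hv j
    rw [Real.log_one, Real.log_mul (by positivity) (by positivity),
      Real.log_mul (by positivity) (by positivity), Real.log_mul (by positivity) (by positivity),
      Real.log_mul (by positivity) (by positivity)] at h4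
    have h5 := hlogval j (hi.trans hj)
    linarith
  have hz : ∀ i, dot (cross (s i) (s (i + 1))) (s i) = 0 ∧
      dot (cross (s i) (s (i + 1))) (s (i + 1)) = 0 := by
    intro i
    constructor <;> simp only [dot, cross] <;> ring
  have hlog2 : 0 < Real.log 2 := Real.log_pos one_lt_two
  have hlogK : 0 ≤ Real.log K := Real.log_nonneg hK1
  have hlog6 : 0 < Real.log 6 := Real.log_pos (by norm_num)
  have hw2 : 0 < w * Real.log 2 := by positivity
  refine ⟨s, Real.log K + w * Real.log 2 + Real.log 6, N, fun n => ⟨hs0 n, hs n⟩,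
    fun i hi => ⟨hnr i hi, ?_, ?_, ?_⟩⟩
  · linarith [hlogval i hi]
  · linarith [hplane i i hi le_rfl (hz i).1 (hz i).2]
  · have hex : ∃ m, i ≤ m ∧ dot (cross (s i) (s (i + 1))) (s m) ≠ 0 := by
      by_contra hcon
      push Not at hcon
      have hbd : ∀ j, i ≤ j → (w - 1) * Real.log (ht (s (j + 1))) ≤
        Real.log (ht (s i)) + Real.log (ht (s (i + 1))) + (Real.log K + w * Real.log 2) :=
        fun j hj => hplane i j hi hj (hcon j hj) (hcon (j + 1) (hj.trans j.le_succ))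
      have htend : Tendsto (fun j : ℕ => (w - 1) * Real.log ((j + 1 : ℕ) : ℝ)) atTop atTop :=
        ((Real.tendsto_log_atTop.comp tendsto_natCast_atTop_atTop).comp
          (tendsto_add_atTop_nat 1)).const_mul_atTop (by linarith)
      obtain ⟨j, hj1, hj2⟩ := ((htend.eventually_gt_atTop (Real.log (ht (s i)) +
        Real.log (ht (s (i + 1))) + (Real.log K + w * Real.log 2))).and
        (eventually_ge_atTop i)).exists
      have h1 := hbd j hj2
      have h2 : Real.log ((j + 1 : ℕ) : ℝ) ≤ Real.log (ht (s (j + 1))) :=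
        Real.log_le_log (by positivity) (hHn (j + 1))
      have h3 : (w - 1) * Real.log ((j + 1 : ℕ) : ℝ) ≤ (w - 1) * Real.log (ht (s (j + 1))) :=
        mul_le_mul_of_nonneg_left h2 (by linarith)
      exact not_lt.2 (h3.trans h1) hj1
    classical
    obtain ⟨him, hm⟩ := Nat.find_spec hex
    have hmin : ∀ m, i ≤ m → m < Nat.find hex → dot (cross (s i) (s (i + 1))) (s m) = 0 := by
      intro m h1 h2
      by_contra h3
      exact Nat.find_min hex h2 ⟨h1, h3⟩
    have hge : i + 2 ≤ Nat.find hex := by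
      by_contra hlt
      have : Nat.find hex = i ∨ Nat.find hex = i + 1 := by omega
      rcases this with h | h <;> rw [h] at hm
      · exact hm (hz i).1
      · exact hm (hz i).2
    obtain ⟨j, hj⟩ := Nat.exists_eq_add_of_le hge
    have hj' : Nat.find hex = i + j + 1 + 1 := by omega
    rw [hj'] at hm hmin
    have z1 := hmin (i + j) (by omega) (by omega)
    have z2 := hmin (i + j + 1) (by omega) (by omega)
    refine ⟨i + j + 1, by omega, ?_, ?_⟩
    · linarith [hplane i (i + j) hi (by omega) z1 z2]
    · have h1 := one_le_of_independent (dot_cross_ne_zero z1 z2 (hcr (i + j)) hm)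
        (hs (i + j)).1.le (hs (i + j + 1)).1.le (hs (i + j)).2.1.le (hs (i + j + 1)).2.1.le
      have h4 := Real.log_le_log one_pos h1
      have := hH (i + j + 1); have := hH (i + j + 1 + 1); have := hv (i + j)
      rw [Real.log_one, Real.log_mul (by positivity) (by positivity),
        Real.log_mul (by positivity) (by positivity),
        Real.log_mul (by positivity) (by positivity)] at h4
      have h5 := hlogval (i + j) (by omega)
      linarith

/-- The rational polynomial encoded by an integer triple. -/
noncomputable def toPoly (P : ℤ × ℤ × ℤ) : ℚ[X] :=
  C (P.1 : ℚ) * X ^ 2 + C (P.2.1 : ℚ) * X + C (P.2.2 : ℚ)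

lemma toPoly_coeff (P : ℤ × ℤ × ℤ) :
    (toPoly P).coeff 0 = P.2.2 ∧ (toPoly P).coeff 1 = P.2.1 ∧ (toPoly P).coeff 2 = P.1 := by
  simp [toPoly, coeff_X, coeff_C, -map_intCast, -eq_intCast]

lemma natDegree_toPoly_le (P : ℤ × ℤ × ℤ) : (toPoly P).natDegree ≤ 2 :=
  natDegree_quadratic_le

lemma natDegree_toPoly {P : ℤ × ℤ × ℤ} (hP : NoRoot P) : (toPoly P).natDegree = 2 := by
  apply natDegree_quadratic
  intro h
  have ha : P.1 = 0 := by exact_mod_cast h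
  exact one_ne_zero (hP 1 0 (by simp [ha])).1

lemma irreducible_toPoly {P : ℤ × ℤ × ℤ} (hP : NoRoot P) : Irreducible (toPoly P) := by
  apply irreducible_of_degree_le_three_of_not_isRoot (by simp [natDegree_toPoly hP])
  intro x hx
  have hd : (x.den : ℚ) ≠ 0 := by exact_mod_cast x.den_nz
  have h1 : (P.1 : ℚ) * x.num ^ 2 + P.2.1 * x.num * x.den + P.2.2 * x.den ^ 2 = 0 := by
    have h2 : (P.1 : ℚ) * x ^ 2 + P.2.1 * x + P.2.2 = 0 := by
      simpa [toPoly, IsRoot] using hx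
    have h3 : (x.num : ℚ) = x * x.den := (Rat.mul_den_eq_num x).symm
    rw [h3]
    linear_combination (x.den : ℚ) ^ 2 * h2
  have := (hP x.num x.den (by exact_mod_cast h1)).2
  exact x.den_nz (by exact_mod_cast this)

lemma not_toPoly_dvd {A Q : ℤ × ℤ × ℤ} (hQ : NoRoot Q) (hA : cross A Q ≠ 0) :
    ¬ toPoly Q ∣ toPoly A := by
  rintro ⟨D, hD⟩
  have hQ0 : toPoly Q ≠ 0 := (irreducible_toPoly hQ).ne_zero
  have hD0 : D.natDegree = 0 := by
    by_cases h0 : D = 0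
    · simp [h0]
    · have h1 := natDegree_mul hQ0 h0
      rw [← hD, natDegree_toPoly hQ] at h1
      have := natDegree_toPoly_le A
      omega
  rw [eq_C_of_natDegree_eq_zero hD0] at hD
  set t := D.coeff 0
  obtain ⟨a0, a1, a2⟩ := toPoly_coeff A
  obtain ⟨q0, q1, q2⟩ := toPoly_coeff Q
  rw [hD, coeff_mul_C] at a0 a1 a2
  rw [q0] at a0
  rw [q1] at a1
  rw [q2] at a2
  apply hA
  simp only [cross, Prod.mk_eq_zero]
  refine ⟨?_, ?_, ?_⟩
  · have : (A.2.1 : ℚ) * Q.2.2 - A.2.2 * Q.2.1 = 0 := by rw [← a0, ← a1]; ring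
    exact_mod_cast this
  · have : (A.2.2 : ℚ) * Q.1 - A.1 * Q.2.2 = 0 := by rw [← a0, ← a2]; ring
    exact_mod_cast this
  · have : (A.1 : ℚ) * Q.2.1 - A.2.1 * Q.1 = 0 := by rw [← a2, ← a1]; ring
    exact_mod_cast this

/-- The coefficients, in increasing order of degree, of `Q`, `T Q`, `T² Q` and `A B`. -/
def quarticRows (A B Q : ℤ × ℤ × ℤ) : Fin 4 → Fin 5 → ℤ :=
  ![![Q.2.2, Q.2.1, Q.1, 0, 0], ![0, Q.2.2, Q.2.1, Q.1, 0], ![0, 0, Q.2.2, Q.2.1, Q.1],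
    ![A.2.2 * B.2.2, A.2.1 * B.2.2 + A.2.2 * B.2.1,
      A.1 * B.2.2 + A.2.1 * B.2.1 + A.2.2 * B.1, A.1 * B.2.1 + A.2.1 * B.1, A.1 * B.1]]

lemma linearIndependent_quarticRows {A B Q : ℤ × ℤ × ℤ} (hQ : NoRoot Q) (hA : cross A Q ≠ 0)
    (hB : cross B Q ≠ 0) :
    LinearIndependent ℚ (fun i j => (quarticRows A B Q i j : ℚ)) := by
  rw [Fintype.linearIndependent_iff]
  intro g hg
  have e : ∀ j, ∑ i, g i * (quarticRows A B Q i j : ℚ) = 0 := fun j => by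
    simpa using congrFun hg j
  have e0 := e 0
  have e1 := e 1
  have e2 := e 2
  have e3 := e 3
  have e4 := e 4
  simp only [Fin.sum_univ_four, quarticRows, Matrix.cons_val, Int.cast_add, Int.cast_mul,
    Int.cast_zero] at e0 e1 e2 e3 e4
  have hpoly : (C (g 2) * X ^ 2 + C (g 1) * X + C (g 0)) * toPoly Q +
      C (g 3) * (toPoly A * toPoly B) = 0 := by
    have c0 := congrArg (C : ℚ → ℚ[X]) e0
    have c1 := congrArg (C : ℚ → ℚ[X]) e1
    have c2 := congrArg (C : ℚ → ℚ[X]) e2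
    have c3 := congrArg (C : ℚ → ℚ[X]) e3
    have c4 := congrArg (C : ℚ → ℚ[X]) e4
    simp only [C_add, C_mul, C_0] at c0 c1 c2 c3 c4
    simp only [toPoly]
    linear_combination c0 + X * c1 + X ^ 2 * c2 + X ^ 3 * c3 + X ^ 4 * c4
  have hirr := irreducible_toPoly hQ
  have h3 : g 3 = 0 := by
    by_contra h3
    have hdvd : toPoly Q ∣ C (g 3) * (toPoly A * toPoly B) :=
      ⟨-(C (g 2) * X ^ 2 + C (g 1) * X + C (g 0)), by linear_combination hpoly⟩
    have hu : IsUnit (C (g 3)) := isUnit_C.2 (isUnit_iff_ne_zero.2 h3)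
    rcases hirr.prime.dvd_or_dvd (hu.dvd_mul_left.1 hdvd) with h | h
    · exact not_toPoly_dvd hQ hA h
    · exact not_toPoly_dvd hQ hB h
  rw [h3, C_0, zero_mul, add_zero] at hpoly
  have h0 := (mul_eq_zero.1 hpoly).resolve_right hirr.ne_zero
  have k : ∀ n, (C (g 2) * X ^ 2 + C (g 1) * X + C (g 0)).coeff n = 0 := fun n => by
    rw [h0, coeff_zero]
  have k0 := k 0
  have k1 := k 1
  have k2 := k 2
  simp [coeff_X, coeff_C] at k0 k1 k2
  intro i
  fin_cases i <;> assumption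

lemma exists_dual_point_of_quadratics {ζ : ℝ} {A B Q : ℤ × ℤ × ℤ} (hQ : NoRoot Q)
    (hA : cross A Q ≠ 0) (hB : cross B Q ≠ 0) {H V : ℝ} (hH : 1 ≤ H) (hV : 0 < V)
    (hQH : ht Q ≤ H) (hABH : (ht A : ℝ) * ht B ≤ H) (hQV : |qev ζ Q| ≤ V)
    (hABV : |qev ζ A| * |qev ζ B| ≤ V) :
    ∃ u : Fin 5 → ℤ, u ≠ 0 ∧ |(u 0 : ℝ)| ≤ 120 * (3 * H) ^ 4 ∧
      ∀ i : Fin 5, |ζ ^ (i : ℕ) * (u 0 : ℝ) - u i| ≤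
        120 * (3 * H) ^ 3 * ((1 + |ζ|) ^ 2 * V) := by
  have hz := abs_nonneg ζ
  refine exists_dual_point ζ _ (linearIndependent_quarticRows hQ hA hB) (by linarith)
    (by positivity) ?_ ?_
  · have q1 := (abs_fst_le_ht Q).trans hQH
    have q2 := (abs_snd_le_ht Q).trans hQH
    have q3 := (abs_trd_le_ht Q).trans hQH
    have hprod : ∀ x y : ℝ, |x| ≤ ht A → |y| ≤ ht B → |x * y| ≤ H := fun x y hx hy => by
      rw [abs_mul]
      exact (mul_le_mul hx hy (abs_nonneg _) (by positivity)).trans hABH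
    have a1 := abs_fst_le_ht A
    have a2 := abs_snd_le_ht A
    have a3 := abs_trd_le_ht A
    have b1 := abs_fst_le_ht B
    have b2 := abs_snd_le_ht B
    have b3 := abs_trd_le_ht B
    have m11 := hprod _ _ a1 b1
    have m12 := hprod _ _ a1 b2
    have m13 := hprod _ _ a1 b3
    have m21 := hprod _ _ a2 b1
    have m22 := hprod _ _ a2 b2
    have m23 := hprod _ _ a2 b3
    have m31 := hprod _ _ a3 b1
    have m32 := hprod _ _ a3 b2
    have m33 := hprod _ _ a3 b3
    have hadd : ∀ x y X Y : ℝ, |x| ≤ X → |y| ≤ Y → |x + y| ≤ X + Y := fun x y X Y hx hy =>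
      (abs_add_le _ _).trans (add_le_add hx hy)
    have s1 := hadd _ _ _ _ m23 m32
    have s2 := hadd _ _ _ _ (hadd _ _ _ _ m13 m22) m31
    have s3 := hadd _ _ _ _ m12 m21
    intro i j
    fin_cases i <;> fin_cases j <;>
      simp only [quarticRows, Matrix.cons_val, Fin.zero_eta, Fin.mk_one, Fin.reduceFinMk,
        Int.cast_zero, abs_zero, Int.cast_add, Int.cast_mul] <;> linarith
  · have hV1 : V ≤ (1 + |ζ|) ^ 2 * V := le_mul_of_one_le_left hV.le (by nlinarith)
    have p1 : |qev ζ Q| ≤ (1 + |ζ|) ^ 2 * V := hQV.trans hV1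
    have p2 : |ζ * qev ζ Q| ≤ (1 + |ζ|) ^ 2 * V := by
      rw [abs_mul]
      exact mul_le_mul (by nlinarith) hQV (abs_nonneg _) (by positivity)
    have p3 : |ζ ^ 2 * qev ζ Q| ≤ (1 + |ζ|) ^ 2 * V := by
      rw [abs_mul, abs_pow]
      exact mul_le_mul (by nlinarith) hQV (abs_nonneg _) (by positivity)
    have p4 : |qev ζ A * qev ζ B| ≤ (1 + |ζ|) ^ 2 * V := by
      rw [abs_mul]
      exact hABV.trans hV1
    intro i
    fin_cases i
    · convert p1 using 2
      simp [Fin.sum_univ_five, quarticRows, qev]; ring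
    · convert p2 using 2
      simp [Fin.sum_univ_five, quarticRows, qev]; ring
    · convert p3 using 2
      simp [Fin.sum_univ_five, quarticRows, qev]; ring
    · convert p4 using 2
      simp [Fin.sum_univ_five, quarticRows, qev]; ring

lemma growth_estimates {g δ C hi hi1 hj hj1 hk hk1 : ℝ} (hg : g ^ 2 = g + 1)
    (hg1 : 1.6 < g) (hg2 : g < 1.62) (hδ : 0 < δ) (hδ1 : δ ≤ 1 / 100) (hC : C ≤ δ * hi)
    (hi0 : 0 < hi) (oij : hi ≤ hj) (oij1 : hi1 ≤ hj) (ojk : hj ≤ hk) (ojk1 : hj1 ≤ hk)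
    (Di : (g - δ) * hi ≤ hi1 + C) (Dj : (g - δ) * hj ≤ hj1 + C)
    (Dk : (g - δ) * hk ≤ hk1 + C) (Rj : (g - δ) * hj1 ≤ hj + hj1 + C)
    (Pij : (g - δ) * hj ≤ hi + hi1 + C) (Pjk : (g - δ) * hk ≤ hj + hj1 + C) :
    hi + hj ≤ (1 + 50 * δ) * hk ∧
    (2 * g + 1 - 50 * δ) * hk ≤ (g + 1 - δ) * (hi1 + hj1) - 2 * C ∧
    (2 * g + 1 - 50 * δ) * hk ≤ (g + 1 - δ) * hk1 - C := by
  have hj0 : 0 < hj := by linarith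
  have hk0 : 0 < hk := by linarith
  have Cj : C ≤ δ * hj := hC.trans (by gcongr)
  have Ck : C ≤ δ * hk := Cj.trans (by gcongr)
  have dg1 : δ * 1.6 ≤ δ * g := by gcongr
  have dg2 : δ * g ≤ δ * 1.62 := by gcongr
  have dd1 : 0 < δ * δ := by positivity
  have dd2 : δ * δ ≤ δ * (1 / 100) := by gcongr
  have inv : 1 ≤ (g - 2 * δ) * (g - 1 + 2 * δ) := by linarith
  have key : ∀ x y : ℝ, 0 ≤ x → (g - 2 * δ) * x ≤ y → x ≤ (g - 1 + 2 * δ) * y := by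
    intro x y hx hxy
    calc x ≤ (g - 2 * δ) * (g - 1 + 2 * δ) * x := le_mul_of_one_le_left hx inv
      _ = (g - 1 + 2 * δ) * ((g - 2 * δ) * x) := by ring
      _ ≤ (g - 1 + 2 * δ) * y := mul_le_mul_of_nonneg_left hxy (by linarith)
  have ci : 0 ≤ δ * hi := by positivity
  have cj : 0 ≤ δ * hj := by positivity
  have ck : 0 ≤ δ * hk := by positivity
  have i1 := key hi hi1 hi0.le (by linarith)
  have j1 := key hj hj1 hj0.le (by linarith)
  have hi10 : 0 < hi1 := by nlinarith
  have hj10 : 0 < hj1 := by nlinarith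
  have back : ∀ x y z : ℝ, 0 ≤ y → x ≤ (g - 1 + 2 * δ) * y → (g - δ) * z ≤ x + y + δ * x →
      0 ≤ z → (1 - 5 * δ) * z ≤ y := by
    intro x y z hy hxy hz hz0
    have h1 : (g - δ) * z ≤ (g + 3 * δ) * y := by
      have : (1 + δ) * x ≤ (1 + δ) * ((g - 1 + 2 * δ) * y) := by gcongr
      have h2 : 0 ≤ δ * y := by positivity
      have h3 : δ * (g - 1 + 2 * δ) * y ≤ δ * y := by
        rw [mul_right_comm]
        exact mul_le_of_le_one_right h2 (by linarith)
      linarith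
    have h4 : (1 - 5 * δ) * (g + 3 * δ) ≤ g - δ := by linarith
    have h5 : (g + 3 * δ) * ((1 - 5 * δ) * z) ≤ (g + 3 * δ) * y := by
      have := mul_le_mul_of_nonneg_right h4 hz0
      linarith
    exact le_of_mul_le_mul_left h5 (by linarith)
  have i2 := back hi hi1 hj hi10.le i1 (by linarith) hj0.le
  have j2 := back hj hj1 hk hj10.le j1 (by linarith) hk0.le
  have j3 : (g - 1 + 2 * δ) * hj1 ≤ (g - 1 + 2 * δ) * hk := by gcongr; linarith
  have i3 : (g - 1 + 2 * δ) * hi1 ≤ (g - 1 + 2 * δ) * ((g - 1 + 2 * δ) * hk) := by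
    gcongr
    · linarith
    · linarith
  refine ⟨?_, ?_, ?_⟩
  · have : (g - 1 + 2 * δ) + (g - 1 + 2 * δ) * (g - 1 + 2 * δ) ≤ 1 + 50 * δ := by linarith
    have := mul_le_mul_of_nonneg_right this hk0.le
    linarith
  · have r1 : (g - 1 - 3 * δ) * hj1 ≤ hj := by
      have h1 : (1 + δ) * (g - 1 - 3 * δ) ≤ g - 1 - δ := by linarith
      have h2 := mul_le_mul_of_nonneg_right h1 hj10.le
      have h3 : (1 + δ) * ((g - 1 - 3 * δ) * hj1) ≤ (1 + δ) * hj := by linarith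
      exact le_of_mul_le_mul_left h3 (by linarith)
    have r2 : (g - 1 - 3 * δ) * ((1 - 5 * δ) * hk) ≤ (g - 1 - 3 * δ) * hj1 := by
      gcongr
      linarith
    have r3 : (g - 1 - 7 * δ) * hk ≤ hj := by
      have : g - 1 - 7 * δ ≤ (g - 1 - 3 * δ) * (1 - 5 * δ) := by linarith
      have := mul_le_mul_of_nonneg_right this hk0.le
      linarith
    have r4 : (1 - 5 * δ) * ((g - 1 - 7 * δ) * hk) ≤ (1 - 5 * δ) * hj := by
      gcongr
      linarith
    have r5 : (g + 1 - δ) * ((1 - 5 * δ) * ((g - 1 - 7 * δ) * hk) + (1 - 5 * δ) * hk) ≤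
        (g + 1 - δ) * (hi1 + hj1) := by
      gcongr
      · linarith
      · linarith
    have r6 : 2 * g + 1 - 48 * δ ≤ (g + 1 - δ) * ((1 - 5 * δ) * (g - 7 * δ)) := by
      have e1 : g - 16 * δ ≤ (1 - 5 * δ) * (g - 7 * δ) := by linarith
      have e2 := mul_le_mul_of_nonneg_left e1 (show 0 ≤ g + 1 - δ by linarith)
      linarith
    have := mul_le_mul_of_nonneg_right r6 hk0.le
    linarith
  · have r1 : (g + 1 - δ) * ((g - 2 * δ) * hk) ≤ (g + 1 - δ) * hk1 := by
      gcongr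
      · linarith
      · linarith
    have r2 : 2 * g + 1 - 40 * δ ≤ (g + 1 - δ) * (g - 2 * δ) := by linarith
    have := mul_le_mul_of_nonneg_right r2 hk0.le
    linarith

lemma eq_zero_of_qev_eq_zero {ζ : ℝ} (hζ : Transcendental ℚ ζ) (P : ℤ × ℤ × ℤ)
    (hP : qev ζ P = 0) : P = 0 := by
  have hp : toPoly P = 0 := by
    by_contra h0
    exact hζ ⟨toPoly P, h0, by simpa [toPoly, qev] using hP⟩
  obtain ⟨a0, a1, a2⟩ := toPoly_coeff P
  rw [hp, coeff_zero] at a0 a1 a2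
  exact Prod.ext (by exact_mod_cast a2.symm)
    (Prod.ext (by exact_mod_cast a1.symm) (by exact_mod_cast a0.symm))

lemma natAbs_coeff_le_polyH (P : Polynomial ℤ) (n : ℕ) : ((P.coeff n).natAbs : ℝ) ≤ polyH P := by
  rw [polyH]
  by_cases h : n ∈ P.support
  · exact_mod_cast Finset.le_sup (f := fun i => (P.coeff i).natAbs) h
  · rw [notMem_support_iff.1 h]
    simp

lemma uApprox_of_isExtremal {ζ w : ℝ} (hζ : IsExtremal ζ) (hw : w < (3 + Real.sqrt 5) / 2) :
    UApprox ζ w := by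
  have hne : (whSet 2 ζ).Nonempty := by
    by_contra h
    rw [Set.not_nonempty_iff_eq_empty] at h
    have h1 := hζ.2
    rw [whExp, h, Real.sSup_empty] at h1
    have := Real.sqrt_nonneg 5
    linarith
  obtain ⟨w', ⟨X₀, hX₀⟩, hw'⟩ := exists_lt_of_lt_csSup hne (hw.trans_eq hζ.2.symm)
  refine ⟨max X₀ 1, fun X hX => ?_⟩
  have hX1 : 1 ≤ X := (le_max_right _ _).trans hX
  obtain ⟨P, hdeg, hH, hpos, hle⟩ := hX₀ X ((le_max_left _ _).trans hX)
  have hev : qev ζ (P.coeff 2, P.coeff 1, P.coeff 0) = pev ζ P := by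
    rw [pev, aeval_eq_sum_range' (by omega : P.natDegree < 3)]
    simp [Finset.sum_range_succ, qev]
    ring
  refine ⟨(P.coeff 2, P.coeff 1, P.coeff 0), ?_, ?_, ?_⟩
  · intro h0
    rw [← hev, h0] at hpos
    simp [qev] at hpos
  · refine le_trans ?_ hH
    rw [ht, Nat.cast_max, Nat.cast_max]
    exact max_le (natAbs_coeff_le_polyH P 2)
      (max_le (natAbs_coeff_le_polyH P 1) (natAbs_coeff_le_polyH P 0))
  · rw [hev]
    exact hle.trans (Real.rpow_le_rpow_of_exponent_le hX1 (by linarith))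

lemma bddAbove_lamSet {ζ w : ℝ} (hnz : ∀ P, qev ζ P = 0 → P = 0) (hw : 2 < w)
    (hU : UApprox ζ w) : BddAbove (lamSet 4 ζ) := by
  obtain ⟨c, hc, hlow⟩ := linear_lower hnz hw hU
  refine ⟨3, fun η hη => ?_⟩
  by_contra! h3
  obtain ⟨X, hX, x, y, hne, hx, hy⟩ := hη ((|ζ| + 1) ^ 2 / c + 2)
  have hz := abs_nonneg ζ
  have hX2 : 2 ≤ X := by
    have : 0 ≤ (|ζ| + 1) ^ 2 / c := by positivity
    linarith
  have hX0 : 0 < X := by linarith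
  have hsmall : X ^ (-η) ≤ 1 / X ^ 3 := by
    have h := Real.rpow_le_rpow_of_exponent_le (by linarith : 1 ≤ X) (by linarith : -η ≤ -3)
    rwa [Real.rpow_neg hX0.le 3, ← one_div, show (3 : ℝ) = ((3 : ℕ) : ℝ) by norm_num,
      Real.rpow_natCast] at h
  have hlt1 : 1 / X ^ 3 < 1 := by
    rw [div_lt_one (by positivity)]
    exact one_lt_pow₀ (by linarith) (by norm_num)
  have hxy : ¬ (y 0 = 0 ∧ x = 0) := by
    rintro ⟨-, rfl⟩
    rcases hne with h | h
    · exact h rfl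
    · apply h
      funext i
      have h1 := (hy i).trans_lt (hsmall.trans_lt hlt1)
      rw [Int.cast_zero, mul_zero, zero_sub, abs_neg] at h1
      exact Int.abs_lt_one_iff.1 (by exact_mod_cast h1)
  have hl := hlow (y 0) x hxy
  have hy0 := hy 0
  simp only [Fin.val_zero, zero_add, pow_one] at hy0
  rw [mul_comm] at hy0
  have hx' : |(x : ℝ)| ≤ X := by exact_mod_cast hx
  have hmax : max |(y 0 : ℝ)| |(x : ℝ)| ≤ (|ζ| + 1) * X := by
    apply max_le
    · have h1 : |(y 0 : ℝ)| ≤ |x * ζ| + |x * ζ - y 0| := by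
        have := abs_sub (x * ζ) (x * ζ - y 0)
        rwa [sub_sub_cancel] at this
      rw [abs_mul] at h1
      have : |(x : ℝ)| * |ζ| ≤ X * |ζ| := by gcongr
      linarith
    · nlinarith
  have hfin : |x * ζ - y 0| * max |(y 0 : ℝ)| |(x : ℝ)| ^ 2 ≤
      1 / X ^ 3 * ((|ζ| + 1) * X) ^ 2 := by
    gcongr
    exact hy0.trans hsmall
  have heq : 1 / X ^ 3 * ((|ζ| + 1) * X) ^ 2 = (|ζ| + 1) ^ 2 / X := by
    field_simp
  have hclt : (|ζ| + 1) ^ 2 / X < c := by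
    rw [div_lt_iff₀ hX0, ← div_lt_iff₀' hc]
    linarith
  linarith

lemma dual_error_le {g η ε h Z : ℝ} (hZ : 0 < Z) (hε : 4 * η + 12 * ε = 2 * g - 2)
    (hh : (1 + η) * Real.log 120 + (3 + 4 * η) * Real.log 3 + 2 * Real.log Z ≤
      (8 - 4 * η) * ε * h) :
    120 * (3 * Real.exp ((1 + ε) * h)) ^ 3 * (Z ^ 2 * Real.exp (-(2 * g + 1 - ε) * h)) ≤
      (120 * (3 * Real.exp ((1 + ε) * h)) ^ 4) ^ (-η) := by
  have hE := Real.exp_pos ((1 + ε) * h)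
  have hF := Real.exp_pos (-(2 * g + 1 - ε) * h)
  rw [← Real.log_le_log_iff (by positivity) (by positivity), Real.log_rpow (by positivity),
    Real.log_mul (by positivity) (by positivity), Real.log_mul (by positivity) (by positivity),
    Real.log_mul (by positivity) (by positivity), Real.log_mul (by positivity) (by positivity),
    Real.log_pow, Real.log_pow, Real.log_pow, Real.log_mul (by positivity) (by positivity),
    Real.log_exp, Real.log_exp]
  push_cast
  have : g = 2 * η + 6 * ε + 1 := by linarith
  subst this
  linarith

lemma mem_lamSet_of_lt {ζ η : ℝ} (hζ : IsExtremal ζ) (h0 : 0 < η)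
    (hη : η < (Real.sqrt 5 - 1) / 4) : η ∈ lamSet 4 ζ := by
  intro X₀
  have hs5 : Real.sqrt 5 ^ 2 = 5 := Real.sq_sqrt (by norm_num)
  have hs1 : 2.2 < Real.sqrt 5 := Real.lt_sqrt_of_sq_lt (by norm_num)
  have hs2 : Real.sqrt 5 < 2.24 := (Real.sqrt_lt' (by norm_num)).2 (by norm_num)
  obtain ⟨g, hgdef⟩ : ∃ g, g = (1 + Real.sqrt 5) / 2 := ⟨_, rfl⟩
  have hg : g ^ 2 = g + 1 := by rw [hgdef]; linarith
  have hg1 : 1.6 < g := by linarith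
  have hg2 : g < 1.62 := by linarith
  obtain ⟨ε, hεdef⟩ : ∃ ε, ε = (2 * g - 2 - 4 * η) / 12 := ⟨_, rfl⟩
  have hε : 0 < ε := by linarith
  obtain ⟨δ, hδ, hδ1, hδε⟩ : ∃ δ : ℝ, 0 < δ ∧ δ ≤ 1 / 100 ∧ 50 * δ ≤ ε :=
    ⟨min (ε / 50) (1 / 100), lt_min (by linarith) (by norm_num), min_le_right _ _, by
      have := min_le_left (ε / 50) (1 / 100)
      linarith⟩
  have hnz := eq_zero_of_qev_eq_zero hζ.1
  have hw : 2 < g + 1 - δ := by linarith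
  obtain ⟨s, C, N, hs, hgr⟩ := exists_growth hnz hw
    (uApprox_of_isExtremal hζ (by linarith : g + 1 - δ < _))
  rw [show g + 1 - δ - 1 = g - δ by ring] at hgr
  have hmono : StrictMono fun n => ht (s n) := strictMono_nat_of_lt_succ fun n => (hs n).2.1
  have hanti : StrictAnti fun n => |qev ζ (s n)| :=
    strictAnti_nat_of_succ_lt fun n => (hs n).2.2.1
  have hpos : ∀ n, (0 : ℝ) < ht (s n) := fun n => by exact_mod_cast ht_pos (hs n).1
  have hvpos : ∀ n, 0 < |qev ζ (s n)| := fun n => abs_pos.2 fun h => (hs n).1 (hnz _ h)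
  have hL : ∀ m n, m ≤ n → Real.log (ht (s m)) ≤ Real.log (ht (s n)) := fun m n hmn =>
    Real.log_le_log (hpos m) (by exact_mod_cast hmono.monotone hmn)
  obtain ⟨T, hT1, hTC, hTX, hTK⟩ : ∃ T : ℝ, 1 ≤ T ∧ C / δ ≤ T ∧ X₀ ≤ T ∧
      ((1 + η) * Real.log 120 + (3 + 4 * η) * Real.log 3 + 2 * Real.log (1 + |ζ|)) /
        (5 * ε) ≤ T :=
    ⟨max (max 1 (C / δ)) (max X₀ _), (le_max_left _ _).trans (le_max_left _ _),
      (le_max_right _ _).trans (le_max_left _ _), (le_max_left _ _).trans (le_max_right _ _),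
      (le_max_right _ _).trans (le_max_right _ _)⟩
  obtain ⟨M, hM⟩ := exists_nat_ge (Real.exp T)
  have hlarge : ∀ n, M ≤ n → T ≤ Real.log (ht (s n)) := fun n hn => by
    rw [Real.le_log_iff_exp_le (hpos n)]
    exact hM.trans (by exact_mod_cast hn.trans (hmono.le_apply (x := n)))
  obtain ⟨-, -, -, i, hi, -, Di⟩ := hgr (max N M) (le_max_left _ _)
  have hNi : N ≤ i := (le_max_left _ _).trans hi.le
  have hMi : M ≤ i := (le_max_right _ _).trans hi.le
  obtain ⟨-, vA, -, j, hij, Pij, Dj⟩ := hgr i hNi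
  obtain ⟨-, vB, Rj, k, hjk, Pjk, Dk⟩ := hgr j (hNi.trans hij.le)
  obtain ⟨hroot, vQ, -, -⟩ := hgr k ((hNi.trans hij.le).trans hjk.le)
  have hTi := hlarge i hMi
  obtain ⟨e1, e2, e3⟩ := growth_estimates hg hg1 hg2 hδ hδ1
    (((div_le_iff₀' hδ).1 hTC).trans (by gcongr)) (by linarith) (hL i j hij.le)
    (hL (i + 1) j hij) (hL j k hjk.le) (hL (j + 1) k hjk) Di Dj Dk Rj Pij Pjk
  have hTk : T ≤ Real.log (ht (s k)) := hTi.trans (hL i k (hij.trans hjk).le)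
  set h := Real.log (ht (s k)) with hh
  have hhpos : 0 < h := by linarith
  have hεh : 50 * δ * h ≤ ε * h := by gcongr
  have hεh0 : 0 < ε * h := by positivity
  obtain ⟨u, hu, hu0, herr⟩ := exists_dual_point_of_quadratics (ζ := ζ) (A := s i) (B := s j)
    (H := Real.exp ((1 + ε) * h)) (V := Real.exp (-(2 * g + 1 - ε) * h)) hroot
    (cross_ne_zero (hmono (hij.trans hjk)) (hanti (hij.trans hjk)))
    (cross_ne_zero (hmono hjk) (hanti hjk))
    (Real.one_le_exp (by positivity)) (Real.exp_pos _)
    (by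
      rw [← Real.log_le_iff_le_exp (hpos k)]
      linarith)
    (by
      rw [← Real.log_le_iff_le_exp (mul_pos (hpos i) (hpos j)),
        Real.log_mul (hpos i).ne' (hpos j).ne']
      linarith)
    (by
      rw [← Real.log_le_iff_le_exp (hvpos k)]
      linarith)
    (by
      rw [← Real.log_le_iff_le_exp (mul_pos (hvpos i) (hvpos j)),
        Real.log_mul (hvpos i).ne' (hvpos j).ne']
      linarith)
  have hζ1 : 0 < 1 + |ζ| := by positivity
  have herr2 := dual_error_le (h := h) hζ1 (by linarith : 4 * η + 12 * ε = 2 * g - 2) (by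
    have h1 := (div_le_iff₀' (by positivity)).1 (hTK.trans hTk)
    have h2 : 5 * ε * h ≤ (8 - 4 * η) * ε * h := by
      gcongr
      linarith
    linarith)
  refine ⟨120 * (3 * Real.exp ((1 + ε) * h)) ^ 4, ?_, u 0, fun t => u t.succ, ?_, ?_, ?_⟩
  · have h1 : h ≤ Real.exp ((1 + ε) * h) := by
      have := Real.add_one_le_exp ((1 + ε) * h)
      linarith
    have h2 : 1 ≤ 3 * Real.exp ((1 + ε) * h) := by linarith
    have h3 := le_self_pow₀ h2 (by norm_num : 4 ≠ 0)
    linarith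
  · by_contra! hcon
    apply hu
    funext t
    refine Fin.cases hcon.1 (fun t => ?_) t
    exact congrFun hcon.2 t
  · exact_mod_cast hu0
  · intro t
    have := herr t.succ
    rw [Fin.val_succ] at this
    exact this.trans herr2

end QuadApprox

theorem extremal_lambda4_lower (ζ : ℝ) (hζ : IsExtremal ζ) :
    (Real.sqrt 5 - 1) / 4 ≤ lamExp 4 ζ := by
  have hs : 2.2 < Real.sqrt 5 := Real.lt_sqrt_of_sq_lt (by norm_num)
  have hbdd := QuadApprox.bddAbove_lamSet (QuadApprox.eq_zero_of_qev_eq_zero hζ.1)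
    (by norm_num : (2 : ℝ) < 2.5) (QuadApprox.uApprox_of_isExtremal hζ (by linarith))
  refine le_of_forall_lt fun η hη => ?_
  obtain ⟨η', h1, h2⟩ := exists_between (max_lt hη (by linarith : 0 < (Real.sqrt 5 - 1) / 4))
  exact ((le_max_left _ _).trans_lt h1).trans_le (le_csSup hbdd
    (QuadApprox.mem_lamSet_of_lt hζ ((le_max_right _ _).trans_lt h1) h2))
end

section
/- Let ζ be an extremal number and suppose that w_4(ζ) = 2 + √5. Then λ_4(ζ) = (√5 − 1)/4. -/
open Polynomial

/-- The integer polynomial with prescribed coefficients. -/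
noncomputable def vecPoly {m : ℕ} (t : Fin m → ℤ) : Polynomial ℤ := ∑ i, C (t i) * X ^ (i : ℕ)

theorem vecPoly_coeff {m : ℕ} (t : Fin m → ℤ) (k : ℕ) :
    (vecPoly t).coeff k = if h : k < m then t ⟨k, h⟩ else 0 := by
  simp only [vecPoly, finsetSum_coeff, coeff_C_mul, coeff_X_pow]
  split_ifs with h
  · rw [Finset.sum_eq_single ⟨k, h⟩]
    · simp
    · intro b _ hb
      have : k ≠ b := fun h' => hb (Fin.ext h'.symm)
      simp [this]
    · simp
  · refine Finset.sum_eq_zero fun i _ => ?_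
    have : k ≠ i := by omega
    simp [this]

theorem vecPoly_natDegree_le {m : ℕ} (t : Fin (m + 1) → ℤ) : (vecPoly t).natDegree ≤ m := by
  rw [natDegree_le_iff_coeff_eq_zero]
  intro k hk
  rw [vecPoly_coeff, dif_neg (by omega)]

theorem polyH_le_iff {P : Polynomial ℤ} {x : ℝ} (hx : 0 ≤ x) :
    polyH P ≤ x ↔ ∀ i, |(P.coeff i : ℝ)| ≤ x := by
  have key : polyH P ≤ x ↔ (P.support.sup fun i => (P.coeff i).natAbs) ≤ ⌊x⌋₊ := by
    rw [polyH, Nat.le_floor_iff hx]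
  rw [key, Finset.sup_le_iff]
  constructor
  · intro h i
    by_cases hi : P.coeff i = 0
    · simpa [hi] using hx
    · have := (Nat.le_floor_iff hx).1 (h i (mem_support_iff.2 hi))
      rwa [Nat.cast_natAbs, Int.cast_abs] at this
  · intro h i _
    rw [Nat.le_floor_iff hx, Nat.cast_natAbs, Int.cast_abs]
    exact h i

theorem vecPoly_polyH_le {m : ℕ} {t : Fin m → ℤ} {x : ℝ} (hx : 0 ≤ x)
    (h : ∀ i, |(t i : ℝ)| ≤ x) : polyH (vecPoly t) ≤ x := by
  rw [polyH_le_iff hx]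
  intro k
  rw [vecPoly_coeff]
  split_ifs with hk
  · exact h _
  · simpa using hx

theorem pev_vecPoly {m : ℕ} (ζ : ℝ) (t : Fin m → ℤ) :
    pev ζ (vecPoly t) = ∑ i, (t i : ℝ) * ζ ^ (i : ℕ) := by
  simp [pev, vecPoly]

theorem pev_ne_zero {ζ : ℝ} (hζ : Transcendental ℚ ζ) {P : Polynomial ℤ} (hP : P ≠ 0) :
    pev ζ P ≠ 0 := by
  have h : Transcendental ℤ ζ := fun h => hζ ((IsFractionRing.isAlgebraic_iff ℤ ℚ ℝ).1 h)
  exact fun h0 => hP ((transcendental_iff.1 h) P h0)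

theorem Transcendental.mul_intCast_ne {ζ : ℝ} (hζ : Transcendental ℚ ζ) {x : ℤ} (hx : x ≠ 0)
    (y : ℤ) : ζ * x - y ≠ 0 := by
  have hP : vecPoly ![-y, x] ≠ 0 := by
    intro h
    have := congrArg (fun P => P.coeff 1) h
    simp [vecPoly_coeff] at this
    exact hx this
  have := pev_ne_zero hζ hP
  rw [pev_vecPoly] at this
  simp [Fin.sum_univ_two] at this
  intro h
  apply this
  linarith

theorem vecPoly_ne_zero {m : ℕ} {t : Fin m → ℤ} (ht : t ≠ 0) : vecPoly t ≠ 0 := by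
  intro h
  apply ht
  funext i
  have := congrArg (fun P => P.coeff i) h
  simpa [vecPoly_coeff] using this

/-- Rational approximations with bounded denominator stay away from an irrational number. -/
theorem exists_pos_le_abs_mul_sub {ζ : ℝ} (hζ : Transcendental ℚ ζ) (B : ℕ) :
    ∃ δ : ℝ, 0 < δ ∧ ∀ x : ℤ, x ≠ 0 → |x| ≤ B → ∀ y : ℤ, δ ≤ |ζ * x - y| := by
  by_cases hne : ((Finset.Icc (-(B : ℤ)) B).erase 0).Nonempty
  · obtain ⟨x₀, hx₀, hmin⟩ := Finset.exists_min_image _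
      (fun x : ℤ => |ζ * x - round (ζ * x)|) hne
    refine ⟨|ζ * x₀ - round (ζ * x₀)|,
      abs_pos.2 (hζ.mul_intCast_ne (Finset.ne_of_mem_erase hx₀) _), fun x hx hxB y => ?_⟩
    refine (hmin x ?_).trans (round_le _ _)
    rw [Finset.mem_erase, Finset.mem_Icc]
    exact ⟨hx, abs_le.1 hxB⟩
  · refine ⟨1, one_pos, fun x hx hxB => absurd ⟨x, ?_⟩ hne⟩
    rw [Finset.mem_erase, Finset.mem_Icc]
    exact ⟨hx, abs_le.1 hxB⟩

/-- A positive exponent of simultaneous approximation is attained at arbitrarily large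
denominators. -/
theorem lamSet.exists_large {n : ℕ} {ζ η : ℝ} (hn : 0 < n) (hζ : Transcendental ℚ ζ) (hη : 0 < η)
    (h : η ∈ lamSet n ζ) (B : ℕ) :
    ∃ x : ℤ, ∃ y : Fin n → ℤ, (B : ℝ) < |(x : ℝ)| ∧ x ≠ 0 ∧
      ∀ i : Fin n, |ζ ^ ((i : ℕ) + 1) * (x : ℝ) - (y i : ℝ)| ≤ |(x : ℝ)| ^ (-η) := by
  obtain ⟨δ, hδ, hδB⟩ := exists_pos_le_abs_mul_sub hζ B
  have hlim := (tendsto_rpow_neg_atTop hη).eventually_lt_const (lt_min hδ one_pos)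
  obtain ⟨X₀, hX₀⟩ := Filter.eventually_atTop.1 hlim
  obtain ⟨X, hX, x, y, hxy, hxX, happ⟩ := h X₀
  have hsmall := hX₀ X hX
  have hx : x ≠ 0 := by
    rintro rfl
    have hy : y ≠ 0 := by simpa using hxy
    obtain ⟨i, hi⟩ := Function.ne_iff.1 hy
    have h1 := happ i
    have h2 : (1 : ℝ) ≤ |(y i : ℝ)| := by
      rw [← Int.cast_abs]
      exact_mod_cast Int.one_le_abs hi
    simp at h1
    linarith [hsmall.trans_le (min_le_right _ _)]
  have hx1 : (0 : ℝ) < |(x : ℝ)| := abs_pos.2 (by exact_mod_cast hx)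
  rw [Int.cast_abs] at hxX
  refine ⟨x, y, ?_, hx, fun i => (happ i).trans
    (Real.rpow_le_rpow_of_nonpos hx1 hxX (by linarith))⟩
  by_contra! hB
  have hB' : |x| ≤ B := by
    rw [← Int.cast_abs] at hB
    exact_mod_cast hB
  have h1 := hδB x hx hB' (y ⟨0, hn⟩)
  have h2 := happ ⟨0, hn⟩
  simp only [zero_add, pow_one] at h2
  linarith [hsmall.trans_le (min_le_left _ _)]

/-- Siegel's lemma for a single linear equation. -/
theorem exists_small_orthogonal {n : ℕ} (hn : 0 < n) (z : Fin (n + 1) → ℤ) {M : ℝ} (hM : 1 ≤ M)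
    (hz : ∀ i, |(z i : ℝ)| ≤ M) :
    ∃ t : Fin (n + 1) → ℤ, t ≠ 0 ∧ ∑ i, z i * t i = 0 ∧
      ∀ i, |(t i : ℝ)| ≤ ((n + 1) * M) ^ ((1 : ℝ) / n) := by
  letI : SeminormedAddCommGroup (Matrix (Fin 1) (Fin (n + 1)) ℤ) := Matrix.seminormedAddCommGroup
  let A : Matrix (Fin 1) (Fin (n + 1)) ℤ := Matrix.of fun _ => z
  obtain ⟨t, ht, hAt, hbound⟩ := Int.Matrix.exists_ne_zero_int_vec_norm_le A (by simpa) (by simp)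
  refine ⟨t, ht, ?_, fun i => ?_⟩
  · have := congrFun hAt 0
    simpa [A, Matrix.mulVec, dotProduct] using this
  · have h1 : ‖A‖ ≤ M := by
      rw [Matrix.norm_le_iff (by linarith)]
      intro i j
      rw [Int.norm_eq_abs]
      exact hz j
    have h2 : |(t i : ℝ)| ≤ ‖t‖ := by
      rw [← Int.norm_eq_abs]
      exact norm_le_pi_norm t i
    refine h2.trans (hbound.trans ?_)
    simp only [Fintype.card_fin, Nat.cast_add, Nat.cast_one, add_sub_cancel_right]
    gcongr
    exact max_le hM h1

/-- Khintchine's transference principle, in the direction from simultaneous approximation to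
linear forms. -/
theorem mem_wSet_of_mem_lamSet {n : ℕ} {ζ η ξ : ℝ} (hn : 0 < n) (hζ : Transcendental ℚ ζ)
    (hη : 0 < η) (h : η ∈ lamSet n ζ) (hξ : ξ < n * η + n - 1) : ξ ∈ wSet n ζ := by
  intro X₀
  set K : ℝ := (n + 1) * ((1 + |ζ|) ^ n + 1) with hK
  have hK0 : 0 < K := by positivity
  have hn' : (0 : ℝ) < n := by exact_mod_cast hn
  set c : ℝ := n * K ^ (η + 1)
  have hc : 0 < c := by positivity
  set κ : ℝ := n * η + n - 1
  have e1 : ∀ᶠ X : ℝ in Filter.atTop, c ≤ X ^ (κ - ξ) :=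
    (tendsto_rpow_atTop (by linarith)).eventually_ge_atTop c
  have hroot : Filter.Tendsto (fun N : ℝ => (K * N) ^ ((1 : ℝ) / n)) Filter.atTop Filter.atTop :=
    (tendsto_rpow_atTop (by positivity)).comp (Filter.tendsto_id.const_mul_atTop hK0)
  obtain ⟨N₀, hN₀⟩ := Filter.eventually_atTop.1
    (hroot.eventually (e1.and (Filter.eventually_ge_atTop X₀)))
  obtain ⟨B, hB⟩ := exists_nat_ge N₀
  obtain ⟨x, y, hxB, hx, happ⟩ := lamSet.exists_large hn hζ hη h B
  set N : ℝ := |(x : ℝ)| with hN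
  have hN1 : 1 ≤ N := by
    rw [hN, ← Int.cast_abs]
    exact_mod_cast Int.one_le_abs hx
  obtain ⟨hX1, hX2⟩ := hN₀ N (by linarith)
  set X : ℝ := (K * N) ^ ((1 : ℝ) / n) with hX
  have hX0 : 0 < X := by positivity
  have herr : N ^ (-η) ≤ 1 := Real.rpow_le_one_of_one_le_of_nonpos hN1 (by linarith)
  obtain ⟨t, ht, horth, hsize⟩ := exists_small_orthogonal hn (Fin.cons x y)
    (M := ((1 + |ζ|) ^ n + 1) * N) (by nlinarith [pow_pos (show 0 < 1 + |ζ| by positivity) n])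
    (by
      refine Fin.cases ?_ fun i => ?_
      · simp only [Fin.cons_zero]
        nlinarith [pow_pos (show 0 < 1 + |ζ| by positivity) n]
      · simp only [Fin.cons_succ]
        have h1 : |ζ| ^ ((i : ℕ) + 1) ≤ (1 + |ζ|) ^ n :=
          (pow_le_pow_left₀ (abs_nonneg _) (by linarith) _).trans
            (pow_le_pow_right₀ (by linarith [abs_nonneg ζ]) i.2)
        have h2 := happ i
        have h3 : |(y i : ℝ)| ≤ |ζ ^ ((i : ℕ) + 1) * x| + |ζ ^ ((i : ℕ) + 1) * x - y i| := by
          have := abs_sub (ζ ^ ((i : ℕ) + 1) * x) (ζ ^ ((i : ℕ) + 1) * x - y i)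
          simpa using this
        rw [abs_mul, abs_pow, ← hN] at h3
        nlinarith [mul_le_mul_of_nonneg_right h1 (by linarith : 0 ≤ N)])
  rw [← mul_assoc, ← hK, ← hX] at hsize
  refine ⟨X, hX2, vecPoly t, vecPoly_natDegree_le t, vecPoly_polyH_le hX0.le hsize,
    abs_pos.2 (pev_ne_zero hζ (vecPoly_ne_zero ht)), ?_⟩
  have hval : pev ζ (vecPoly t) * x =
      ∑ i : Fin n, (t i.succ : ℝ) * (ζ ^ ((i : ℕ) + 1) * x - y i) := by
    have h0 : (∑ i, ((Fin.cons x y : Fin (n + 1) → ℤ) i : ℝ) * (t i : ℝ)) = 0 := by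
      exact_mod_cast horth
    rw [Fin.sum_univ_succ] at h0
    rw [pev_vecPoly, Fin.sum_univ_succ]
    simp only [Fin.cons_zero, Fin.cons_succ, Fin.val_zero, pow_zero, mul_one, Fin.val_succ] at *
    simp only [mul_sub, Finset.sum_sub_distrib, add_mul, Finset.sum_mul]
    have h1 : ∑ i : Fin n, (t i.succ : ℝ) * (y i : ℝ) = ∑ i : Fin n, (y i : ℝ) * (t i.succ : ℝ) :=
      Finset.sum_congr rfl fun _ _ => mul_comm _ _
    have h2 : ∑ i : Fin n, (t i.succ : ℝ) * ζ ^ ((i : ℕ) + 1) * x =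
        ∑ i : Fin n, (t i.succ : ℝ) * (ζ ^ ((i : ℕ) + 1) * x) :=
      Finset.sum_congr rfl fun _ _ => mul_assoc _ _ _
    rw [h1, h2]
    linarith
  have hbd : |pev ζ (vecPoly t)| * N ≤ n * (X * N ^ (-η)) := by
    rw [hN, ← abs_mul, hval, ← hN]
    refine (Finset.abs_sum_le_sum_abs _ _).trans ?_
    calc _ ≤ ∑ _i : Fin n, X * N ^ (-η) := by
          refine Finset.sum_le_sum fun i _ => ?_
          rw [abs_mul]
          exact mul_le_mul (hsize _) (happ i) (abs_nonneg _) hX0.le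
      _ = _ := by simp
  have hNX : N = X ^ (n : ℝ) / K := by
    rw [hX, ← Real.rpow_mul (by positivity), one_div, inv_mul_cancel₀ hn'.ne', Real.rpow_one]
    field_simp
  have hN0 : 0 < N := by linarith
  have h5 : n * (X * N ^ (-η)) / N = c * X ^ (-κ) := by
    have a1 : N ^ (-η) / N = N ^ (-(η + 1)) := by
      rw [neg_add, Real.rpow_add hN0, Real.rpow_neg_one]; rfl
    have a2 : N ^ (-(η + 1)) = K ^ (η + 1) * X ^ (-(n * (η + 1))) := by
      rw [hNX, Real.div_rpow (by positivity) hK0.le, ← Real.rpow_mul hX0.le,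
        Real.rpow_neg hK0.le (η + 1), div_inv_eq_mul, mul_comm]
      congr 2
      ring
    have a3 : X * X ^ (-(n * (η + 1))) = X ^ (-κ) := by
      nth_rw 1 [← Real.rpow_one X]
      rw [← Real.rpow_add hX0]
      congr 1
      simp only [κ]
      ring
    calc n * (X * N ^ (-η)) / N = n * (X * (N ^ (-η) / N)) := by ring
      _ = n * K ^ (η + 1) * (X * X ^ (-(n * (η + 1)))) := by rw [a1, a2]; ring
      _ = _ := by rw [a3]
  calc |pev ζ (vecPoly t)| ≤ n * (X * N ^ (-η)) / N := by rwa [le_div_iff₀ hN0]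
    _ = c * X ^ (-κ) := h5
    _ ≤ X ^ (κ - ξ) * X ^ (-κ) := by gcongr
    _ = X ^ (-ξ) := by rw [← Real.rpow_add hX0]; congr 1; ring

/-- The maximum norm of an integer vector. -/
def vecH {m : ℕ} (p : Fin m → ℤ) : ℕ := Finset.univ.sup fun i => (p i).natAbs

theorem abs_le_vecH {m : ℕ} (p : Fin m → ℤ) (i : Fin m) : |(p i : ℝ)| ≤ vecH p := by
  rw [← Int.cast_abs, ← Nat.cast_natAbs]
  exact_mod_cast Finset.le_sup (f := fun i => (p i).natAbs) (Finset.mem_univ i)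

theorem vecH_le_iff {m : ℕ} {p : Fin m → ℤ} {h : ℕ} :
    vecH p ≤ h ↔ ∀ i, |p i| ≤ h := by
  simp only [vecH, Finset.sup_le_iff, Finset.mem_univ, true_implies]
  refine forall_congr' fun i => ?_
  rw [Int.abs_eq_natAbs]
  omega

theorem vecH_cast_le {m : ℕ} {p : Fin m → ℤ} {x : ℝ} (hx : 0 ≤ x) (h : ∀ i, |(p i : ℝ)| ≤ x) :
    (vecH p : ℝ) ≤ x := by
  rw [← Nat.le_floor_iff hx, vecH_le_iff]
  intro i
  have : (p i).natAbs ≤ ⌊x⌋₊ := by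
    rw [Nat.le_floor_iff hx, Nat.cast_natAbs, Int.cast_abs]
    exact h i
  rw [Int.abs_eq_natAbs]
  omega

theorem one_le_vecH {m : ℕ} {p : Fin m → ℤ} (hp : p ≠ 0) : 1 ≤ vecH p := by
  obtain ⟨i, hi⟩ := Function.ne_iff.1 hp
  have := vecH_le_iff.1 (le_refl (vecH p)) i
  rw [Int.abs_eq_natAbs] at this
  simp at hi
  omega

theorem exists_abs_eq_vecH {p : Fin 3 → ℤ} : ∃ i, |(p i : ℝ)| = vecH p := by
  obtain ⟨i, -, hi⟩ := Finset.exists_mem_eq_sup Finset.univ Finset.univ_nonempty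
    fun i => (p i).natAbs
  refine ⟨i, ?_⟩
  rw [vecH, hi, Nat.cast_natAbs, Int.cast_abs]

/-- The value at `ζ` of the quadratic polynomial with coefficient vector `p`. -/
def ev (ζ : ℝ) (p : Fin 3 → ℤ) : ℝ := p 0 + p 1 * ζ + p 2 * ζ ^ 2

theorem pev_vecPoly_three (ζ : ℝ) (p : Fin 3 → ℤ) : pev ζ (vecPoly p) = ev ζ p := by
  simp [pev_vecPoly, Fin.sum_univ_three, ev]

theorem ev_ne_zero {ζ : ℝ} (hζ : Transcendental ℚ ζ) {p : Fin 3 → ℤ} (hp : p ≠ 0) :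
    ev ζ p ≠ 0 := by
  rw [← pev_vecPoly_three]
  exact pev_ne_zero hζ (vecPoly_ne_zero hp)

/-- Every quadratic integer polynomial comes from its coefficient vector. -/
theorem exists_vec_of_natDegree_le_two {P : Polynomial ℤ} (hP : P.natDegree ≤ 2) :
    ∃ p : Fin 3 → ℤ, vecPoly p = P := by
  refine ⟨fun i => P.coeff i, ?_⟩
  ext k
  rw [vecPoly_coeff]
  split_ifs with h
  · rfl
  · rw [coeff_eq_zero_of_natDegree_lt (by omega)]

theorem vecH_le_polyH (p : Fin 3 → ℤ) : (vecH p : ℝ) ≤ polyH (vecPoly p) := by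
  have h0 : 0 ≤ polyH (vecPoly p) := Nat.cast_nonneg _
  refine vecH_cast_le h0 fun i => ?_
  have := (polyH_le_iff h0).1 le_rfl i
  simpa [vecPoly_coeff] using this

theorem polyH_le_vecH (p : Fin 3 → ℤ) : polyH (vecPoly p) ≤ vecH p :=
  vecPoly_polyH_le (Nat.cast_nonneg _) (abs_le_vecH p)

/-- A sequence of minimal points for approximation to `0` by quadratic polynomials at `ζ`. -/
structure IsMinimalSeq (ζ : ℝ) (P : ℕ → Fin 3 → ℤ) : Prop where
  ne_zero (i : ℕ) : P i ≠ 0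
  vecH_lt (i : ℕ) : vecH (P i) < vecH (P (i + 1))
  ev_lt (i : ℕ) : |ev ζ (P (i + 1))| < |ev ζ (P i)|
  le_ev (i : ℕ) (q : Fin 3 → ℤ) (hq : q ≠ 0) (h : vecH q < vecH (P (i + 1))) :
    |ev ζ (P i)| ≤ |ev ζ q|

theorem exists_minimizer (ζ : ℝ) {h : ℕ} {p : Fin 3 → ℤ} (hp : p ≠ 0) (hph : vecH p ≤ h) :
    ∃ q : Fin 3 → ℤ, q ≠ 0 ∧ vecH q ≤ h ∧
      ∀ r : Fin 3 → ℤ, r ≠ 0 → vecH r ≤ h → |ev ζ q| ≤ |ev ζ r| := by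
  have hfin : {q : Fin 3 → ℤ | q ≠ 0 ∧ vecH q ≤ h}.Finite := by
    refine (Set.finite_Icc (fun _ => -(h : ℤ)) (fun _ => (h : ℤ))).subset fun q hq => ?_
    have := vecH_le_iff.1 hq.2
    exact ⟨fun i => (abs_le.1 (this i)).1, fun i => (abs_le.1 (this i)).2⟩
  obtain ⟨q, hq, hmin⟩ := Set.exists_min_image _ (fun q => |ev ζ q|) hfin ⟨p, hp, hph⟩
  exact ⟨q, hq.1, hq.2, fun r hr hrh => hmin r ⟨hr, hrh⟩⟩

theorem exists_next_minimal {ζ : ℝ} (hsmall : ∀ δ > 0, ∃ q : Fin 3 → ℤ, q ≠ 0 ∧ |ev ζ q| < δ)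
    (hne : ∀ q : Fin 3 → ℤ, q ≠ 0 → ev ζ q ≠ 0) {p : Fin 3 → ℤ} (hp : p ≠ 0)
    (hmin : ∀ r : Fin 3 → ℤ, r ≠ 0 → vecH r ≤ vecH p → |ev ζ p| ≤ |ev ζ r|) :
    ∃ q : Fin 3 → ℤ, (q ≠ 0 ∧ ∀ r : Fin 3 → ℤ, r ≠ 0 → vecH r ≤ vecH q → |ev ζ q| ≤ |ev ζ r|) ∧
      vecH p < vecH q ∧ |ev ζ q| < |ev ζ p| ∧
      ∀ r : Fin 3 → ℤ, r ≠ 0 → vecH r < vecH q → |ev ζ p| ≤ |ev ζ r| := by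
  classical
  have hex : ∃ h, ∃ q : Fin 3 → ℤ, q ≠ 0 ∧ vecH q ≤ h ∧ |ev ζ q| < |ev ζ p| := by
    obtain ⟨q, hq, hlt⟩ := hsmall _ (abs_pos.2 (hne p hp))
    exact ⟨_, q, hq, le_rfl, hlt⟩
  obtain ⟨q₀, hq₀, hh₀, hlt₀⟩ := Nat.find_spec hex
  obtain ⟨q, hq, hqh, hqmin⟩ := exists_minimizer ζ hq₀ hh₀
  have hqp : |ev ζ q| < |ev ζ p| := (hqmin q₀ hq₀ hh₀).trans_lt hlt₀
  refine ⟨q, ⟨hq, fun r hr hrq => hqmin r hr (hrq.trans hqh)⟩, ?_, hqp, fun r hr hrq => ?_⟩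
  · by_contra! h
    exact absurd (hmin q hq h) (not_le.2 hqp)
  · by_contra! h
    exact Nat.find_min hex (hrq.trans_le hqh) ⟨r, hr, le_rfl, h⟩

theorem exists_isMinimalSeq {ζ : ℝ}
    (hsmall : ∀ δ > 0, ∃ q : Fin 3 → ℤ, q ≠ 0 ∧ |ev ζ q| < δ)
    (hne : ∀ q : Fin 3 → ℤ, q ≠ 0 → ev ζ q ≠ 0) : ∃ P, IsMinimalSeq ζ P := by
  let S := {p : Fin 3 → ℤ // p ≠ 0 ∧
    ∀ r : Fin 3 → ℤ, r ≠ 0 → vecH r ≤ vecH p → |ev ζ p| ≤ |ev ζ r|}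
  obtain ⟨q₀, hq₀, -⟩ := hsmall 1 one_pos
  obtain ⟨p₀, hp₀, hle, hmin₀⟩ := exists_minimizer ζ hq₀ le_rfl
  let start : S := ⟨p₀, hp₀, fun r hr hrp => hmin₀ r hr (hrp.trans hle)⟩
  choose next hnext using fun p : S => exists_next_minimal hsmall hne p.2.1 p.2.2
  let F : ℕ → S := fun n => Nat.rec start (fun _ p => ⟨next p, (hnext p).1⟩) n
  exact ⟨fun n => (F n).1, fun i => (F i).2.1, fun i => (hnext (F i)).2.1,
    fun i => (hnext (F i)).2.2.1, fun i => (hnext (F i)).2.2.2⟩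

namespace IsMinimalSeq

variable {ζ : ℝ} {P : ℕ → Fin 3 → ℤ}

theorem vecH_strictMono (hP : IsMinimalSeq ζ P) : StrictMono fun i => vecH (P i) :=
  strictMono_nat_of_lt_succ hP.vecH_lt

theorem ev_strictAnti (hP : IsMinimalSeq ζ P) : StrictAnti fun i => |ev ζ (P i)| :=
  strictAnti_nat_of_succ_lt hP.ev_lt

end IsMinimalSeq

theorem cross_ne_zero {ζ : ℝ} {p q : Fin 3 → ℤ} (hH : vecH p < vecH q)
    (hv : |ev ζ q| < |ev ζ p|) : crossProduct p q ≠ 0 := by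
  intro h
  rw [cross_apply] at h
  have h0 := congrFun h 0
  have h1 := congrFun h 1
  have h2 := congrFun h 2
  simp at h0 h1 h2
  obtain ⟨i, hi⟩ := exists_abs_eq_vecH (p := q)
  have key : (q i : ℝ) * ev ζ p = p i * ev ζ q := by
    have e0 : (p 1 * q 2 - p 2 * q 1 : ℝ) = 0 := by exact_mod_cast h0
    have e1 : (p 2 * q 0 - p 0 * q 2 : ℝ) = 0 := by exact_mod_cast h1
    have e2 : (p 0 * q 1 - p 1 * q 0 : ℝ) = 0 := by exact_mod_cast h2
    unfold ev
    fin_cases i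
    · simp only [Fin.zero_eta]
      linear_combination (ζ ^ 2) * e1 - ζ * e2
    · simp only [Fin.mk_one]
      linear_combination e2 - ζ ^ 2 * e0
    · simp only [Fin.reduceFinMk]
      linear_combination ζ * e0 - e1
  have key' := congrArg abs key
  rw [abs_mul, abs_mul, hi] at key'
  have a1 := abs_le_vecH p i
  have a2 : (vecH p : ℝ) < vecH q := by exact_mod_cast hH
  have a3 := abs_nonneg (ev ζ q)
  have a4 := abs_nonneg (p i : ℝ)
  nlinarith

/-- A vector orthogonal to a plane is a multiple of any cross product of vectors in the plane. -/
theorem dotProduct_cross_eq_zero_iff {u v n : Fin 3 → ℤ} (hn : n ≠ 0) (hu : u ⬝ᵥ n = 0)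
    (hv : v ⬝ᵥ n = 0) (hm : crossProduct u v ≠ 0) (w : Fin 3 → ℤ) :
    w ⬝ᵥ crossProduct u v = 0 ↔ w ⬝ᵥ n = 0 := by
  set m := crossProduct u v with hmdef
  have hpar : ∀ i j, m i * n j = m j * n i := by
    have h := cross_apply u v
    rw [← hmdef] at h
    have m0 : m 0 = u 1 * v 2 - u 2 * v 1 := by rw [h]; rfl
    have m1 : m 1 = u 2 * v 0 - u 0 * v 2 := by rw [h]; rfl
    have m2 : m 2 = u 0 * v 1 - u 1 * v 0 := by rw [h]; rfl
    simp only [dotProduct, Fin.sum_univ_three] at hu hv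
    have e01 : m 0 * n 1 = m 1 * n 0 := by
      rw [m0, m1]; linear_combination v 2 * hu - u 2 * hv
    have e02 : m 0 * n 2 = m 2 * n 0 := by
      rw [m0, m2]; linear_combination u 1 * hv - v 1 * hu
    have e12 : m 1 * n 2 = m 2 * n 1 := by
      rw [m1, m2]; linear_combination v 0 * hu - u 0 * hv
    intro i j
    fin_cases i <;> fin_cases j <;> simp <;> linarith
  have aux : ∀ {a b : Fin 3 → ℤ}, a ≠ 0 → (∀ i j, a i * b j = a j * b i) → w ⬝ᵥ a = 0 →
      w ⬝ᵥ b = 0 := by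
    intro a b ha hab h
    obtain ⟨i, hi⟩ := Function.ne_iff.1 ha
    simp only [Pi.zero_apply] at hi
    have : a i * (w ⬝ᵥ b) = b i * (w ⬝ᵥ a) := by
      simp only [dotProduct, Finset.mul_sum]
      exact Finset.sum_congr rfl fun j _ => by linear_combination w j * hab i j
    rw [h, mul_zero] at this
    exact (mul_eq_zero.1 this).resolve_left hi
  exact ⟨aux hm hpar, aux hn fun i j => by linarith [hpar i j]⟩

theorem dotProduct_cross_eq (ζ : ℝ) (w p q : Fin 3 → ℤ) :
    ((w ⬝ᵥ crossProduct p q : ℤ) : ℝ) = (crossProduct p q 0 : ℤ) * ev ζ w +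
      (w 2 * (q 1 * ev ζ p - p 1 * ev ζ q) - w 1 * (q 2 * ev ζ p - p 2 * ev ζ q)) := by
  simp [cross_apply, dotProduct, Fin.sum_univ_three, ev]
  ring

theorem abs_dotProduct_cross_sub_le {ζ : ℝ} {p q : Fin 3 → ℤ} (hH : vecH p ≤ vecH q)
    (hv : |ev ζ q| ≤ |ev ζ p|) (w : Fin 3 → ℤ) :
    |((w ⬝ᵥ crossProduct p q : ℤ) : ℝ) - (crossProduct p q 0 : ℤ) * ev ζ w| ≤
      4 * vecH w * vecH q * |ev ζ p| := by
  rw [dotProduct_cross_eq ζ, add_sub_cancel_left]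
  have hH' : (vecH p : ℝ) ≤ vecH q := by exact_mod_cast hH
  have h : ∀ i, |(q i * ev ζ p - p i * ev ζ q : ℝ)| ≤ 2 * vecH q * |ev ζ p| := fun i => by
    calc _ ≤ |(q i : ℝ)| * |ev ζ p| + |(p i : ℝ)| * |ev ζ q| := by
          rw [← abs_mul, ← abs_mul]; exact abs_sub _ _
      _ ≤ vecH q * |ev ζ p| + vecH q * |ev ζ p| := by
          gcongr
          · exact abs_le_vecH q i
          · exact (abs_le_vecH p i).trans hH'
      _ = _ := by ring
  calc _ ≤ |(w 2 : ℝ)| * |(q 1 * ev ζ p - p 1 * ev ζ q : ℝ)| +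
        |(w 1 : ℝ)| * |(q 2 * ev ζ p - p 2 * ev ζ q : ℝ)| := by
        rw [← abs_mul, ← abs_mul]; exact abs_sub _ _
    _ ≤ vecH w * (2 * vecH q * |ev ζ p|) + vecH w * (2 * vecH q * |ev ζ p|) := by
        gcongr
        · exact abs_le_vecH w 2
        · exact h 1
        · exact abs_le_vecH w 1
        · exact h 2
    _ = _ := by ring

theorem abs_cross_zero_le (p q : Fin 3 → ℤ) :
    |((crossProduct p q 0 : ℤ) : ℝ)| ≤ 2 * vecH p * vecH q := by
  have : ((crossProduct p q 0 : ℤ) : ℝ) = p 1 * q 2 - p 2 * q 1 := by simp [cross_apply]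
  rw [this]
  calc _ ≤ |(p 1 : ℝ)| * |(q 2 : ℝ)| + |(p 2 : ℝ)| * |(q 1 : ℝ)| := by
        rw [← abs_mul, ← abs_mul]; exact abs_sub _ _
    _ ≤ vecH p * vecH q + vecH p * vecH q := by
        gcongr <;> apply abs_le_vecH
    _ = _ := by ring

theorem cross_zero_ne_zero {ζ : ℝ} {p q : Fin 3 → ℤ} (hH : vecH p ≤ vecH q)
    (hv : |ev ζ q| ≤ |ev ζ p|) (hpq : crossProduct p q ≠ 0)
    (hsmall : 4 * vecH q * |ev ζ p| < 1) : crossProduct p q 0 ≠ 0 := by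
  intro h0
  have hk : ∀ k, crossProduct p q k = 0 := fun k => by
    have h := abs_dotProduct_cross_sub_le hH hv (Pi.single k 1)
    have h1 : (vecH (Pi.single k 1 : Fin 3 → ℤ) : ℝ) ≤ 1 := by
      refine vecH_cast_le zero_le_one fun i => ?_
      by_cases hi : i = k <;> simp [hi]
    rw [h0, single_dotProduct] at h
    simp only [one_mul, Int.cast_zero, zero_mul, sub_zero] at h
    have h2 : |((crossProduct p q k : ℤ) : ℝ)| < 1 := by
      have : 0 ≤ vecH q * |ev ζ p| := by positivity
      nlinarith
    rw [← Int.cast_abs] at h2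
    exact Int.abs_lt_one_iff.1 (by exact_mod_cast h2)
  exact hpq (funext hk)

namespace IsMinimalSeq

variable {ζ : ℝ} {P : ℕ → Fin 3 → ℤ}

/-- The integer vector orthogonal to two consecutive minimal points. -/
def normal (P : ℕ → Fin 3 → ℤ) (i : ℕ) : Fin 3 → ℤ := crossProduct (P i) (P (i + 1))

theorem cross_ne_zero_of_lt (hP : IsMinimalSeq ζ P) {i j : ℕ} (h : i < j) :
    crossProduct (P i) (P j) ≠ 0 :=
  cross_ne_zero (hP.vecH_strictMono h) (hP.ev_strictAnti h)

theorem normal_ne_zero (hP : IsMinimalSeq ζ P) (i : ℕ) : normal P i ≠ 0 :=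
  hP.cross_ne_zero_of_lt i.lt_succ_self

theorem vecH_pos (hP : IsMinimalSeq ζ P) (i : ℕ) : (0 : ℝ) < vecH (P i) := by
  exact_mod_cast one_le_vecH (hP.ne_zero i)

theorem vecH_mono (hP : IsMinimalSeq ζ P) {i j : ℕ} (h : i ≤ j) :
    (vecH (P i) : ℝ) ≤ vecH (P j) := by
  exact_mod_cast hP.vecH_strictMono.monotone h

theorem ev_anti (hP : IsMinimalSeq ζ P) {i j : ℕ} (h : i ≤ j) :
    |ev ζ (P j)| ≤ |ev ζ (P i)| := hP.ev_strictAnti.antitone h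

theorem dotProduct_normal_left (i : ℕ) : P i ⬝ᵥ normal P i = 0 := dot_self_cross _ _

theorem dotProduct_normal_right (i : ℕ) : P (i + 1) ⬝ᵥ normal P i = 0 := dot_cross_self _ _

/-- The plane of two consecutive minimal points is eventually left by the sequence. -/
theorem exists_normal_eq_and_ne (hP : IsMinimalSeq ζ P) (hne : ∀ i, ev ζ (P i) ≠ 0)
    (hdecay : ∀ δ > 0, ∃ T, ∀ t ≥ T, |ev ζ (P t)| * vecH (P (t + 1)) < δ) (i : ℕ) :
    ∃ j ≥ i, (∀ w, w ⬝ᵥ normal P j = 0 ↔ w ⬝ᵥ normal P i = 0) ∧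
      P (j + 2) ⬝ᵥ normal P j ≠ 0 := by
  classical
  by_cases hex : ∃ k, P (i + k + 2) ⬝ᵥ normal P i ≠ 0
  · set k := Nat.find hex
    have hk : ∀ l < k + 2, P (i + l) ⬝ᵥ normal P i = 0 := by
      intro l hl
      match l with
      | 0 => exact dotProduct_normal_left i
      | 1 => exact dotProduct_normal_right i
      | l + 2 => exact not_not.1 (Nat.find_min hex (m := l) (by omega))
    have hiff := dotProduct_cross_eq_zero_iff (hP.normal_ne_zero i) (hk k (by omega))
      (hk (k + 1) (by omega)) (hP.normal_ne_zero (i + k))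
    exact ⟨i + k, by omega, hiff, (hiff _).not.2 (Nat.find_spec hex)⟩
  · push Not at hex
    exfalso
    have hall : ∀ l, P (i + l) ⬝ᵥ normal P i = 0 := by
      intro l
      match l with
      | 0 => exact dotProduct_normal_left i
      | 1 => exact dotProduct_normal_right i
      | l + 2 => exact hex l
    have hv := abs_pos.2 (hne i)
    have hH := hP.vecH_pos i
    obtain ⟨T, hT⟩ := hdecay (min (1 / 4) (|ev ζ (P i)| / (4 * vecH (P i)))) (by positivity)
    have hs := hT (i + T) (by omega)
    set l := i + T with hl
    have hiff := dotProduct_cross_eq_zero_iff (hP.normal_ne_zero i) (hall T)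
      (hall (T + 1)) (hP.normal_ne_zero (i + T)) (P i)
    have horth : P i ⬝ᵥ normal P l = 0 := hiff.2 (dotProduct_normal_left i)
    have h0 : crossProduct (P l) (P (l + 1)) 0 ≠ 0 :=
      cross_zero_ne_zero (hP.vecH_lt l).le (hP.ev_lt l).le (hP.normal_ne_zero l)
        (by linarith [hs.trans_le (min_le_left _ _)])
    have hb := abs_dotProduct_cross_sub_le (hP.vecH_lt l).le (hP.ev_lt l).le (P i)
    rw [normal] at horth
    rw [horth, Int.cast_zero, zero_sub, abs_neg, abs_mul] at hb
    have h1 : (1 : ℝ) ≤ |((crossProduct (P l) (P (l + 1)) 0 : ℤ) : ℝ)| := by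
      rw [← Int.cast_abs]
      exact_mod_cast Int.one_le_abs h0
    have h2 := hs.trans_le (min_le_right _ _)
    rw [lt_div_iff₀ (by positivity)] at h2
    nlinarith

theorem log_growth (hP : IsMinimalSeq ζ P) (hne : ∀ i, ev ζ (P i) ≠ 0) {i : ℕ}
    (hi : P (i + 2) ⬝ᵥ normal P i ≠ 0) :
    -Real.log |ev ζ (P i)| ≤
      Real.log 6 + Real.log (vecH (P (i + 1))) + Real.log (vecH (P (i + 2))) := by
  have hb := abs_dotProduct_cross_sub_le (hP.vecH_lt i).le (hP.ev_lt i).le (P (i + 2))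
  have h0 := abs_cross_zero_le (P i) (P (i + 1))
  rw [← normal] at hb h0
  have h1 : (1 : ℝ) ≤ |((P (i + 2) ⬝ᵥ normal P i : ℤ) : ℝ)| := by
    rw [← Int.cast_abs]
    exact_mod_cast Int.one_le_abs hi
  have hv := abs_pos.2 (hne i)
  have p1 := hP.vecH_pos (i + 1)
  have p2 := hP.vecH_pos (i + 2)
  have h2 : |((normal P i 0 : ℤ) : ℝ) * ev ζ (P (i + 2))| ≤
      2 * vecH (P (i + 2)) * vecH (P (i + 1)) * |ev ζ (P i)| := by
    rw [abs_mul]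
    refine mul_le_mul (h0.trans ?_) (hP.ev_anti (Nat.le_add_right i 2)) (abs_nonneg _)
      (by positivity)
    gcongr
    exact hP.vecH_strictMono.monotone (Nat.le_add_right i 2)
  have h3 : (1 : ℝ) ≤ |ev ζ (P i)| * (6 * vecH (P (i + 1)) * vecH (P (i + 2))) := by
    have := abs_sub_abs_le_abs_sub ((P (i + 2) ⬝ᵥ normal P i : ℤ) : ℝ)
      ((normal P i 0 : ℤ) * ev ζ (P (i + 2)))
    linarith
  have h4 := Real.log_nonneg h3
  rw [Real.log_mul hv.ne' (by positivity), Real.log_mul (by positivity) p2.ne',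
    Real.log_mul (by norm_num) p1.ne'] at h4
  linarith

theorem log_growth_upper (hP : IsMinimalSeq ζ P) (hne : ∀ i, ev ζ (P i) ≠ 0) {i j : ℕ}
    (hi : P i ⬝ᵥ normal P j ≠ 0) (hi' : P (i + 1) ⬝ᵥ normal P j = 0)
    (hsmall : 8 * vecH (P i) * vecH (P (j + 1)) * |ev ζ (P j)| ≤ 1) :
    -Real.log |ev ζ (P i)| + Real.log |ev ζ (P (i + 1))| ≤ Real.log 8 +
      Real.log (vecH (P (i + 1))) + Real.log (vecH (P (j + 1))) + Real.log |ev ζ (P j)| := by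
  have hb := abs_dotProduct_cross_sub_le (hP.vecH_lt j).le (hP.ev_lt j).le (P i)
  have hb' := abs_dotProduct_cross_sub_le (hP.vecH_lt j).le (hP.ev_lt j).le (P (i + 1))
  rw [← normal] at hb hb'
  rw [hi', Int.cast_zero, zero_sub, abs_neg, abs_mul] at hb'
  have h1 : (1 : ℝ) ≤ |((P i ⬝ᵥ normal P j : ℤ) : ℝ)| := by
    rw [← Int.cast_abs]
    exact_mod_cast Int.one_le_abs hi
  have hv := abs_pos.2 (hne i)
  have hv' := abs_pos.2 (hne (i + 1))
  have hvj := abs_pos.2 (hne j)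
  have p1 := hP.vecH_pos (i + 1)
  have p2 := hP.vecH_pos (j + 1)
  have h2 := abs_sub_abs_le_abs_sub ((P i ⬝ᵥ normal P j : ℤ) : ℝ)
    ((normal P j 0 : ℤ) * ev ζ (P i))
  rw [abs_mul] at h2
  have h3 : 1 ≤ 2 * (|((normal P j 0 : ℤ) : ℝ)| * |ev ζ (P i)|) := by linarith
  have h4 : |ev ζ (P (i + 1))| ≤
      |ev ζ (P i)| * (8 * vecH (P (i + 1)) * vecH (P (j + 1)) * |ev ζ (P j)|) := by
    calc _ ≤ 2 * (|((normal P j 0 : ℤ) : ℝ)| * |ev ζ (P i)|) * |ev ζ (P (i + 1))| :=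
          le_mul_of_one_le_left hv'.le h3
      _ = 2 * |ev ζ (P i)| * (|((normal P j 0 : ℤ) : ℝ)| * |ev ζ (P (i + 1))|) := by ring
      _ ≤ 2 * |ev ζ (P i)| * (4 * vecH (P (i + 1)) * vecH (P (j + 1)) * |ev ζ (P j)|) := by
          gcongr
      _ = _ := by ring
  have h5 := Real.log_le_log hv' h4
  rw [Real.log_mul hv.ne' (by positivity), Real.log_mul (by positivity) hvj.ne',
    Real.log_mul (by positivity) p2.ne', Real.log_mul (by norm_num) p1.ne'] at h5
  linarith

theorem tendsto_log_vecH (hP : IsMinimalSeq ζ P) :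
    Filter.Tendsto (fun i => Real.log (vecH (P i))) Filter.atTop Filter.atTop :=
  Real.tendsto_log_atTop.comp
    (tendsto_natCast_atTop_atTop.comp hP.vecH_strictMono.tendsto_atTop)

/-- From one linearly independent triple of consecutive minimal points to the next: growth of
heights and values when the exponents are those of an extremal number. -/
theorem exists_good_step (hP : IsMinimalSeq ζ P) (hne : ∀ i, ev ζ (P i) ≠ 0) {g : ℝ}
    (hg : g ^ 2 = g + 1) (hg1 : 1.6 < g) (hg2 : g < 1.7)
    (hdecay : ∀ δ > 0, ∃ T, ∀ t ≥ T, |ev ζ (P t)| * vecH (P (t + 1)) < δ)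
    (hU : ∀ ε > 0, ∃ T, ∀ t ≥ T,
      (g ^ 2 - ε) * Real.log (vecH (P (t + 1))) ≤ -Real.log |ev ζ (P t)|)
    (hL : ∀ ε > 0, ∃ T, ∀ t ≥ T,
      -Real.log |ev ζ (P t)| ≤ (g ^ 3 + ε) * Real.log (vecH (P t)))
    {ε : ℝ} (hε : 0 < ε) :
    ∃ T, ∀ i ≥ T, P (i + 2) ⬝ᵥ normal P i ≠ 0 →
      (g ^ 3 - ε) * Real.log (vecH (P (i + 1))) ≤ -Real.log |ev ζ (P (i + 1))| ∧
      ∃ j ≥ i + 1, (∀ w, w ⬝ᵥ normal P j = 0 ↔ w ⬝ᵥ normal P (i + 1) = 0) ∧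
        P (j + 2) ⬝ᵥ normal P j ≠ 0 ∧
        (g - ε) * Real.log (vecH (P (i + 1))) ≤ Real.log (vecH (P (j + 1))) ∧
        Real.log (vecH (P (j + 1))) ≤ (g + ε) * Real.log (vecH (P (i + 1))) := by
  obtain ⟨e, he, heε, he1⟩ : ∃ e : ℝ, 0 < e ∧ 20 * e ≤ ε ∧ 20 * e ≤ 1 :=
    ⟨min ε 1 / 20, by positivity, by linarith [min_le_left ε 1], by linarith [min_le_right ε 1]⟩
  have hg3 : g ^ 3 = 2 * g + 1 := by linear_combination (g + 1) * hg
  rw [hg] at hU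
  rw [hg3] at hL ⊢
  obtain ⟨T₁, hT₁⟩ := hU e he
  obtain ⟨T₂, hT₂⟩ := hL e he
  obtain ⟨T₃, hT₃⟩ := Filter.eventually_atTop.1
    (hP.tendsto_log_vecH.eventually_ge_atTop (max (Real.log 8 / e) (2 * Real.log 8)))
  have h86 : Real.log 6 ≤ Real.log 8 := Real.log_le_log (by norm_num) (by norm_num)
  have h8 : 0 ≤ Real.log 8 := Real.log_nonneg (by norm_num)
  refine ⟨max T₁ (max T₂ T₃), fun i hi hgood => ?_⟩
  have hi1 : T₁ ≤ i := (le_max_left _ _).trans hi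
  have hi2 : T₂ ≤ i := (le_max_left _ _).trans ((le_max_right _ _).trans hi)
  have hi3 : T₃ ≤ i := (le_max_right _ _).trans ((le_max_right _ _).trans hi)
  have hmono : ∀ {a b : ℕ}, a ≤ b → Real.log (vecH (P a)) ≤ Real.log (vecH (P b)) :=
    fun hab => Real.log_le_log (hP.vecH_pos _) (hP.vecH_mono hab)
  have hbig : Real.log 8 ≤ e * Real.log (vecH (P (i + 1))) := by
    have := (le_max_left _ _).trans (hT₃ (i + 1) (by omega))
    rwa [div_le_iff₀' he] at this
  have hα : 0 ≤ Real.log (vecH (P (i + 1))) := h8.trans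
    (by linarith [(le_max_right _ _).trans (hT₃ (i + 1) (by omega))])
  have hgrow : (g - 2 * e) * Real.log (vecH (P (i + 1))) ≤ Real.log (vecH (P (i + 2))) := by
    have := hP.log_growth hne hgood
    linarith [hT₁ i hi1]
  have hval : (2 * g + 1 - 8 * e) * Real.log (vecH (P (i + 1))) ≤
      -Real.log |ev ζ (P (i + 1))| := by
    have h1 := hT₁ (i + 1) (by omega)
    have h2 := mul_le_mul_of_nonneg_left hgrow (show 0 ≤ g + 1 - e by linarith)
    have h3 : 2 * g + 1 - 8 * e ≤ (g + 1 - e) * (g - 2 * e) := by nlinarith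
    have h4 := mul_le_mul_of_nonneg_right h3 hα
    linarith
  obtain ⟨j, hj, hiff, hjgood⟩ := hP.exists_normal_eq_and_ne hne hdecay (i + 1)
  have hα' := hmono (show i + 2 ≤ j + 1 by omega)
  refine ⟨le_trans (mul_le_mul_of_nonneg_right (by linarith) hα) hval, j, hj, hiff, hjgood,
    le_trans (mul_le_mul_of_nonneg_right (by linarith) hα) (hgrow.trans hα'), ?_⟩
  have hvj := hT₁ j (by omega)
  have hbig' : 2 * Real.log 8 ≤ Real.log (vecH (P (j + 1))) :=
    (le_max_right _ _).trans (hT₃ (j + 1) (by omega))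
  have hsmall : 8 * vecH (P i) * vecH (P (j + 1)) * |ev ζ (P j)| ≤ 1 := by
    have p1 := hP.vecH_pos i
    have p2 := hP.vecH_pos (j + 1)
    have p3 := abs_pos.2 (hne j)
    rw [← Real.log_nonpos_iff (by positivity), Real.log_mul (by positivity) p3.ne',
      Real.log_mul (by positivity) p2.ne', Real.log_mul (by norm_num) p1.ne']
    have := hmono (show i ≤ j + 1 by omega)
    nlinarith
  have hnot : P i ⬝ᵥ normal P j ≠ 0 := by
    rw [Ne, hiff]
    intro h
    apply hgood
    have hn := hP.normal_ne_zero (i + 1)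
    have := (dotProduct_cross_eq_zero_iff hn h (dotProduct_normal_left (i + 1))
      (hP.normal_ne_zero i) (P (i + 2))).2 (dotProduct_normal_right (i + 1))
    exact this
  have hupp := hP.log_growth_upper hne hnot ((hiff _).2 (dotProduct_normal_left (i + 1))) hsmall
  have hlow := hT₂ (i + 1) (by omega)
  have hvi := hT₁ i hi1
  have h1 : (g - e) * Real.log (vecH (P (j + 1))) ≤
      (g + 1 + 3 * e) * Real.log (vecH (P (i + 1))) := by linarith
  have h2 : g + 1 + 3 * e ≤ (g - e) * (g + 20 * e) := by nlinarith
  have h3 := mul_le_mul_of_nonneg_right h2 hα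
  have h4 : Real.log (vecH (P (j + 1))) ≤ (g + 20 * e) * Real.log (vecH (P (i + 1))) := by
    refine le_of_mul_le_mul_left ?_ (show 0 < g - e by linarith)
    linarith
  exact h4.trans (mul_le_mul_of_nonneg_right (by linarith) hα)

/-- Three linearly independent quadratic polynomials with very small values whose heights are in
golden geometric progression. -/
theorem exists_triple (hP : IsMinimalSeq ζ P) (hne : ∀ i, ev ζ (P i) ≠ 0) {g : ℝ}
    (hg : g ^ 2 = g + 1) (hg1 : 1.6 < g) (hg2 : g < 1.7)
    (hU : ∀ ε > 0, ∃ T, ∀ t ≥ T,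
      (g ^ 2 - ε) * Real.log (vecH (P (t + 1))) ≤ -Real.log |ev ζ (P t)|)
    (hL : ∀ ε > 0, ∃ T, ∀ t ≥ T,
      -Real.log |ev ζ (P t)| ≤ (g ^ 3 + ε) * Real.log (vecH (P t)))
    {δ : ℝ} (hδ : 0 < δ) (hδ1 : δ ≤ 1) (A : ℝ) :
    ∃ p q r : Fin 3 → ℤ, ∃ a ≥ A, r ⬝ᵥ crossProduct p q ≠ 0 ∧
      Real.log (vecH p) ≤ a ∧ Real.log (vecH q) ≤ (g + δ) * a ∧
      Real.log (vecH r) ≤ (g ^ 2 + δ) * a ∧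
      Real.log |ev ζ p| ≤ -(g ^ 3 - δ) * a ∧ Real.log |ev ζ q| ≤ -(g ^ 4 - δ) * a ∧
      Real.log |ev ζ r| ≤ -(g ^ 5 - δ) * a := by
  have hdecay : ∀ δ > 0, ∃ T, ∀ t ≥ T, |ev ζ (P t)| * vecH (P (t + 1)) < δ := by
    intro δ hδ
    obtain ⟨T₁, hT₁⟩ := hU 0.5 (by norm_num)
    obtain ⟨T₂, hT₂⟩ := Filter.eventually_atTop.1
      (hP.tendsto_log_vecH.eventually_ge_atTop (max 0 (1 - Real.log δ)))
    refine ⟨max T₁ T₂, fun t ht => ?_⟩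
    have h1 := hT₁ t ((le_max_left _ _).trans ht)
    have h2 := hT₂ (t + 1) (((le_max_right _ _).trans ht).trans t.le_succ)
    have p1 := abs_pos.2 (hne t)
    have p2 := hP.vecH_pos (t + 1)
    rw [← Real.log_lt_log_iff (by positivity) hδ, Real.log_mul p1.ne' p2.ne']
    have h3 := (le_max_left _ _).trans h2
    have h4 := (le_max_right _ _).trans h2
    rw [hg] at h1
    nlinarith
  obtain ⟨T, hT⟩ := hP.exists_good_step hne hg hg1 hg2 hdecay hU hL
    (show 0 < δ / 40 by positivity)
  obtain ⟨S, hS⟩ := Filter.eventually_atTop.1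
    (hP.tendsto_log_vecH.eventually_ge_atTop (max A 0))
  obtain ⟨i, hi, -, higood⟩ := hP.exists_normal_eq_and_ne hne hdecay (max T S)
  have hiT : T ≤ i := (le_max_left _ _).trans hi
  have hiS : S ≤ i := (le_max_right _ _).trans hi
  obtain ⟨hvi, j, hj, hjiff, hjgood, hjlow, hjupp⟩ := hT i hiT higood
  obtain ⟨hvj, k, hk, hkiff, hkgood, hklow, hkupp⟩ := hT j (by omega) hjgood
  obtain ⟨hvk, -⟩ := hT k (by omega) hkgood
  set a := Real.log (vecH (P (i + 1)))
  have ha : max A 0 ≤ a := hS (i + 1) (by omega)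
  have ha0 : 0 ≤ a := (le_max_right _ _).trans ha
  set b := Real.log (vecH (P (j + 1)))
  set c := Real.log (vecH (P (k + 1)))
  set ε := δ / 40 with hε
  have hε0 : 0 < ε := by positivity
  have hε1 : ε ≤ 1 / 40 := by linarith
  have hg3 : g ^ 3 = 2 * g + 1 := by linear_combination (g + 1) * hg
  have hg4 : g ^ 4 = 3 * g + 2 := by linear_combination (g ^ 2 + g + 2) * hg
  have hg5 : g ^ 5 = 5 * g + 3 := by linear_combination (g ^ 3 + g ^ 2 + 2 * g + 3) * hg
  refine ⟨P (i + 1), P (j + 1), P (k + 1), a, (le_max_left _ _).trans ha, ?_, le_rfl, ?_, ?_, ?_,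
    ?_, ?_⟩
  · intro hdet
    have hpj : P (i + 1) ⬝ᵥ normal P j = 0 := (hjiff _).2 (dotProduct_normal_left (i + 1))
    have hrj := (dotProduct_cross_eq_zero_iff (hP.normal_ne_zero j) hpj
      (dotProduct_normal_right j) (hP.cross_ne_zero_of_lt (by omega)) (P (k + 1))).1 hdet
    have hqk : P (j + 1) ⬝ᵥ normal P k = 0 := (hkiff _).2 (dotProduct_normal_left (j + 1))
    have hqr := hP.cross_ne_zero_of_lt (show j + 1 < k + 1 by omega)
    have hjk : P (j + 2) ⬝ᵥ normal P k = 0 := (hkiff _).2 (dotProduct_normal_right (j + 1))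
    have h1 := (dotProduct_cross_eq_zero_iff (hP.normal_ne_zero k) hqk
      (dotProduct_normal_right k) hqr (P (j + 2))).2 hjk
    exact hjgood ((dotProduct_cross_eq_zero_iff (hP.normal_ne_zero j)
      (dotProduct_normal_right j) hrj hqr (P (j + 2))).1 h1)
  · exact hjupp.trans (mul_le_mul_of_nonneg_right (by linarith) ha0)
  · have h1 : (g + ε) * (g + ε) ≤ g ^ 2 + δ := by nlinarith
    have h2 := mul_le_mul_of_nonneg_left hjupp (show 0 ≤ g + ε by linarith)
    have h3 := mul_le_mul_of_nonneg_right h1 ha0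
    linarith
  · have := mul_le_mul_of_nonneg_right (show g ^ 3 - δ ≤ g ^ 3 - ε by linarith) ha0
    linarith
  · have h1 : g ^ 4 - δ ≤ (g ^ 3 - ε) * (g - ε) := by rw [hg3, hg4]; nlinarith
    have h2 := mul_le_mul_of_nonneg_left hjlow (show 0 ≤ g ^ 3 - ε by rw [hg3]; linarith)
    have h3 := mul_le_mul_of_nonneg_right h1 ha0
    linarith
  · have h1 : g ^ 2 - 4 * ε ≤ (g - ε) * (g - ε) := by nlinarith
    have h1' : g ^ 5 - δ ≤ (g ^ 3 - ε) * (g ^ 2 - 4 * ε) := by rw [hg3, hg5, hg]; nlinarith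
    have h1'' := mul_le_mul_of_nonneg_left h1 (show 0 ≤ g ^ 3 - ε by rw [hg3]; linarith)
    have h2 := mul_le_mul_of_nonneg_left hjlow (show 0 ≤ g - ε by linarith)
    have h3 := mul_le_mul_of_nonneg_left (h2.trans hklow)
      (show 0 ≤ g ^ 3 - ε by rw [hg3]; linarith)
    have h4 := mul_le_mul_of_nonneg_right (h1'.trans h1'') ha0
    linarith

end IsMinimalSeq

theorem exists_factor_of_root {u : Fin 3 → ℤ} {ρ : ℚ}
    (h : (u 0 : ℚ) + u 1 * ρ + u 2 * ρ ^ 2 = 0) :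
    ∃ m k : ℤ, u 0 = -(ρ.num * k) ∧ u 1 = ρ.den * k - ρ.num * m ∧ u 2 = ρ.den * m := by
  have hd : (ρ.den : ℚ) ≠ 0 := by exact_mod_cast ρ.den_ne_zero
  have hd' : (ρ.den : ℤ) ≠ 0 := by exact_mod_cast ρ.den_ne_zero
  have hcop : IsCoprime (ρ.den : ℤ) ρ.num := by
    rw [Int.isCoprime_iff_nat_coprime, Int.natAbs_natCast]
    exact ρ.reduced.symm
  have hρ : ρ * ρ.den = ρ.num := Rat.mul_den_eq_num ρ
  have hZ : u 0 * ρ.den ^ 2 + u 1 * ρ.num * ρ.den + u 2 * ρ.num ^ 2 = 0 := by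
    have : (u 0 * ρ.den ^ 2 + u 1 * ρ.num * ρ.den + u 2 * ρ.num ^ 2 : ℚ) = 0 := by
      rw [← hρ]
      linear_combination ρ.den ^ 2 * h
    exact_mod_cast this
  obtain ⟨m, hm⟩ : (ρ.den : ℤ) ∣ u 2 := by
    refine (hcop.pow_right (n := 2)).dvd_of_dvd_mul_right ⟨-(u 0 * ρ.den + u 1 * ρ.num), ?_⟩
    linear_combination hZ
  have hZ' : u 0 * ρ.den = -(ρ.num * (u 1 + ρ.num * m)) :=
    mul_left_cancel₀ hd' (by rw [hm] at hZ; linear_combination hZ)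
  obtain ⟨k, hk⟩ : (ρ.den : ℤ) ∣ u 1 + ρ.num * m :=
    hcop.dvd_of_dvd_mul_left ⟨-u 0, by linear_combination hZ'⟩
  refine ⟨m, k, mul_left_cancel₀ hd' ?_, by linear_combination hk, hm⟩
  rw [hk] at hZ'
  linear_combination hZ'

theorem natCast_dvd_le_vecH {u : Fin 3 → ℤ} (hu : u ≠ 0) {d : ℕ} (n m k : ℤ)
    (h0 : u 0 = -(n * k)) (h1 : u 1 = d * k - n * m) (h2 : u 2 = d * m) : d ≤ vecH u := by
  have aux : ∀ i, (d : ℤ) ∣ u i → u i ≠ 0 → d ≤ vecH u := fun i hdvd hne => by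
    have := Int.le_of_dvd (abs_pos.2 hne) ((dvd_abs _ _).2 hdvd)
    exact_mod_cast this.trans (vecH_le_iff.1 le_rfl i)
  rcases Nat.eq_zero_or_pos d with rfl | hd
  · exact Nat.zero_le _
  by_cases hm : m = 0
  · subst hm
    refine aux 1 ⟨k, by rw [h1]; ring⟩ fun h => hu ?_
    have hk : k = 0 := by
      rw [h1, mul_zero, sub_zero] at h
      exact (mul_eq_zero.1 h).resolve_left (by exact_mod_cast hd.ne')
    subst hk
    ext i
    fin_cases i <;> simp_all
  · refine aux 2 ⟨m, h2⟩ ?_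
    rw [h2]
    exact mul_ne_zero (by exact_mod_cast hd.ne') hm

/-- If `u` and `w` have a common rational root, then a third independent vector `s` gives a lower
bound for the distance of this root to `ζ`. -/
theorem one_le_of_common_root (ζ : ℝ) {s u w : Fin 3 → ℤ} (hdet : s ⬝ᵥ crossProduct u w ≠ 0)
    {ρ : ℚ} (hu : (u 0 : ℚ) + u 1 * ρ + u 2 * ρ ^ 2 = 0)
    (hw : (w 0 : ℚ) + w 1 * ρ + w 2 * ρ ^ 2 = 0) {B : ℝ}
    (hB : vecH u * |ev ζ w| + vecH w * |ev ζ u| ≤ B ∨ (u 2 = 0 ∧ vecH w * |ev ζ u| ≤ B)) :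
    1 ≤ (vecH w : ℝ) ^ 2 * |ev ζ s| + (2 + 2 * |ζ|) * (vecH s * B) := by
  have hu0 : u ≠ 0 := by rintro rfl; simp at hdet
  have hw0 : w ≠ 0 := by rintro rfl; simp at hdet
  have hs0 : s ≠ 0 := by rintro rfl; simp at hdet
  obtain ⟨m, k, hu1, hu2, hu3⟩ := exists_factor_of_root hu
  obtain ⟨m', k', hw1, hw2, hw3⟩ := exists_factor_of_root hw
  have hdw : (ρ.den : ℝ) ≤ vecH w := by exact_mod_cast natCast_dvd_le_vecH hw0 _ _ _ hw1 hw2 hw3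
  have hd1 : (1 : ℝ) ≤ ρ.den := by exact_mod_cast ρ.pos
  have hs1 : (1 : ℝ) ≤ vecH s := by exact_mod_cast one_le_vecH hs0
  set d := ρ.den
  set n := ρ.num
  have hprod : s ⬝ᵥ crossProduct u w =
      (m * k' - m' * k) * (s 0 * d ^ 2 + s 1 * n * d + s 2 * n ^ 2) * -1 := by
    simp [cross_apply, dotProduct, Fin.sum_univ_three, hu1, hu2, hu3, hw1, hw2, hw3]
    ring
  have hD : m * k' - m' * k ≠ 0 := fun h => hdet (by rw [hprod, h]; ring)
  have hE : s 0 * d ^ 2 + s 1 * n * d + s 2 * n ^ 2 ≠ 0 := fun h => hdet (by rw [hprod, h]; ring)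
  have hE1 : (1 : ℝ) ≤ |(s 0 * d ^ 2 + s 1 * n * d + s 2 * n ^ 2 : ℝ)| := by
    exact_mod_cast Int.one_le_abs hE
  have hD1 : (1 : ℝ) ≤ |(m * k' - m' * k : ℝ)| := by exact_mod_cast Int.one_le_abs hD
  set l : ℝ := d * ζ - n with hl
  have evu : ev ζ u = l * (m * ζ + k) := by
    simp only [ev, hu1, hu2, hu3, hl]; push_cast; ring
  have evw : ev ζ w = l * (m' * ζ + k') := by
    simp only [ev, hw1, hw2, hw3, hl]; push_cast; ring
  have hlB : d * |l| ≤ B := by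
    rcases hB with hB | ⟨hu2z, hB⟩
    · refine le_trans ?_ hB
      have e1 : d * l * (m * k' - m' * k : ℝ) = u 2 * ev ζ w - w 2 * ev ζ u := by
        rw [evu, evw, hu3, hw3]; push_cast; ring
      calc d * |l| ≤ d * |l| * |(m * k' - m' * k : ℝ)| :=
            le_mul_of_one_le_right (by positivity) hD1
        _ = |u 2 * ev ζ w - w 2 * ev ζ u| := by
            rw [← e1, abs_mul, abs_mul, Nat.abs_cast]
        _ ≤ |(u 2 : ℝ)| * |ev ζ w| + |(w 2 : ℝ)| * |ev ζ u| := by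
            rw [← abs_mul, ← abs_mul]; exact abs_sub _ _
        _ ≤ _ := by gcongr <;> apply abs_le_vecH
    · refine le_trans ?_ hB
      have hm : m = 0 := by
        rw [hu3] at hu2z
        exact (mul_eq_zero.1 hu2z).resolve_left (by exact_mod_cast ρ.den_ne_zero)
      have hk : k ≠ 0 := fun hk => hD (by rw [hm, hk]; ring)
      have hk1 : (1 : ℝ) ≤ |(k : ℝ)| := by exact_mod_cast Int.one_le_abs hk
      rw [evu, hm, abs_mul]
      simp only [Int.cast_zero, zero_mul, zero_add]
      gcongr
      exact le_mul_of_one_le_right (abs_nonneg _) hk1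
  have hB0 : 0 ≤ B := le_trans (by positivity) hlB
  have hlB' : |l| ≤ B := le_trans (le_mul_of_one_le_left (abs_nonneg _) hd1) hlB
  by_cases hB1 : 1 ≤ B
  · have h1 : 1 ≤ vecH s * B := one_le_mul_of_one_le_of_one_le hs1 hB1
    have h2 : 0 ≤ (vecH w : ℝ) ^ 2 * |ev ζ s| := by positivity
    have h3 : 0 ≤ |ζ| * (vecH s * B) := by positivity
    linarith
  · have e : (s 0 * d ^ 2 + s 1 * n * d + s 2 * n ^ 2 : ℝ) =
        d ^ 2 * ev ζ s - (s 1 * (d * l) + s 2 * (d * l * (2 * ζ) - l * l)) := by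
      simp only [ev, hl]; ring
    rw [e] at hE1
    calc (1 : ℝ) ≤ _ := hE1
      _ ≤ |d ^ 2 * ev ζ s| + (|s 1 * (d * l)| + |s 2 * (d * l * (2 * ζ) - l * l)|) :=
          (abs_sub _ _).trans (add_le_add_right (abs_add_le _ _) _)
      _ ≤ (vecH w : ℝ) ^ 2 * |ev ζ s| + (vecH s * B + vecH s * (B * (2 * |ζ|) + B * 1)) := by
          have a1 := abs_le_vecH s 1
          have a2 := abs_le_vecH s 2
          have e1 : |(d : ℝ) * l| ≤ B := by rwa [abs_mul, Nat.abs_cast]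
          have e2 : |(d * l * (2 * ζ) - l * l : ℝ)| ≤ B * (2 * |ζ|) + B * 1 := by
            refine (abs_sub _ _).trans ?_
            rw [abs_mul, abs_mul l l, abs_mul 2 ζ, abs_two]
            have : |l| ≤ 1 := hlB'.trans (not_le.1 hB1).le
            gcongr
          rw [abs_mul, abs_mul (s 1 : ℝ), abs_mul (s 2 : ℝ), abs_of_nonneg (sq_nonneg (d : ℝ))]
          gcongr
      _ = _ := by ring

/-- The quadratic polynomial with rational coefficients attached to an integer vector. -/
noncomputable def ratPoly (p : Fin 3 → ℤ) : ℚ[X] :=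
  C (p 0 : ℚ) + C (p 1 : ℚ) * X + C (p 2 : ℚ) * X ^ 2

theorem ratPoly_coeff (p : Fin 3 → ℤ) (i : Fin 3) : (ratPoly p).coeff i = p i := by
  simp only [ratPoly, coeff_add, coeff_C_mul, coeff_C, coeff_X, coeff_X_pow]
  fin_cases i <;> simp

theorem ratPoly_natDegree_le (p : Fin 3 → ℤ) : (ratPoly p).natDegree ≤ 2 := by
  unfold ratPoly
  compute_degree

theorem ratPoly_ne_zero {p : Fin 3 → ℤ} (hp : p ≠ 0) : ratPoly p ≠ 0 := by
  intro h
  refine hp (funext fun i => ?_)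
  have := ratPoly_coeff p i
  rw [h, coeff_zero] at this
  exact_mod_cast this.symm

theorem ratPoly_eval (p : Fin 3 → ℤ) (ρ : ℚ) :
    (ratPoly p).eval ρ = p 0 + p 1 * ρ + p 2 * ρ ^ 2 := by
  simp [ratPoly]

theorem cross_eq_zero_of_eq_C_mul {u w : Fin 3 → ℤ} {f : ℚ[X]} {a b : ℚ}
    (hu : ratPoly u = C a * f) (hw : ratPoly w = C b * f) : crossProduct u w = 0 := by
  have h : ∀ i j, u i * w j = u j * w i := fun i j => by
    have key : ∀ i, (u i : ℚ) = a * f.coeff i ∧ (w i : ℚ) = b * f.coeff i := fun i => by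
      rw [← ratPoly_coeff, ← ratPoly_coeff, hu, hw, coeff_C_mul, coeff_C_mul]
      exact ⟨rfl, rfl⟩
    have : (u i * w j : ℚ) = u j * w i := by
      rw [(key i).1, (key i).2, (key j).1, (key j).2]; ring
    exact_mod_cast this
  rw [cross_apply]
  ext i
  fin_cases i <;> simp [h 1 2, h 2 0, h 0 1, mul_comm]

theorem eq_C_mul_of_dvd_of_natDegree_le {f g : ℚ[X]} (hg : g ≠ 0) (h : f ∣ g)
    (hd : g.natDegree ≤ f.natDegree) : ∃ a : ℚ, g = C a * f := by
  obtain ⟨c, rfl⟩ := h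
  rw [natDegree_mul (left_ne_zero_of_mul hg) (right_ne_zero_of_mul hg)] at hd
  obtain ⟨a, rfl⟩ := natDegree_eq_zero.1 (show c.natDegree = 0 by omega)
  exact ⟨a, mul_comm _ _⟩

theorem exists_root_of_natDegree_eq_one {f : ℚ[X]} (hf : f.natDegree = 1) :
    ∃ ρ, f.eval ρ = 0 :=
  exists_root_of_degree_eq_one ((degree_eq_iff_natDegree_eq_of_pos one_pos).2 hf)

/-- Three independent quadratic polynomials with very small values at `ζ`: the third one does not
divide the product of the others. -/
theorem ratPoly_not_dvd_mul (ζ : ℝ) {p q r : Fin 3 → ℤ} (hdet : r ⬝ᵥ crossProduct p q ≠ 0)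
    (h₁ : (vecH q : ℝ) ^ 2 * |ev ζ p| +
      (2 + 2 * |ζ|) * (vecH p * (vecH r * |ev ζ q| + vecH q * |ev ζ r|)) < 1)
    (h₂ : (vecH p : ℝ) ^ 2 * |ev ζ q| + (2 + 2 * |ζ|) * (vecH q * (vecH p * |ev ζ r|)) < 1)
    (h₃ : |ev ζ r| < 1) : ¬ ratPoly r ∣ ratPoly p * ratPoly q := by
  intro hdvd
  have hr0 : r ≠ 0 := by rintro rfl; simp at hdet
  have hp0 : p ≠ 0 := by rintro rfl; simp at hdet
  have hq0 : q ≠ 0 := by rintro rfl; simp at hdet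
  have hperm : ∀ s u w : Fin 3 → ℤ, s ⬝ᵥ crossProduct u w = u ⬝ᵥ crossProduct w s :=
    fun s u w => by rw [triple_product_permutation]
  have hdet' := hdet
  rw [hperm] at hdet'
  have hdet'' := hdet'
  rw [hperm] at hdet''
  by_cases hcop : IsCoprime (ratPoly r) (ratPoly q)
  · have hrp := hcop.dvd_of_dvd_mul_right hdvd
    have hdeg := natDegree_le_of_dvd hrp (ratPoly_ne_zero hp0)
    have hle := (ratPoly_natDegree_le p)
    obtain h | h | h : (ratPoly r).natDegree = 0 ∨ (ratPoly r).natDegree = 1 ∨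
      (ratPoly r).natDegree = 2 := by omega
    · have hz : ∀ i : Fin 3, i ≠ 0 → r i = 0 := fun i hi => by
        have := ratPoly_coeff r i
        rw [coeff_eq_zero_of_natDegree_lt (by rw [h]; exact Fin.pos_iff_ne_zero.2 hi)] at this
        exact_mod_cast this.symm
      have hr00 : r 0 ≠ 0 := fun h0 => hr0 (funext fun i => by
        by_cases hi : i = 0
        · rw [hi, h0]; rfl
        · exact hz i hi)
      rw [ev, hz 1 (by decide), hz 2 (by decide)] at h₃
      simp only [Int.cast_zero, zero_mul, add_zero] at h₃
      have : (1 : ℝ) ≤ |(r 0 : ℝ)| := by exact_mod_cast Int.one_le_abs hr00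
      linarith
    · obtain ⟨ρ, hρ⟩ := exists_root_of_natDegree_eq_one h
      have hρp : (ratPoly p).eval ρ = 0 := eval_eq_zero_of_dvd_of_eval_eq_zero hrp hρ
      rw [ratPoly_eval] at hρ hρp
      have hr2 : r 2 = 0 := by
        have := ratPoly_coeff r 2
        rw [coeff_eq_zero_of_natDegree_lt (by rw [h]; decide)] at this
        exact_mod_cast this.symm
      exact absurd (one_le_of_common_root ζ hdet'' hρ hρp (Or.inr ⟨hr2, le_rfl⟩)) (not_le.2 h₂)
    · obtain ⟨a, ha⟩ := eq_C_mul_of_dvd_of_natDegree_le (ratPoly_ne_zero hp0) hrp (by omega)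
      have := cross_eq_zero_of_eq_C_mul (u := r) (a := 1) (by rw [C_1, one_mul]) ha
      rw [this] at hdet''
      simp at hdet''
  · set f := EuclideanDomain.gcd (ratPoly r) (ratPoly q) with hf
    have hfr : f ∣ ratPoly r := EuclideanDomain.gcd_dvd_left _ _
    have hfq : f ∣ ratPoly q := EuclideanDomain.gcd_dvd_right _ _
    have hdeg := natDegree_le_of_dvd hfr (ratPoly_ne_zero hr0)
    have hr2 := ratPoly_natDegree_le r
    have hq2 := ratPoly_natDegree_le q
    have hf0 : f.natDegree ≠ 0 := fun h => hcop (by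
      rw [← EuclideanDomain.gcd_isUnit_iff]
      exact isUnit_iff_degree_eq_zero.2 (by
        rw [degree_eq_natDegree (ne_zero_of_dvd_ne_zero (ratPoly_ne_zero hr0) hfr), h]; rfl))
    obtain h | h : f.natDegree = 1 ∨ f.natDegree = 2 := by omega
    · obtain ⟨ρ, hρ⟩ := exists_root_of_natDegree_eq_one h
      have hρr := eval_eq_zero_of_dvd_of_eval_eq_zero hfr hρ
      have hρq := eval_eq_zero_of_dvd_of_eval_eq_zero hfq hρ
      rw [ratPoly_eval] at hρr hρq
      have hdr : p ⬝ᵥ crossProduct r q ≠ 0 := by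
        rwa [← cross_anticomm, dotProduct_neg, neg_ne_zero]
      exact absurd (one_le_of_common_root ζ hdr hρr hρq (Or.inl le_rfl)) (not_le.2 h₁)
    · obtain ⟨a, ha⟩ := eq_C_mul_of_dvd_of_natDegree_le (ratPoly_ne_zero hr0) hfr (by omega)
      obtain ⟨b, hb⟩ := eq_C_mul_of_dvd_of_natDegree_le (ratPoly_ne_zero hq0) hfq (by omega)
      have := cross_eq_zero_of_eq_C_mul hb ha
      rw [this] at hdet'
      simp at hdet'

theorem abs_det_le_of_row_le {m : ℕ} (M : Matrix (Fin m) (Fin m) ℝ) (b : Fin m → ℝ)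
    (h : ∀ i j, |M i j| ≤ b i) : |M.det| ≤ m.factorial * ∏ i, b i := by
  rw [Matrix.det_apply]
  calc _ ≤ ∑ σ : Equiv.Perm (Fin m), |Equiv.Perm.sign σ • ∏ i, M (σ i) i| :=
        Finset.abs_sum_le_sum_abs _ _
    _ ≤ ∑ σ : Equiv.Perm (Fin m), ∏ i, b i := by
        refine Finset.sum_le_sum fun σ _ => ?_
        have : |Equiv.Perm.sign σ • ∏ i, M (σ i) i| = |∏ i, M (σ i) i| := by
          rcases Int.units_eq_one_or (Equiv.Perm.sign σ) with h | h <;> simp [h]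
        rw [this, Finset.abs_prod, ← Equiv.prod_comp σ b]
        exact Finset.prod_le_prod (fun _ _ => abs_nonneg _) fun i _ => h _ _
    _ = _ := by
        rw [Finset.sum_const, Finset.card_univ, Fintype.card_perm, Fintype.card_fin, nsmul_eq_mul]

section CrossProduct

variable {n : ℕ} {R : Type*} [CommRing R]

/-- The generalized cross product of `n` vectors of length `n + 1`: the vector of their maximal
minors. -/
def minors (A : Fin n → Fin (n + 1) → R) (j : Fin (n + 1)) : R :=
  (Matrix.of (Fin.cons (Pi.single j 1) A : Fin (n + 1) → Fin (n + 1) → R)).det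

theorem dotProduct_minors (A : Fin n → Fin (n + 1) → R) (w : Fin (n + 1) → R) :
    w ⬝ᵥ minors A = (Matrix.of (Fin.cons w A : Fin (n + 1) → Fin (n + 1) → R)).det := by
  have hup : ∀ v : Fin (n + 1) → R, (Fin.cons v A : Fin (n + 1) → Fin (n + 1) → R) =
      Function.update (Fin.cons 0 A) 0 v := fun v => (Fin.update_cons_zero _ _ _).symm
  let D : (Fin (n + 1) → R) →ₗ[R] R :=
    (Matrix.detRowAlternating (R := R) (n := Fin (n + 1))).toMultilinearMap.toLinearMap
      (Fin.cons 0 A) 0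
  have hD : ∀ v, (Matrix.of (Fin.cons v A : Fin (n + 1) → Fin (n + 1) → R)).det = D v :=
    fun v => by rw [hup]; rfl
  rw [hD]
  conv_rhs => rw [← Finset.univ_sum_single w]
  rw [map_sum, dotProduct]
  refine Finset.sum_congr rfl fun j _ => ?_
  rw [minors, hD, ← smul_eq_mul, ← map_smul, ← Pi.single_smul, smul_eq_mul, mul_one]

theorem minors_intCast (A : Fin n → Fin (n + 1) → ℤ) (j : Fin (n + 1)) :
    minors (fun i k => (A i k : R)) j = (minors A j : ℤ) := by
  rw [minors, minors, Int.cast_det]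
  congr 1
  ext i k
  refine Fin.cases ?_ (fun i => ?_) i
  · by_cases h : k = j <;> simp [h]
  · simp

end CrossProduct

theorem minors_ne_zero {n : ℕ} {K : Type*} [Field K] {A : Fin n → Fin (n + 1) → K}
    (hA : LinearIndependent K A) : minors A ≠ 0 := by
  intro h
  obtain ⟨w, hw⟩ : ∃ w, w ∉ Submodule.span K (Set.range A) := by
    by_contra! hall
    have htop : Submodule.span K (Set.range A) = ⊤ := eq_top_iff.2 fun w _ => hall w
    have h1 := finrank_range_le_card (R := K) A
    rw [Set.finrank, htop, finrank_top] at h1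
    simp at h1
  have hli : LinearIndependent K (Fin.cons w A : Fin (n + 1) → Fin (n + 1) → K) :=
    linearIndependent_finCons.2 ⟨hA, hw⟩
  have hdet := dotProduct_minors A w
  rw [h, dotProduct_zero] at hdet
  have hunit : IsUnit (Matrix.of (Fin.cons w A : Fin (n + 1) → Fin (n + 1) → K)) :=
    Matrix.linearIndependent_rows_iff_isUnit.1 hli
  rw [Matrix.isUnit_iff_isUnit_det, ← hdet] at hunit
  exact not_isUnit_zero hunit

/-- Integer vectors `A i` of size at most `K` and of values at most `v` at `ζ` yield, via their
minors, a simultaneous approximation to the powers of `ζ`. -/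
theorem abs_minors_sub_le {ζ Z K v : ℝ} (A : Fin 4 → Fin 5 → ℤ)
    (hZ : ∀ i : Fin 5, |ζ| ^ (i : ℕ) ≤ Z) (hK : ∀ i j, |(A i j : ℝ)| ≤ K)
    (hv : ∀ i, |∑ j : Fin 5, (A i j : ℝ) * ζ ^ (j : ℕ)| ≤ v) (i : Fin 5) :
    |ζ ^ (i : ℕ) * (minors A 0 : ℤ) - (minors A i : ℤ)| ≤ 480 * (Z + 1) * K ^ 3 * v := by
  have hZ1 : 1 ≤ Z := by simpa using hZ 0
  have hK0 : 0 ≤ K := (abs_nonneg _).trans (hK 0 0)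
  have hv0 : 0 ≤ v := (abs_nonneg _).trans (hv 0)
  let B : Fin 4 → Fin 5 → ℝ := fun i k => A i k
  let z : Fin 5 → ℝ := ζ ^ (i : ℕ) • Pi.single 0 1 - Pi.single i 1
  have hz : z ⬝ᵥ minors B = ζ ^ (i : ℕ) * (minors A 0 : ℤ) - (minors A i : ℤ) := by
    rw [sub_dotProduct, smul_dotProduct, single_dotProduct, single_dotProduct, one_mul, one_mul,
      minors_intCast, minors_intCast, smul_eq_mul]
  let M : Matrix (Fin 5) (Fin 5) ℝ := Matrix.of (Fin.cons z B : Fin 5 → Fin 5 → ℝ)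
  have hM : M.det = ζ ^ (i : ℕ) * (minors A 0 : ℤ) - (minors A i : ℤ) := by
    rw [← hz, dotProduct_minors]
  let θ : Fin 5 → ℝ := fun j => ζ ^ (j : ℕ)
  have hMθ0 : (M.mulVec θ) 0 = 0 := by
    change z ⬝ᵥ θ = 0
    rw [sub_dotProduct, smul_dotProduct, single_dotProduct, single_dotProduct]
    simp [θ]
  have hMθ : ∀ k : Fin 4, |(M.mulVec θ) k.succ| ≤ v := fun k => hv k
  have hzle : ∀ j, |z j| ≤ Z + 1 := fun j => by
    refine (abs_sub _ _).trans (add_le_add ?_ ?_)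
    · by_cases h : j = 0
      · subst h
        simpa using hZ i
      · simp [Pi.single_eq_of_ne h]
        linarith
    · by_cases h : j = i
      · subst h
        simp
      · simp [Pi.single_eq_of_ne h]
  have hadj : ∀ k : Fin 4, |M.adjugate 0 k.succ| ≤ 120 * ((Z + 1) * K ^ 3) := fun k => by
    rw [Matrix.adjugate_apply]
    refine (abs_det_le_of_row_le _ (Function.update
      (Fin.cons (Z + 1) fun _ => K : Fin 5 → ℝ) k.succ 1) fun a b => ?_).trans (le_of_eq ?_)
    · by_cases ha : a = k.succ
      · subst ha
        rw [Matrix.updateRow_self, Function.update_self]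
        by_cases hb : b = 0
        · simp [hb]
        · simp [Pi.single_eq_of_ne hb]
      · rw [Matrix.updateRow_ne ha, Function.update_of_ne ha]
        refine Fin.cases ?_ (fun a => ?_) a
        · exact hzle b
        · exact hK a b
    · have : ((Nat.factorial 5 : ℕ) : ℝ) = 120 := by norm_num [Nat.factorial]
      have hcard : (Finset.univ \ {k}).card = 3 := by revert k; decide
      rw [this, ← Fin.cons_update, Fin.prod_univ_succ]
      simp only [Fin.cons_zero, Fin.cons_succ]
      rw [Finset.prod_update_of_mem (Finset.mem_univ k), one_mul, Finset.prod_const, hcard]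
  have hcramer : M.det = ∑ k : Fin 4, M.adjugate 0 k.succ * (M.mulVec θ) k.succ := by
    have h : (M.adjugate.mulVec (M.mulVec θ)) 0 = M.det := by
      rw [Matrix.mulVec_mulVec, Matrix.adjugate_mul, Matrix.smul_mulVec, Matrix.one_mulVec]
      simp [θ]
    rw [← h, Matrix.mulVec, dotProduct, Fin.sum_univ_succ, hMθ0, mul_zero, zero_add]
  rw [← hM, hcramer]
  calc _ ≤ ∑ k : Fin 4, |M.adjugate 0 k.succ * (M.mulVec θ) k.succ| :=
        Finset.abs_sum_le_sum_abs _ _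
    _ ≤ ∑ k : Fin 4, 120 * ((Z + 1) * K ^ 3) * v := by
        refine Finset.sum_le_sum fun k _ => ?_
        rw [abs_mul]
        exact mul_le_mul (hadj k) (hMθ k) (abs_nonneg _) (by positivity)
    _ = _ := by
        rw [Finset.sum_const, Finset.card_univ, Fintype.card_fin, nsmul_eq_mul]
        push_cast
        ring

theorem abs_minors_zero_le {K : ℝ} (A : Fin 4 → Fin 5 → ℤ) (hK : ∀ i j, |(A i j : ℝ)| ≤ K) :
    |((minors A 0 : ℤ) : ℝ)| ≤ 120 * K ^ 4 := by
  rw [← minors_intCast (R := ℝ)]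
  refine (abs_det_le_of_row_le _ (Fin.cons 1 fun _ => K : Fin 5 → ℝ) fun a b => ?_).trans
    (le_of_eq ?_)
  · refine Fin.cases ?_ (fun a => ?_) a
    · by_cases hb : b = 0
      · simp [hb]
      · simp [Pi.single_eq_of_ne hb]
    · exact hK a b
  · have : ((Nat.factorial 5 : ℕ) : ℝ) = 120 := by norm_num [Nat.factorial]
    rw [this, Fin.prod_univ_succ]
    simp

/-- Coefficient vectors of `r`, `T r`, `T² r` and `p q`. -/
def multiples (p q r : Fin 3 → ℤ) : Fin 4 → Fin 5 → ℤ :=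
  ![![r 0, r 1, r 2, 0, 0], ![0, r 0, r 1, r 2, 0], ![0, 0, r 0, r 1, r 2],
    ![p 0 * q 0, p 0 * q 1 + p 1 * q 0, p 0 * q 2 + p 1 * q 1 + p 2 * q 0,
      p 1 * q 2 + p 2 * q 1, p 2 * q 2]]

theorem linearIndependent_multiples {p q r : Fin 3 → ℤ} (hr : r ≠ 0)
    (h : ¬ ratPoly r ∣ ratPoly p * ratPoly q) :
    LinearIndependent ℚ (fun i k => (multiples p q r i k : ℚ)) := by
  rw [Fintype.linearIndependent_iff]
  intro c hc
  have hcoef : ∀ k, ∑ i, c i * (multiples p q r i k : ℚ) = 0 := fun k => by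
    have := congrFun hc k
    simpa [Finset.sum_apply] using this
  have e0 := hcoef 0
  have e1 := hcoef 1
  have e2 := hcoef 2
  have e3 := hcoef 3
  have e4 := hcoef 4
  simp [Fin.sum_univ_four, multiples] at e0 e1 e2 e3 e4
  set l : ℚ[X] := C (c 0) + C (c 1) * X + C (c 2) * X ^ 2 with hl
  have key : l * ratPoly r + C (c 3) * (ratPoly p * ratPoly q) = 0 := by
    have f0 := congrArg (C : ℚ →+* ℚ[X]) e0
    have f1 := congrArg (C : ℚ →+* ℚ[X]) e1
    have f2 := congrArg (C : ℚ →+* ℚ[X]) e2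
    have f3 := congrArg (C : ℚ →+* ℚ[X]) e3
    have f4 := congrArg (C : ℚ →+* ℚ[X]) e4
    simp only [map_add, map_mul, map_zero] at f0 f1 f2 f3 f4
    simp only [hl, ratPoly]
    linear_combination f0 + X * f1 + X ^ 2 * f2 + X ^ 3 * f3 + X ^ 4 * f4
  have hc3 : c 3 = 0 := by
    by_contra hc3
    refine h ⟨-(C (c 3)⁻¹ * l), ?_⟩
    have hu : C (c 3)⁻¹ * C (c 3) = (1 : ℚ[X]) := by rw [← C_mul, inv_mul_cancel₀ hc3, C_1]
    linear_combination C (c 3)⁻¹ * key - (ratPoly p * ratPoly q) * hu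
  rw [hc3, C_0, zero_mul, add_zero] at key
  have hl0 := (mul_eq_zero.1 key).resolve_right (ratPoly_ne_zero hr)
  have hci : ∀ k : ℕ, l.coeff k = 0 := fun k => by rw [hl0, coeff_zero]
  have g0 := hci 0
  have g1 := hci 1
  have g2 := hci 2
  simp only [hl, coeff_add, coeff_C_mul, coeff_C, coeff_X, coeff_X_pow] at g0 g1 g2
  simp at g0 g1 g2
  intro i
  fin_cases i <;> assumption

/-- Simultaneous approximations to `ζ, …, ζ ^ 4` from three quadratic polynomials. -/
theorem exists_approx_of_triple {ζ Z K v : ℝ} {p q r : Fin 3 → ℤ} (hr0 : r ≠ 0)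
    (hdvd : ¬ ratPoly r ∣ ratPoly p * ratPoly q) (hZ : ∀ i : Fin 5, |ζ| ^ (i : ℕ) ≤ Z)
    (hr : (vecH r : ℝ) ≤ K) (hpq : (3 * vecH p * vecH q : ℝ) ≤ K)
    (hvr : Z * |ev ζ r| ≤ v) (hvpq : |ev ζ p| * |ev ζ q| ≤ v) :
    ∃ x : Fin 5 → ℤ, x ≠ 0 ∧ |(x 0 : ℝ)| ≤ 120 * K ^ 4 ∧
      ∀ i : Fin 5, |ζ ^ (i : ℕ) * (x 0 : ℝ) - x i| ≤ 480 * (Z + 1) * K ^ 3 * v := by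
  have hK0 : 0 ≤ K := le_trans (Nat.cast_nonneg _) hr
  have hprod : ∀ i j, |(p i * q j : ℝ)| ≤ vecH p * vecH q := fun i j => by
    rw [abs_mul]
    exact mul_le_mul (abs_le_vecH p i) (abs_le_vecH q j) (abs_nonneg _) (Nat.cast_nonneg _)
  have hpq0 : (0 : ℝ) ≤ vecH p * vecH q := by positivity
  have hK : ∀ i j, |(multiples p q r i j : ℝ)| ≤ K := by
    have hri := fun i => (abs_le_vecH r i).trans hr
    have h2 : ∀ {a b : ℝ}, |a| ≤ vecH p * vecH q → |b| ≤ vecH p * vecH q → |a + b| ≤ K :=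
      fun {a b} ha hb => by linarith [abs_add_le a b]
    intro i j
    fin_cases i <;> fin_cases j <;> simp [multiples, hK0, hri, -abs_mul]
    · linarith [hprod 0 0]
    · exact h2 (hprod 0 1) (hprod 1 0)
    · have a1 := abs_add_le (p 0 * q 2 + p 1 * q 1 : ℝ) (p 2 * q 0)
      have a2 := abs_add_le (p 0 * q 2 : ℝ) (p 1 * q 1)
      linarith [hprod 0 2, hprod 1 1, hprod 2 0]
    · exact h2 (hprod 1 2) (hprod 2 1)
    · linarith [hprod 2 2]
  have hv : ∀ i, |∑ j : Fin 5, (multiples p q r i j : ℝ) * ζ ^ (j : ℕ)| ≤ v := by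
    have hk : ∀ k : Fin 5, |ζ ^ (k : ℕ) * ev ζ r| ≤ v := fun k => by
      rw [abs_mul, abs_pow]
      exact (mul_le_mul_of_nonneg_right (hZ k) (abs_nonneg _)).trans hvr
    intro i
    fin_cases i
    · refine le_trans (le_of_eq (congrArg abs ?_)) (hk 0)
      simp [multiples, Fin.sum_univ_five, ev]
    · refine le_trans (le_of_eq (congrArg abs ?_)) (hk 1)
      simp [multiples, Fin.sum_univ_five, ev]
      ring
    · refine le_trans (le_of_eq (congrArg abs ?_)) (hk 2)
      simp [multiples, Fin.sum_univ_five, ev]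
      ring
    · rw [← abs_mul] at hvpq
      refine le_trans (le_of_eq (congrArg abs ?_)) hvpq
      simp [multiples, Fin.sum_univ_five, ev]
      ring
  refine ⟨minors (multiples p q r), fun h => ?_, abs_minors_zero_le _ hK,
    abs_minors_sub_le _ hZ hK hv⟩
  refine minors_ne_zero (linearIndependent_multiples hr0 hdvd) (funext fun j => ?_)
  rw [minors_intCast, h]
  simp

theorem exists_small_of_whSet {ζ : ℝ} {η : ℝ} (hη : 1 ≤ η) (h : η ∈ whSet 2 ζ) :
    ∀ δ > 0, ∃ q : Fin 3 → ℤ, q ≠ 0 ∧ |ev ζ q| < δ := by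
  intro δ hδ
  obtain ⟨X₀, hX₀⟩ := h
  obtain ⟨P, hdeg, -, hpos, hle⟩ := hX₀ (max X₀ (1 + 1 / δ)) (le_max_left _ _)
  obtain ⟨q, rfl⟩ := exists_vec_of_natDegree_le_two hdeg
  rw [pev_vecPoly_three] at hpos hle
  refine ⟨q, ?_, hle.trans_lt ?_⟩
  · rintro rfl
    simp [ev] at hpos
  · have hX := le_max_right X₀ (1 + 1 / δ)
    set X := max X₀ (1 + 1 / δ)
    have hδ' : 0 < 1 / δ := by positivity
    calc X ^ (-η) ≤ X ^ (-1 : ℝ) :=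
          Real.rpow_le_rpow_of_exponent_le (by linarith) (by linarith)
      _ = X⁻¹ := Real.rpow_neg_one X
      _ < δ := inv_lt_of_inv_lt₀ hδ (by rw [← one_div]; linarith)

theorem IsMinimalSeq.log_ev_le_of_whSet {ζ : ℝ} {P : ℕ → Fin 3 → ℤ} (hP : IsMinimalSeq ζ P)
    {η ξ : ℝ} (hξη : ξ < η) (h : η ∈ whSet 2 ζ) (hne : ∀ i, ev ζ (P i) ≠ 0) :
    ∃ T, ∀ t ≥ T, ξ * Real.log (vecH (P (t + 1))) ≤ -Real.log |ev ζ (P t)| := by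
  obtain ⟨X₀, hX₀⟩ := h
  have hη0 : 0 < η - ξ := sub_pos.2 hξη
  have hH : Filter.Tendsto (fun i => (vecH (P i) : ℝ)) Filter.atTop Filter.atTop :=
    tendsto_natCast_atTop_atTop.comp hP.vecH_strictMono.tendsto_atTop
  obtain ⟨T, hT⟩ := Filter.eventually_atTop.1 ((hH.eventually_ge_atTop (2 * X₀)).and
    (hP.tendsto_log_vecH.eventually_ge_atTop (η * Real.log 2 / (η - ξ))))
  refine ⟨T, fun t ht => ?_⟩
  obtain ⟨h1, h2⟩ := hT (t + 1) (by omega)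
  have hpos := hP.vecH_pos (t + 1)
  obtain ⟨Q, hdeg, hht, hQ, hle⟩ := hX₀ (vecH (P (t + 1)) / 2) (by linarith)
  obtain ⟨q, rfl⟩ := exists_vec_of_natDegree_le_two hdeg
  rw [pev_vecPoly_three] at hQ hle
  have hq : q ≠ 0 := by
    rintro rfl
    simp [ev] at hQ
  have hlt : vecH q < vecH (P (t + 1)) := by
    have : (vecH q : ℝ) < vecH (P (t + 1)) := by linarith [vecH_le_polyH q]
    exact_mod_cast this
  have h3 := Real.log_le_log (abs_pos.2 (hne t)) ((hP.le_ev t q hq hlt).trans hle)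
  rw [Real.log_rpow (by positivity), Real.log_div hpos.ne' two_ne_zero] at h3
  rw [div_le_iff₀ hη0] at h2
  linarith

theorem IsMinimalSeq.le_log_ev_of_notMem_wSet {ζ : ℝ} {P : ℕ → Fin 3 → ℤ}
    (hP : IsMinimalSeq ζ P) {n : ℕ} (hn : 2 ≤ n) {η : ℝ} (h : η ∉ wSet n ζ)
    (hne : ∀ i, ev ζ (P i) ≠ 0) :
    ∃ T, ∀ t ≥ T, -Real.log |ev ζ (P t)| ≤ η * Real.log (vecH (P t)) := by
  simp only [wSet, Set.mem_ofPred_eq, not_forall, not_exists, not_and, not_le] at h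
  obtain ⟨X₀, hX₀⟩ := h
  have hH : Filter.Tendsto (fun i => (vecH (P i) : ℝ)) Filter.atTop Filter.atTop :=
    tendsto_natCast_atTop_atTop.comp hP.vecH_strictMono.tendsto_atTop
  obtain ⟨T, hT⟩ := Filter.eventually_atTop.1 (hH.eventually_ge_atTop X₀)
  refine ⟨T, fun t ht => ?_⟩
  have hpos := hP.vecH_pos t
  have h1 := hX₀ _ (hT t ht) (vecPoly (P t)) ((vecPoly_natDegree_le _).trans hn) (polyH_le_vecH _)
  rw [pev_vecPoly_three] at h1
  have h2 := Real.log_le_log (by positivity) (h1 (abs_pos.2 (hne t))).le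
  rw [Real.log_rpow hpos] at h2
  linarith

theorem bddAbove_of_sSup_ne_zero {s : Set ℝ} (h : sSup s ≠ 0) : BddAbove s := by
  by_contra hs
  exact h (Real.sSup_of_not_bddAbove hs)

theorem nonempty_of_sSup_ne_zero {s : Set ℝ} (h : sSup s ≠ 0) : s.Nonempty := by
  by_contra hs
  rw [Set.not_nonempty_iff_eq_empty.1 hs, Real.sSup_empty] at h
  exact h rfl

/-- Non-divisibility for triples of quadratic polynomials with the growth of
`IsMinimalSeq.exists_triple`. -/
theorem ratPoly_not_dvd_mul_of_le_exp {ζ g δ a : ℝ} {p q r : Fin 3 → ℤ} (hg1 : 1.6 < g)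
    (hg2 : g < 1.7) (hδ : 0 < δ) (hδ1 : δ ≤ 1 / 10)
    (haζ : 2 * Real.log (6 + 4 * |ζ|) ≤ a) (hdet : r ⬝ᵥ crossProduct p q ≠ 0)
    (hp : (vecH p : ℝ) ≤ Real.exp a) (hq : (vecH q : ℝ) ≤ Real.exp ((g + δ) * a))
    (hr : (vecH r : ℝ) ≤ Real.exp ((g + 1 + δ) * a))
    (hvp : |ev ζ p| ≤ Real.exp (-(2 * g + 1 - δ) * a))
    (hvq : |ev ζ q| ≤ Real.exp (-(3 * g + 2 - δ) * a))
    (hvr : |ev ζ r| ≤ Real.exp (-(5 * g + 3 - δ) * a)) :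
    ¬ ratPoly r ∣ ratPoly p * ratPoly q := by
  have ha1 : 0 < a :=
    lt_of_lt_of_le (mul_pos two_pos (Real.log_pos (by linarith [abs_nonneg ζ]))) haζ
  obtain ⟨e, he⟩ : ∃ e, e = Real.exp (-(a / 2)) := ⟨_, rfl⟩
  have he0 : 0 < e := by rw [he]; exact Real.exp_pos _
  have he1 : (5 + 4 * |ζ|) * e < 1 := by
    have h1 : 6 + 4 * |ζ| ≤ Real.exp (a / 2) := by
      rw [← Real.log_le_iff_le_exp (by positivity)]
      linarith
    rw [he, Real.exp_neg, mul_inv_lt_iff₀ (Real.exp_pos _)]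
    linarith
  have hprod : ∀ {x y z s t u : ℝ}, 0 ≤ x → 0 ≤ y → 0 ≤ z → x ≤ Real.exp s → y ≤ Real.exp t →
      z ≤ Real.exp u → s + t + u ≤ -(a / 2) → x * (y * z) ≤ e := by
    intro x y z s t u hx hy hz hxs hyt hzu h
    rw [he]
    calc x * (y * z) ≤ Real.exp s * (Real.exp t * Real.exp u) := by gcongr
      _ = Real.exp (s + t + u) := by rw [Real.exp_add, Real.exp_add, mul_assoc]
      _ ≤ _ := Real.exp_le_exp.2 h
  have hH : ∀ w : Fin 3 → ℤ, (0 : ℝ) ≤ vecH w := fun w => Nat.cast_nonneg _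
  have hV : ∀ w : Fin 3 → ℤ, 0 ≤ |ev ζ w| := fun w => abs_nonneg _
  have b1 := hprod (hH q) (hH q) (hV p) hq hq hvp (by nlinarith)
  have b2 := hprod (hH p) (hH r) (hV q) hp hr hvq (by nlinarith)
  have b3 := hprod (hH p) (hH q) (hV r) hp hq hvr (by nlinarith)
  have b4 := hprod (hH p) (hH p) (hV q) hp hp hvq (by nlinarith)
  have hζ0 := abs_nonneg ζ
  exact ratPoly_not_dvd_mul ζ hdet (by nlinarith) (by nlinarith)
    (hvr.trans_lt (Real.exp_lt_one_iff.2 (by nlinarith)))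

/-- Triples of independent quadratic polynomials with the growth of `IsMinimalSeq.exists_triple`
produce good simultaneous approximations to the first four powers. -/
theorem mem_lamSet_of_triples {ζ g η : ℝ} (hζ : Transcendental ℚ ζ) (hg : g ^ 2 = g + 1)
    (hg1 : 1.6 < g) (hg2 : g < 1.7) (hη : 0 < η) (hηg : 2 * g * η < 1)
    (htriple : ∀ δ : ℝ, 0 < δ → δ ≤ 1 → ∀ A : ℝ,
      ∃ p q r : Fin 3 → ℤ, ∃ a ≥ A, r ⬝ᵥ crossProduct p q ≠ 0 ∧
        Real.log (vecH p) ≤ a ∧ Real.log (vecH q) ≤ (g + δ) * a ∧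
        Real.log (vecH r) ≤ (g ^ 2 + δ) * a ∧
        Real.log |ev ζ p| ≤ -(g ^ 3 - δ) * a ∧ Real.log |ev ζ q| ≤ -(g ^ 4 - δ) * a ∧
        Real.log |ev ζ r| ≤ -(g ^ 5 - δ) * a) : η ∈ lamSet 4 ζ := by
  intro X₀
  have hg3 : g ^ 3 = 2 * g + 1 := by linear_combination (g + 1) * hg
  have hg4 : g ^ 4 = 3 * g + 2 := by linear_combination (g ^ 2 + g + 2) * hg
  have hg5 : g ^ 5 = 5 * g + 3 := by linear_combination (g ^ 3 + g ^ 2 + 2 * g + 3) * hg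
  rw [hg3, hg4, hg5, hg] at htriple
  obtain ⟨c, hc⟩ : ∃ c, c = 2 * g - 4 * η * (g + 1) := ⟨_, rfl⟩
  have hc0 : 0 < c := by
    have : c = 2 * g * (1 - 2 * g * η) := by rw [hc]; linear_combination (4 * η) * hg
    rw [this]
    exact mul_pos (by linarith) (by linarith)
  have hη1 : η < 1 := by nlinarith
  obtain ⟨δ, hδ, hδ1, hδc⟩ : ∃ δ : ℝ, 0 < δ ∧ δ ≤ 1 / 10 ∧ 20 * δ ≤ c :=
    ⟨min (1 / 10) (c / 20), by positivity, min_le_left _ _,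
      by linarith [min_le_right (1 / 10) (c / 20)]⟩
  obtain ⟨Z, hZ⟩ : ∃ Z, Z = (1 + |ζ|) ^ 4 := ⟨_, rfl⟩
  have hZ0 : 0 < Z := by rw [hZ]; positivity
  have hZpow : ∀ i : Fin 5, |ζ| ^ (i : ℕ) ≤ Z := fun i => by
    rw [hZ]
    calc |ζ| ^ (i : ℕ) ≤ (1 + |ζ|) ^ (i : ℕ) := by gcongr; linarith
      _ ≤ _ := pow_le_pow_right₀ (by linarith [abs_nonneg ζ]) (by omega)
  obtain ⟨L, hL⟩ : ∃ L, L = Real.log (12960 * (Z + 1) * Z) + η * Real.log 9720 := ⟨_, rfl⟩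
  obtain ⟨p, q, r, a, ha, hdet, hp, hq, hr, hvp, hvq, hvr⟩ := htriple δ hδ (by linarith)
    (max (max 0 X₀) (max (2 * Real.log (6 + 4 * |ζ|)) (2 * L / c)))
  have ha0 : 0 ≤ a := (le_max_left 0 X₀).trans ((le_max_left _ _).trans ha)
  have haX : X₀ ≤ a := (le_max_right 0 X₀).trans ((le_max_left _ _).trans ha)
  have haζ := (le_max_left _ _).trans ((le_max_right _ _).trans ha)
  have haL := (le_max_right _ _).trans ((le_max_right _ _).trans ha)
  rw [div_le_iff₀ hc0] at haL
  have hr0 : r ≠ 0 := by rintro rfl; simp at hdet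
  have hp0 : p ≠ 0 := by rintro rfl; simp at hdet
  have hq0 : q ≠ 0 := by rintro rfl; simp at hdet
  have hHe : ∀ {w : Fin 3 → ℤ} {t : ℝ}, w ≠ 0 → Real.log (vecH w) ≤ t →
      (vecH w : ℝ) ≤ Real.exp t := fun hw h =>
    (Real.log_le_iff_le_exp (by exact_mod_cast one_le_vecH hw)).1 h
  have hve : ∀ {w : Fin 3 → ℤ} {t : ℝ}, w ≠ 0 → Real.log |ev ζ w| ≤ t →
      |ev ζ w| ≤ Real.exp t := fun hw h =>
    (Real.log_le_iff_le_exp (abs_pos.2 (ev_ne_zero hζ hw))).1 h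
  replace hp := hHe hp0 hp
  replace hq := hHe hq0 hq
  replace hr := hHe hr0 hr
  replace hvp := hve hp0 hvp
  replace hvq := hve hq0 hvq
  replace hvr := hve hr0 hvr
  have hdvd := ratPoly_not_dvd_mul_of_le_exp hg1 hg2 hδ hδ1 haζ hdet hp hq hr hvp hvq hvr
  obtain ⟨K, hK⟩ : ∃ K, K = 3 * Real.exp ((g + 1 + δ) * a) := ⟨_, rfl⟩
  obtain ⟨v, hv⟩ : ∃ v, v = Z * Real.exp (-(5 * g + 3 - 2 * δ) * a) := ⟨_, rfl⟩
  have hZ1 : 1 ≤ Z := by simpa using hZpow 0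
  obtain ⟨x, hx0, hxle, hx⟩ := exists_approx_of_triple (K := K) (v := v) hr0 hdvd hZpow
    (by rw [hK]; linarith [Real.exp_pos ((g + 1 + δ) * a)])
    (by
      rw [hK, mul_assoc]
      refine mul_le_mul_of_nonneg_left ?_ (by norm_num)
      calc (vecH p : ℝ) * vecH q ≤ Real.exp a * Real.exp ((g + δ) * a) := by gcongr
        _ = _ := by rw [← Real.exp_add]; ring_nf)
    (by
      rw [hv]
      gcongr
      exact hvr.trans (Real.exp_le_exp.2 (mul_le_mul_of_nonneg_right (by linarith) ha0)))
    (by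
      rw [hv]
      calc |ev ζ p| * |ev ζ q| ≤
          Real.exp (-(2 * g + 1 - δ) * a) * Real.exp (-(3 * g + 2 - δ) * a) := by gcongr
        _ = 1 * Real.exp (-(5 * g + 3 - 2 * δ) * a) := by
            rw [← Real.exp_add, one_mul]; ring_nf
        _ ≤ _ := by gcongr)
  have hX : 120 * K ^ 4 = 9720 * Real.exp (4 * ((g + 1 + δ) * a)) := by
    rw [hK, mul_pow, ← Real.exp_nat_mul]
    push_cast
    ring
  refine ⟨120 * K ^ 4, ?_, x 0, fun i => x i.succ, ?_, by exact_mod_cast hxle, fun i => ?_⟩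
  · rw [hX]
    have h1 := Real.add_one_le_exp (4 * ((g + 1 + δ) * a))
    have h2 := Real.exp_pos (4 * ((g + 1 + δ) * a))
    nlinarith
  · by_contra! h
    refine hx0 (funext fun i => ?_)
    refine Fin.cases h.1 (fun i => congrFun h.2 i) i
  · refine (hx i.succ).trans ?_
    have hl : 480 * (Z + 1) * K ^ 3 * v = Real.exp (Real.log (12960 * (Z + 1) * Z) +
        (3 * ((g + 1 + δ) * a) + -(5 * g + 3 - 2 * δ) * a)) := by
      rw [hK, hv, mul_pow, ← Real.exp_nat_mul, Real.exp_add, Real.exp_log (by positivity),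
        Real.exp_add]
      push_cast
      ring
    rw [hl, hX, Real.rpow_def_of_pos (by positivity), Real.log_mul (by norm_num)
      (Real.exp_pos _).ne', Real.log_exp]
    refine Real.exp_le_exp.2 ?_
    have h1 : c / 2 * a ≤ (c - 5 * δ - 4 * η * δ) * a :=
      mul_le_mul_of_nonneg_right (by linarith [mul_le_mul_of_nonneg_right hη1.le hδ.le]) ha0
    rw [hc] at h1 haL
    linarith

theorem extremal_lambda4_eq (ζ : ℝ) (hζ : IsExtremal ζ)
    (hw : wExp 4 ζ = 2 + Real.sqrt 5) :
    lamExp 4 ζ = (Real.sqrt 5 - 1) / 4 := by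
  obtain ⟨htr, hwh⟩ := hζ
  have h5 : √5 ^ 2 = 5 := Real.sq_sqrt (by norm_num)
  have h5l : 2.2 < √5 := by rw [Real.lt_sqrt] <;> norm_num
  have h5u : √5 < 2.3 := by rw [Real.sqrt_lt'] <;> norm_num
  have hwb : BddAbove (wSet 4 ζ) := bddAbove_of_sSup_ne_zero (by
    change wExp 4 ζ ≠ 0
    rw [hw]; linarith)
  have hwhn : (whSet 2 ζ).Nonempty := nonempty_of_sSup_ne_zero (by
    change whExp 2 ζ ≠ 0
    rw [hwh]; linarith)
  have hmem : ∀ η, 0 < η → η < (√5 - 1) / 4 → η ∈ lamSet 4 ζ := by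
    intro η hη hlt
    obtain ⟨g, hgdef⟩ : ∃ g, g = (1 + √5) / 2 := ⟨_, rfl⟩
    have hg : g ^ 2 = g + 1 := by rw [hgdef]; linear_combination h5 / 4
    have hg3 : g ^ 3 = 2 + √5 := by
      rw [show g ^ 3 = 2 * g + 1 by linear_combination (g + 1) * hg, hgdef]; ring
    have hwhg : whExp 2 ζ = g ^ 2 := by rw [hwh, hg, hgdef]; ring
    have hwhlt : ∀ ξ < g ^ 2, ∃ η ∈ whSet 2 ζ, ξ < η := fun ξ hξ =>
      exists_lt_of_lt_csSup hwhn (hξ.trans_eq hwhg.symm)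
    obtain ⟨η₁, hη₁, hη₁'⟩ := hwhlt 1 (by linarith)
    have hne0 : ∀ q : Fin 3 → ℤ, q ≠ 0 → ev ζ q ≠ 0 := fun q => ev_ne_zero htr
    obtain ⟨P, hP⟩ := exists_isMinimalSeq (exists_small_of_whSet hη₁'.le hη₁) hne0
    have hne : ∀ i, ev ζ (P i) ≠ 0 := fun i => hne0 _ (hP.ne_zero i)
    have hg1 : 1.6 < g := by linarith
    have hg2 : g < 1.7 := by linarith
    refine mem_lamSet_of_triples htr hg hg1 hg2 hη (by rw [hgdef]; nlinarith)
      fun δ hδ hδ1 A => hP.exists_triple hne hg hg1 hg2 (fun ε hε => ?_) (fun ε hε => ?_) hδ hδ1 A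
    · obtain ⟨η₂, hη₂, hη₂'⟩ := hwhlt (max 0 (g ^ 2 - ε)) (max_lt (by linarith) (by linarith))
      obtain ⟨T, hT⟩ := hP.log_ev_le_of_whSet hη₂' hη₂ hne
      refine ⟨T, fun t ht => le_trans (mul_le_mul_of_nonneg_right (le_max_right _ _) ?_) (hT t ht)⟩
      exact Real.log_natCast_nonneg _
    · refine hP.le_log_ev_of_notMem_wSet (n := 4) (by norm_num) (fun h => ?_) hne
      have : g ^ 3 + ε ≤ wExp 4 ζ := le_csSup hwb h
      linarith
  refine csSup_eq_of_forall_le_of_forall_lt_exists_gt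
    ⟨(√5 - 1) / 8, hmem _ (by linarith) (by linarith)⟩ (fun η hη => ?_) (fun η hη => ?_)
  · by_contra! hlt
    obtain ⟨ξ, hξ1, hξ2⟩ := exists_between (show 2 + √5 < 4 * η + 4 - 1 by linarith)
    have hξ : ξ ≤ wExp 4 ζ := le_csSup hwb
      (mem_wSet_of_mem_lamSet (by norm_num) htr (by linarith) hη (by push_cast; linarith))
    linarith
  · obtain ⟨ξ, hξ1, hξ2⟩ := exists_between (max_lt hη (show 0 < (√5 - 1) / 4 by linarith))
    exact ⟨ξ, hmem ξ ((le_max_right _ _).trans_lt hξ1) hξ2, (le_max_left _ _).trans_lt hξ1⟩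
end
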